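/- (Regular occurrence of small dissipation.) In the setting below, for every ε > 0 there exists T(ε) > 0 such that for every t ≥ 1, the infimum of δ_dissip(t') over t' ∈ [t, t+T(ε)] is at most ε. -/

import Mathlib

open Filter Topology Set MeasureTheory

noncomputable section

local notation "⟪" x ", " y "⟫" => @inner ℝ _ _ x y

abbrev Euc (n : ℕ) : Type := EuclideanSpace ℝ (Fin n)

variable {n : ℕ}

/-- Spatial partial derivative `u_r`. -/
def ur (u : ℝ → ℝ → Euc n) (r t : ℝ) : Euc n := deriv (fun s => u s t) r

/-- Second spatial partial derivative `u_rr`. -/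
def urr (u : ℝ → ℝ → Euc n) (r t : ℝ) : Euc n := deriv (fun s => ur u s t) r

/-- Time partial derivative `u_t`. -/
def ut (u : ℝ → ℝ → Euc n) (r t : ℝ) : Euc n := deriv (fun s => u r s) t

/-- Hessian (second differential) of the potential. -/
def hess (V : Euc n → ℝ) (x : Euc n) : Euc n →L[ℝ] Euc n := fderiv ℝ (gradient V) x

/-- Coercivity hypothesis. -/
def HCoerc (V : Euc n → ℝ) : Prop :=
  ∃ ε > (0:ℝ), ∃ R : ℝ, ∀ x : Euc n, R ≤ ‖x‖ → ε * ‖x‖ ^ 2 ≤ ⟪x, gradient V x⟫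

/-- The set of nondegenerate minimum points of `V`. -/
def MinSet (V : Euc n → ℝ) : Set (Euc n) :=
  {m | gradient V m = 0 ∧ ∀ v : Euc n, v ≠ 0 → 0 < ⟪v, hess V m v⟫}

/-- Data of the constants `λ_min`, `λ_max`, `d_Esc` from the paper, together with their
spectral characterizations. -/
structure EscData (n : ℕ) (V : Euc n → ℝ) where
  lmin : ℝ
  lmax : ℝ
  dEsc : ℝ
  lmin_pos : 0 < lmin
  dEsc_pos : 0 < dEsc
  lower : ∀ m ∈ MinSet V, ∀ v : Euc n, lmin * ‖v‖ ^ 2 ≤ ⟪v, hess V m v⟫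
  upper : ∀ m ∈ MinSet V, ∀ v : Euc n, ⟪v, hess V m v⟫ ≤ lmax * ‖v‖ ^ 2
  esc_lower : ∀ m ∈ MinSet V, ∀ x : Euc n, ‖x - m‖ ≤ dEsc →
    ∀ v : Euc n, lmin / 2 * ‖v‖ ^ 2 ≤ ⟪v, hess V x v⟫
  esc_upper : ∀ m ∈ MinSet V, ∀ x : Euc n, ‖x - m‖ ≤ dEsc →
    ∀ v : Euc n, ⟪v, hess V x v⟫ ≤ 2 * lmax * ‖v‖ ^ 2

/-- Radially symmetric solution of `u_t = -∇V(u) + ((d-1)/r) u_r + u_rr` with Neumann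
boundary condition at the origin. -/
structure IsRadialSolution (d : ℕ) (V : Euc n → ℝ) (u : ℝ → ℝ → Euc n) : Prop where
  diff_r : ∀ t > (0:ℝ), ∀ r : ℝ, DifferentiableAt ℝ (fun s => u s t) r
  diff_rr : ∀ t > (0:ℝ), ∀ r : ℝ, DifferentiableAt ℝ (fun s => ur u s t) r
  cont_rr : ∀ t > (0:ℝ), Continuous fun r => urr u r t
  diff_t : ∀ t > (0:ℝ), ∀ r : ℝ, DifferentiableAt ℝ (fun s => u r s) t
  cont_t : ∀ r : ℝ, ContinuousOn (fun s => ut u r s) (Ioi 0)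
  bounded : ∃ C : ℝ, ∀ r t : ℝ, 0 ≤ r → 0 < t →
    ‖u r t‖ + ‖ur u r t‖ + ‖urr u r t‖ + ‖ut u r t‖ ≤ C
  pde : ∀ r > (0:ℝ), ∀ t > (0:ℝ),
    ut u r t = -gradient V (u r t) + (((d : ℝ) - 1) / r) • ur u r t + urr u r t
  neumann : ∀ t > (0:ℝ), ur u 0 t = 0

/-- Profiles of fronts travelling at speed `c` connecting `um` to `up`
(nonconstant solutions of `φ'' = -cφ' + ∇V(φ)`). -/
def Phi (V : Euc n → ℝ) (c : ℝ) (um up : Euc n) : Set (ℝ → Euc n) :=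
  {φ | (∃ ξ₁ ξ₂ : ℝ, φ ξ₁ ≠ φ ξ₂) ∧
    (∀ ξ : ℝ, DifferentiableAt ℝ φ ξ) ∧ (∀ ξ : ℝ, DifferentiableAt ℝ (deriv φ) ξ) ∧
    (∀ ξ : ℝ, deriv (deriv φ) ξ = -(c • deriv φ ξ) + gradient V (φ ξ)) ∧
    Tendsto φ atBot (𝓝 um) ∧ Tendsto φ atTop (𝓝 up)}

/-- Fronts travelling at speed `c` invading the equilibrium `mp`. -/
def PhiInv (V : Euc n → ℝ) (c : ℝ) (mp : Euc n) : Set (ℝ → Euc n) :=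
  ⋃ mm ∈ MinSet V, Phi V c mm mp

/-- Normalized front profiles. -/
def PhiNorm (V : Euc n → ℝ) (dEsc c : ℝ) (mm mp : Euc n) : Set (ℝ → Euc n) :=
  {φ | φ ∈ Phi V c mm mp ∧ ‖φ 0 - mp‖ = dEsc ∧ ∀ ξ > (0:ℝ), ‖φ ξ - mp‖ < dEsc}

/-- Normalized front profiles invading `mp`. -/
def PhiNormInv (V : Euc n → ℝ) (dEsc c : ℝ) (mp : Euc n) : Set (ℝ → Euc n) :=
  ⋃ mm ∈ MinSet V, PhiNorm V dEsc c mm mp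

/-- Every critical point of `V` is nondegenerate. -/
def HNonDeg (V : Euc n → ℝ) : Prop :=
  ∀ x : Euc n, gradient V x = 0 → ∀ v : Euc n, hess V x v = 0 → v = 0

/-- Every front travelling at a positive speed and invading a minimum point is bistable. -/
def HOnlyBist (V : Euc n → ℝ) : Prop :=
  ∀ mp ∈ MinSet V, ∀ um : Euc n, gradient V um = 0 →
    ∀ c > (0:ℝ), (Phi V c um mp).Nonempty → um ∈ MinSet V

/-- The set of invading speeds has empty interior. -/
def HDiscVel (V : Euc n → ℝ) : Prop :=
  ∀ mp ∈ MinSet V, interior {c : ℝ | 0 ≤ c ∧ (PhiInv V c mp).Nonempty} = ∅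

/-- The set of initial values of normalized invading fronts is totally disconnected. -/
def HDiscFront (V : Euc n → ℝ) (dEsc : ℝ) : Prop :=
  ∀ mp ∈ MinSet V, ∀ c > (0:ℝ),
    IsTotallyDisconnected
      {p : Euc n × Euc n | ∃ φ ∈ PhiNormInv V dEsc c mp, p = (φ 0, deriv φ 0)}

/-- The generic hypotheses on the potential. -/
def HGen (V : Euc n → ℝ) (dEsc : ℝ) : Prop :=
  HNonDeg V ∧ HOnlyBist V ∧ HDiscVel V ∧ HDiscFront V dEsc

/-- The solution is stable at infinity, close to the minimum point `m`. -/
def StableAtInfinity (V : Euc n → ℝ) (u : ℝ → ℝ → Euc n) (m : Euc n) : Prop :=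
  m ∈ MinSet V ∧
    Tendsto (fun t => limsup (fun r => ‖u r t - m‖) atTop) atTop (𝓝 0)

/-- Propagating terrace of bistable fronts connecting `mLoc` to `mFar`. -/
def IsTerrace (V : Euc n → ℝ) (mLoc mFar : Euc n) (T : ℝ → ℝ → Euc n) : Prop :=
  ∃ (q : ℕ) (ms : ℕ → Euc n) (cs : ℕ → ℝ) (φs : ℕ → ℝ → Euc n) (rs : ℕ → ℝ → ℝ),
    ms 0 = mFar ∧ ms q = mLoc ∧ (∀ i, i ≤ q → ms i ∈ MinSet V) ∧
    (∀ i, i < q → V (ms (i + 1)) < V (ms i)) ∧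
    (∀ i, 1 ≤ i → i ≤ q → 0 < cs i) ∧
    (∀ i, 1 ≤ i → i + 1 ≤ q → cs (i + 1) ≤ cs i) ∧
    (∀ i, 1 ≤ i → i ≤ q → φs i ∈ Phi V (cs i) (ms i) (ms (i - 1))) ∧
    (∀ i, 1 ≤ i → i ≤ q →
      (∀ t : ℝ, 0 ≤ t → 0 ≤ rs i t) ∧ (∀ t : ℝ, DifferentiableAt ℝ (rs i) t) ∧
        Tendsto (deriv (rs i)) atTop (𝓝 (cs i))) ∧
    (∀ i, 1 ≤ i → i + 1 ≤ q → Tendsto (fun t => rs (i + 1) t - rs i t) atTop atTop) ∧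
    (∀ r t : ℝ, 0 ≤ r → 0 ≤ t →
      T r t = ms 0 + ∑ i ∈ Finset.Icc 1 q, (φs i (r - rs i t) - ms (i - 1)))

/-- Hypothesis `(H_hom)` unbundled: `u` is close to `m` on a growing interval around
`rHom t`, travelling at asymptotic speed `cHom`; closeness is measured in `H¹` norm. -/
def HHomWith (u : ℝ → ℝ → Euc n) (m : Euc n) (cHom : ℝ) (rHom : ℝ → ℝ) : Prop :=
  0 < cHom ∧ (∀ t : ℝ, DifferentiableAt ℝ rHom t) ∧
    Tendsto (deriv rHom) atTop (𝓝 cHom) ∧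
    ∀ L > (0:ℝ),
      Tendsto
        (fun t => ∫ r in (-L)..L,
          (‖u (rHom t + r) t - m‖ ^ 2 + ‖ur u (rHom t + r) t‖ ^ 2))
        atTop (𝓝 0)

/-- The set whose supremum defines the Escape point `r_Esc(t)`. -/
def rEscSet (u : ℝ → ℝ → Euc n) (m : Euc n) (dEsc : ℝ) (rHom : ℝ → ℝ) (t : ℝ) : Set ℝ :=
  {r | r ∈ Icc 0 (rHom t) ∧ ‖u r t - m‖ = dEsc}

/-- The Escape point `r_Esc(t)`. -/
def rEscF (u : ℝ → ℝ → Euc n) (m : Euc n) (dEsc : ℝ) (rHom : ℝ → ℝ) (t : ℝ) : ℝ :=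
  sSup (rEscSet u m dEsc rHom t)

/-- The upper limit mean speed `c_Esc` of the Escape point. -/
def cEscV (u : ℝ → ℝ → Euc n) (m : Euc n) (dEsc : ℝ) (rHom : ℝ → ℝ) : ℝ :=
  limsup (fun t => rEscF u m dEsc rHom t / t) atTop

/-- `q_hull`: minimal convexity of the lower quadratic hulls of `V` at minimum points. -/
def qHull (V : Euc n → ℝ) : ℝ :=
  sInf {q : ℝ | ∃ m ∈ MinSet V, ∃ x : Euc n, x ≠ m ∧ q = (V x - V m) / ‖x - m‖ ^ 2}

/-- The weight `w` of the energy in the firewall functionals. -/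
def wV (V : Euc n → ℝ) : ℝ := 1 / max 1 (-(4 * qHull V))

/-- The decay rate `κ₀`. -/
def kappa0 (lmin : ℝ) : ℝ := min (1 / 2) (lmin / 8)

/-- The "small curvature" radius `r_sc`. -/
def rsc (d : ℕ) (lmin : ℝ) : ℝ := max (2 * ((d : ℝ) - 1)) (8 * ((d : ℝ) - 1) / lmin)

/-- The weight function `T_ρ ψ₀`. -/
def Tpsi (d : ℕ) (lmin : ℝ) (ρ r : ℝ) : ℝ :=
  if r ≤ rsc d lmin then Real.exp (-(kappa0 lmin) * |r - ρ|) * (r / rsc d lmin) ^ (d - 1)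
  else Real.exp (-(kappa0 lmin) * |r - ρ|)

/-- The firewall functional `F₀` in the laboratory frame. -/
def F0 (V : Euc n → ℝ) (d : ℕ) (lmin : ℝ) (u : ℝ → ℝ → Euc n) (ρ t : ℝ) : ℝ :=
  ∫ r in Ioi (0:ℝ),
    Tpsi d lmin ρ r * (wV V * (‖ur u r t‖ ^ 2 / 2 + V (u r t)) + ‖u r t‖ ^ 2 / 2)

/-- The set `Σ₀(t)` where the solution Escapes at distance `dEsc` from the origin. -/
def Sigma0 (u : ℝ → ℝ → Euc n) (dEsc t : ℝ) : Set ℝ := {r | 0 ≤ r ∧ dEsc < ‖u r t‖}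

/-- The firewall differential inequality in the laboratory frame. -/
def FireIneq (V : Euc n → ℝ) (d : ℕ) (lmin dEsc : ℝ) (u : ℝ → ℝ → Euc n) (ν K : ℝ) : Prop :=
  ∀ ρ ≥ rsc d lmin, ∀ t > (0:ℝ),
    DifferentiableAt ℝ (fun s => F0 V d lmin u ρ s) t ∧
    deriv (fun s => F0 V d lmin u ρ s) t ≤
      -ν * F0 V d lmin u ρ t + K * ∫ r in Sigma0 u dEsc t, Tpsi d lmin ρ r

/-- The quantity `δ = d_Esc √(min(w/2,1/4)/(κ₀+1))`. -/
def deltaEsc (dEsc w κ₀ : ℝ) : ℝ := dEsc * Real.sqrt (min (w / 2) (1 / 4) / (κ₀ + 1))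

/-- The length `L₀`. -/
def L0c (κ₀ ν K δ : ℝ) : ℝ := κ₀⁻¹ * Real.log (16 * K / (ν * δ ^ 2 * κ₀))

/-- The no-escape speed `c_noesc`. -/
def cNoEsc (κ₀ K L₀ δ : ℝ) : ℝ := 8 * K * L₀ / (κ₀ * δ ^ 2)

/-- The no-escape hull `h`. -/
def hull (δ L₀ : ℝ) (x : ℝ) : EReal :=
  if x < 0 then ⊤
  else if x ≤ L₀ then ((δ ^ 2 / 2 * (1 - x / (2 * L₀)) : ℝ) : EReal)
  else ((δ ^ 2 / 4 : ℝ) : EReal)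

/-- The standing hypothesis that the firewall is below the two mirror hulls positioned
around `rHom t`. -/
def HullBound (V : Euc n → ℝ) (d : ℕ) (lmin : ℝ) (u : ℝ → ℝ → Euc n) (δ L₀ : ℝ)
    (rHom : ℝ → ℝ) : Prop :=
  ∀ t ≥ (0:ℝ), rsc d lmin ≤ rHom t - 1 ∧
    ∀ r ≥ rsc d lmin, ((F0 V d lmin u r t : ℝ) : EReal) ≤
      max (hull δ L₀ (r - (rHom t - 1))) (hull δ L₀ (rHom t - r))

/-- The set whose infimum defines the escape point `r_esc(t)`. -/
def rescSet (V : Euc n → ℝ) (d : ℕ) (lmin : ℝ) (u : ℝ → ℝ → Euc n) (δ L₀ : ℝ)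
    (rHom : ℝ → ℝ) (t : ℝ) : Set ℝ :=
  {rl | rl ∈ Icc (rsc d lmin) (rHom t) ∧
    ∀ r ≥ rsc d lmin, ((F0 V d lmin u r t : ℝ) : EReal) ≤
      max (hull δ L₀ (r - rl)) (hull δ L₀ (rHom t - r))}

/-- The escape point `r_esc(t)`. -/
def rescF (V : Euc n → ℝ) (d : ℕ) (lmin : ℝ) (u : ℝ → ℝ → Euc n) (δ L₀ : ℝ)
    (rHom : ℝ → ℝ) (t : ℝ) : ℝ :=
  sInf (rescSet V d lmin u δ L₀ rHom t)

/-- `c̄`: upper limit of mean variations of a function over time intervals of length `s`. -/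
def cbarF (f : ℝ → ℝ) : ℝ :=
  limsup (fun s => sSup {x : ℝ | ∃ t ≥ (0:ℝ), x = f (t + s) - f t} / s) atTop

/-- `c̲`: lower limit of mean variations of a function over time intervals of length `s`. -/
def cunderF (f : ℝ → ℝ) : ℝ :=
  liminf (fun s => sInf {x : ℝ | ∃ t ≥ (0:ℝ), x = f (t + s) - f t} / s) atTop

/-- The decay rate `κ` in the travelling frame. -/
def kappaTF (lmin cno : ℝ) : ℝ := min (1 / 4) (lmin / (16 * (cno + 1)))

/-- The cut-off speed `c_cut` in the travelling frame. -/
def ccutTF (lmin lmax cno : ℝ) : ℝ := min (lmin / (8 * lmax)) (lmin / (8 * (cno + 1)))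

/-- The energy weight `w'` in the travelling frame. -/
def wTF (V : Euc n → ℝ) (cno : ℝ) : ℝ := min (wV V) (1 / (cno + 1) ^ 2)

/-- The weight function `χ` of the localized energy in the travelling frame. -/
def chiTF (d : ℕ) (lmin lmax cno c xcut r0 : ℝ) (ρ s : ℝ) : ℝ :=
  if ρ ≤ -r0 - c * s + rsc d lmin then
    Real.exp (c * ρ) * ((r0 + c * s + ρ) / rsc d lmin) ^ (d - 1)
  else if ρ ≤ xcut + ccutTF lmin lmax cno * s then Real.exp (c * ρ)
  else
    Real.exp ((c + kappaTF lmin cno) * (xcut + ccutTF lmin lmax cno * s) -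
      kappaTF lmin cno * ρ)

/-- The weight function `ψ` of the firewall in the travelling frame. -/
def psiTF (d : ℕ) (lmin lmax cno c xcut r0 : ℝ) (ρ s : ℝ) : ℝ :=
  if ρ ≤ -r0 - c * s + rsc d lmin then
    Real.exp ((c + kappaTF lmin cno) * ρ -
        kappaTF lmin cno * (xcut + ccutTF lmin lmax cno * s)) *
      ((r0 + c * s + ρ) / rsc d lmin) ^ (d - 1)
  else if ρ ≤ xcut + ccutTF lmin lmax cno * s then
    Real.exp ((c + kappaTF lmin cno) * ρ -
      kappaTF lmin cno * (xcut + ccutTF lmin lmax cno * s))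
  else
    Real.exp ((c + kappaTF lmin cno) * (xcut + ccutTF lmin lmax cno * s) -
      kappaTF lmin cno * ρ)

/-- The firewall functional `F(s)` in the travelling frame. -/
def FTF (V : Euc n → ℝ) (d : ℕ) (lmin lmax cno : ℝ) (u : ℝ → ℝ → Euc n)
    (t0 c xcut r0 : ℝ) (s : ℝ) : ℝ :=
  ∫ ρ in Ioi (-r0 - c * s),
    psiTF d lmin lmax cno c xcut r0 ρ s *
      (wTF V cno *
          (‖ur u (r0 + c * s + ρ) (t0 + s)‖ ^ 2 / 2 + V (u (r0 + c * s + ρ) (t0 + s))) +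
        ‖u (r0 + c * s + ρ) (t0 + s)‖ ^ 2 / 2)

/-- The set `Σ(s)` where the solution Escapes, in the travelling frame. -/
def SigmaTF (u : ℝ → ℝ → Euc n) (d : ℕ) (lmin dEsc : ℝ) (t0 c r0 : ℝ) (s : ℝ) : Set ℝ :=
  {ρ | -r0 - c * s + rsc d lmin ≤ ρ ∧ dEsc < ‖u (r0 + c * s + ρ) (t0 + s)‖}

/-- The weight function `ψ̃` in the standing frame. -/
def psiSF (d : ℕ) (κ cm cp : ℝ) (r t : ℝ) : ℝ :=
  if r ≤ cm * t then r ^ (d - 1) * Real.exp (-κ * (cm * t - r))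
  else if r ≤ cp * t then r ^ (d - 1)
  else r ^ (d - 1) * Real.exp (-κ * (r - cp * t))

/-- The firewall functional `F̃` in the standing frame. -/
def FSF (V : Euc n → ℝ) (d : ℕ) (κ cm cp : ℝ) (u : ℝ → ℝ → Euc n) (t : ℝ) : ℝ :=
  ∫ r in Ioi (0:ℝ),
    psiSF d κ cm cp r t * (wV V * (‖ur u r t‖ ^ 2 / 2 + V (u r t)) + ‖u r t‖ ^ 2 / 2)

/-- The quantity `δ_dissip(t)` measuring the dissipation around the escape point. -/
def deltaDissip (u : ℝ → ℝ → Euc n) (re : ℝ → ℝ) (cesc : ℝ) (t : ℝ) : ℝ :=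
  sInf {ε : ℝ | 0 < ε ∧
    (∫ τ in (-1:ℝ)..1, ∫ ρ in (-(1/ε))..(1/ε),
      ‖ut u (re (t + τ) + ρ) (t + τ) + cesc • ur u (re (t + τ) + ρ) (t + τ)‖ ^ 2) ≤ ε}

/-- `u` solves the radially symmetric system with initial datum `u₀`, in the sense of the
semi-flow on bounded continuous functions (classical for positive times). -/
def SolvesWithInit (d : ℕ) (V : Euc n → ℝ) (u : ℝ → ℝ → Euc n) (u₀ : ℝ → Euc n) : Prop :=
  (∀ r : ℝ, 0 ≤ r → u r 0 = u₀ r) ∧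
  (∀ t : ℝ, 0 ≤ t → ContinuousOn (fun r => u r t) (Ici 0) ∧ ∃ C, ∀ r : ℝ, 0 ≤ r → ‖u r t‖ ≤ C) ∧
  (∀ t : ℝ, 0 ≤ t → ∀ ε > (0:ℝ), ∃ δ > (0:ℝ), ∀ t' : ℝ, 0 ≤ t' → |t' - t| ≤ δ →
    ∀ r : ℝ, 0 ≤ r → ‖u r t' - u r t‖ ≤ ε) ∧
  (∀ t > (0:ℝ), ∀ r > (0:ℝ),
    DifferentiableAt ℝ (fun s => u s t) r ∧ DifferentiableAt ℝ (fun s => ur u s t) r) ∧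
  (∀ t > (0:ℝ), ∀ r : ℝ, 0 ≤ r → DifferentiableAt ℝ (fun s => u r s) t) ∧
  (∀ t > (0:ℝ), ∀ r > (0:ℝ),
    ut u r t = -gradient V (u r t) + (((d : ℝ) - 1) / r) • ur u r t + urr u r t) ∧
  (∀ t > (0:ℝ), DifferentiableAt ℝ (fun s => u s t) 0 ∧ ur u 0 t = 0)

/-! ### The potential near its minimum points and at infinity -/

theorem contDiff_gradient {V : Euc n → ℝ} (hV : ContDiff ℝ 2 V) : ContDiff ℝ 1 (gradient V) := by
  have h : ContDiff ℝ 1 (fderiv ℝ V) := hV.fderiv_right (by norm_num)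
  exact (InnerProductSpace.toDual ℝ (Euc n)).symm.contDiff.comp h

theorem hasFDerivAt_gradient {V : Euc n → ℝ} (hV : ContDiff ℝ 2 V) (x : Euc n) :
    HasFDerivAt (gradient V) (hess V x) x :=
  ((contDiff_gradient hV).differentiable (by norm_num) x).hasFDerivAt

theorem hasDerivAt_comp_gradient {V : Euc n → ℝ} (hV : ContDiff ℝ 2 V) {f : ℝ → Euc n}
    {f' : Euc n} {s : ℝ} (hf : HasDerivAt f f' s) :
    HasDerivAt (fun s => V (f s)) ⟪gradient V (f s), f'⟫ s := by
  have h : HasFDerivAt V (fderiv ℝ V (f s)) (f s) :=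
    (hV.differentiable (by norm_num) (f s)).hasFDerivAt
  have := h.comp_hasDerivAt s hf
  rwa [← inner_gradient_left (𝕜 := ℝ)] at this

theorem hasDerivAt_line (m v : Euc n) (s : ℝ) : HasDerivAt (fun s : ℝ => m + s • v) v s := by
  simpa using ((hasDerivAt_id s).smul_const v).const_add m

theorem inner_gradient_ge_of_near_min {V : Euc n → ℝ} (hV : ContDiff ℝ 2 V) (D : EscData n V)
    {m x : Euc n} (hm : m ∈ MinSet V) (hx : ‖x - m‖ ≤ D.dEsc) :
    D.lmin / 2 * ‖x - m‖ ^ 2 ≤ ⟪x - m, gradient V x⟫ := by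
  set v := x - m with hv
  have hd : ∀ s : ℝ, HasDerivAt (fun s : ℝ => ⟪v, gradient V (m + s • v)⟫)
      ⟪v, hess V (m + s • v) v⟫ s := by
    intro s
    have h1 := (hasFDerivAt_gradient hV (m + s • v)).comp_hasDerivAt s (hasDerivAt_line m v s)
    simpa using (hasDerivAt_const s v).inner ℝ h1
  have hmono := Convex.mul_sub_le_image_sub_of_le_deriv (convex_Icc (0 : ℝ) 1)
    (f := fun s : ℝ => ⟪v, gradient V (m + s • v)⟫) (C := D.lmin / 2 * ‖v‖ ^ 2)
    (fun s _ => (hd s).continuousAt.continuousWithinAt)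
    (fun s _ => (hd s).differentiableAt.differentiableWithinAt)
    (fun s hs => by
      rw [interior_Icc] at hs
      rw [(hd s).deriv]
      refine D.esc_lower m hm _ ?_ v
      rw [add_sub_cancel_left, norm_smul, Real.norm_of_nonneg hs.1.le]
      nlinarith [hs.2, norm_nonneg v])
    0 (by simp) 1 (by simp) zero_le_one
  simp only [sub_zero, mul_one, one_smul, zero_smul, add_zero, hm.1, inner_zero_right] at hmono
  have : m + v = x := by simp [hv]
  rwa [this] at hmono

theorem le_of_near_min {V : Euc n → ℝ} (hV : ContDiff ℝ 2 V) (D : EscData n V)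
    {m x : Euc n} (hm : m ∈ MinSet V) (hx : ‖x - m‖ ≤ D.dEsc) : V m ≤ V x := by
  set v := x - m with hv
  have hd : ∀ s : ℝ, HasDerivAt (fun s : ℝ => V (m + s • v)) ⟪gradient V (m + s • v), v⟫ s :=
    fun s => hasDerivAt_comp_gradient hV (hasDerivAt_line m v s)
  have hmono := Convex.mul_sub_le_image_sub_of_le_deriv (convex_Icc (0 : ℝ) 1)
    (f := fun s : ℝ => V (m + s • v)) (C := 0)
    (fun s _ => (hd s).continuousAt.continuousWithinAt)
    (fun s _ => (hd s).differentiableAt.differentiableWithinAt)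
    (fun s hs => by
      rw [interior_Icc] at hs
      rw [(hd s).deriv]
      have h1 : ‖(m + s • v) - m‖ ≤ D.dEsc := by
        rw [add_sub_cancel_left, norm_smul, Real.norm_of_nonneg hs.1.le]
        nlinarith [hs.2, norm_nonneg v]
      have h2 := inner_gradient_ge_of_near_min hV D hm h1
      rw [add_sub_cancel_left, inner_smul_left, real_inner_comm] at h2
      have h3 : 0 ≤ D.lmin / 2 * ‖s • v‖ ^ 2 := by have := D.lmin_pos; positivity
      have h4 : 0 ≤ s * ⟪gradient V (m + s • v), v⟫ := by simpa using h3.trans h2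
      exact nonneg_of_mul_nonneg_right h4 hs.1)
    0 (by simp) 1 (by simp) zero_le_one
  have : m + v = x := by simp [hv]
  simpa [this] using hmono

theorem bddBelow_of_coercive {V : Euc n → ℝ} (hV : ContDiff ℝ 2 V) (hc : HCoerc V) :
    ∃ B : ℝ, ∀ x, B ≤ V x := by
  obtain ⟨ε, hε, R, hR⟩ := hc
  set R' := max R 1 with hR'
  have hR1 : 1 ≤ R' := le_max_right _ _
  obtain ⟨B, hB⟩ := (isCompact_closedBall (0 : Euc n) R').bddBelow_image hV.continuous.continuousOn
  refine ⟨B, fun x => ?_⟩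
  have hball : ∀ y : Euc n, ‖y‖ ≤ R' → B ≤ V y := fun y hy =>
    hB ⟨y, by simpa using hy, rfl⟩
  rcases le_or_gt ‖x‖ R' with hx | hx
  · exact hball x hx
  have hx0 : 0 < ‖x‖ := by linarith
  have hd : ∀ s : ℝ, HasDerivAt (fun s : ℝ => V (0 + s • x)) ⟪gradient V (0 + s • x), x⟫ s :=
    fun s => hasDerivAt_comp_gradient hV (hasDerivAt_line 0 x s)
  have hs1 : R' / ‖x‖ ≤ 1 := (div_le_one hx0).2 hx.le
  have hs0 : 0 < R' / ‖x‖ := by positivity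
  have hmono := Convex.mul_sub_le_image_sub_of_le_deriv (convex_Icc (R' / ‖x‖) 1)
    (f := fun s : ℝ => V (0 + s • x)) (C := 0)
    (fun s _ => (hd s).continuousAt.continuousWithinAt)
    (fun s _ => (hd s).differentiableAt.differentiableWithinAt)
    (fun s hs => by
      rw [interior_Icc] at hs
      rw [(hd s).deriv]
      have hspos : 0 < s := hs0.trans hs.1
      have h1 : R ≤ ‖s • x‖ := by
        rw [norm_smul, Real.norm_of_nonneg hspos.le]
        have := (div_lt_iff₀ hx0).1 hs.1
        exact (le_max_left R 1).trans this.le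
      have h2 := hR _ h1
      rw [inner_smul_left, real_inner_comm] at h2
      have h3 : 0 ≤ ε * ‖s • x‖ ^ 2 := by positivity
      have h4 : 0 ≤ s * ⟪gradient V (s • x), x⟫ := by simpa using h3.trans h2
      rw [zero_add]
      exact nonneg_of_mul_nonneg_right h4 hspos)
    (R' / ‖x‖) (by simpa using hs1) 1 (by simpa using hs1) hs1
  have h5 : V ((R' / ‖x‖) • x) ≤ V x := by simpa using hmono
  refine (hball _ ?_).trans h5
  rw [norm_smul, Real.norm_of_nonneg hs0.le, div_mul_cancel₀ _ hx0.ne']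

theorem qHull_le {V : Euc n → ℝ} (hV : ContDiff ℝ 2 V) (hc : HCoerc V) (D : EscData n V)
    {m x : Euc n} (hm : m ∈ MinSet V) (hx : x ≠ m) :
    qHull V ≤ (V x - V m) / ‖x - m‖ ^ 2 := by
  refine csInf_le ?_ ⟨m, hm, x, hx, rfl⟩
  obtain ⟨B, hB⟩ := bddBelow_of_coercive hV hc
  obtain ⟨ε, hε, R, hR⟩ := hc
  obtain ⟨A, hA⟩ := (isCompact_closedBall (0 : Euc n) R).bddAbove_image hV.continuous.continuousOn
  set A' := max A (V 0) with hA'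
  have hMb : ∀ m ∈ MinSet V, V m ≤ A' := by
    intro m hm
    rcases le_or_gt ‖m‖ R with h | h
    · exact (hA ⟨m, by simpa using h, rfl⟩).trans (le_max_left _ _)
    · have := hR m h.le
      rw [hm.1, inner_zero_right] at this
      have h0 : ‖m‖ ^ 2 ≤ 0 := by nlinarith
      have : m = 0 := by simpa using (pow_eq_zero_iff two_ne_zero).1 (le_antisymm h0 (by positivity))
      rw [this]; exact le_max_right _ _
  have hAB : B ≤ A' := (hB 0).trans (le_max_right _ _)
  refine ⟨(B - A') / D.dEsc ^ 2, ?_⟩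
  rintro q ⟨m, hm, x, hx, rfl⟩
  have hd := D.dEsc_pos
  have hxm : 0 < ‖x - m‖ := norm_pos_iff.2 (sub_ne_zero.2 hx)
  rcases le_or_gt ‖x - m‖ D.dEsc with h | h
  · have h1 := le_of_near_min hV D hm h
    have h2 : (B - A') / D.dEsc ^ 2 ≤ 0 := div_nonpos_of_nonpos_of_nonneg (by linarith) (by positivity)
    exact h2.trans (div_nonneg (by linarith) (by positivity))
  · rw [div_le_div_iff₀ (by positivity) (by positivity)]
    have h3 : B - A' ≤ V x - V m := by linarith [hB x, hMb m hm]
    have h4 : D.dEsc ^ 2 ≤ ‖x - m‖ ^ 2 := by gcongr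
    nlinarith [sq_nonneg D.dEsc]

theorem wV_pos (V : Euc n → ℝ) : 0 < wV V := by
  unfold wV; positivity

/-- The choice of `wV` makes the integrand of the firewall coercive. -/
theorem wV_mul_add_ge {V : Euc n → ℝ} (hV : ContDiff ℝ 2 V) (hc : HCoerc V) (D : EscData n V)
    (h0 : (0 : Euc n) ∈ MinSet V) (hV0 : V 0 = 0) (x : Euc n) :
    ‖x‖ ^ 2 / 4 ≤ wV V * V x + ‖x‖ ^ 2 / 2 := by
  rcases eq_or_ne x 0 with rfl | hx
  · simp [hV0]
  have h1 := qHull_le hV hc D h0 hx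
  rw [hV0, sub_zero, sub_zero] at h1
  have hx0 : 0 < ‖x‖ ^ 2 := by have := norm_pos_iff.2 hx; positivity
  rw [le_div_iff₀ hx0] at h1
  have hw := wV_pos V
  have h2 : -(1 / 4) ≤ wV V * qHull V := by
    unfold wV
    rw [div_mul_eq_mul_div, one_mul, le_div_iff₀ (by positivity)]
    have := le_max_right 1 (-(4 * qHull V))
    linarith
  nlinarith [mul_le_mul_of_nonneg_left h1 hw.le, mul_le_mul_of_nonneg_right h2 hx0.le]

/-- Quadratic bounds for the potential and its gradient on a ball around a critical point. -/
theorem exists_quadratic_bounds {V : Euc n → ℝ} (hV : ContDiff ℝ 2 V) (hV0 : V 0 = 0)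
    (hg : gradient V 0 = 0) (C : ℝ) :
    ∃ A : ℝ, 0 < A ∧ (∀ x y, ‖x‖ ≤ C → ‖y‖ ≤ C → ‖gradient V x - gradient V y‖ ≤ A * ‖x - y‖) ∧
      ∀ x, ‖x‖ ≤ C → |V x| ≤ A * ‖x‖ ^ 2 ∧ ‖gradient V x‖ ≤ A * ‖x‖ := by
  have hcont : Continuous (fun x => ‖fderiv ℝ (gradient V) x‖) :=
    ((contDiff_gradient hV).continuous_fderiv (by norm_num)).norm
  obtain ⟨A, hA⟩ := (isCompact_closedBall (0 : Euc n) C).bddAbove_image hcont.continuousOn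
  have hA' : ∀ x, ‖x‖ ≤ C → ‖fderiv ℝ (gradient V) x‖ ≤ max A 1 := fun x hx =>
    (hA ⟨x, by simpa using hx, rfl⟩).trans (le_max_left _ _)
  have hA0 : 0 < max A 1 := lt_max_of_lt_right one_pos
  have hlip : ∀ x y, ‖x‖ ≤ C → ‖y‖ ≤ C →
      ‖gradient V x - gradient V y‖ ≤ max A 1 * ‖x - y‖ := by
    intro x y hx hy
    refine (convex_closedBall (0 : Euc n) C).norm_image_sub_le_of_norm_fderiv_le
      (𝕜 := ℝ) (f := gradient V) (fun z _ => (contDiff_gradient hV).differentiable (by norm_num) z)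
      (fun z hz => hA' z (by simpa using hz)) (by simpa using hy) (by simpa using hx)
  have hgr : ∀ x, ‖x‖ ≤ C → ‖gradient V x‖ ≤ max A 1 * ‖x‖ := by
    intro x hx
    have hC : 0 ≤ C := (norm_nonneg x).trans hx
    simpa [hg] using hlip x 0 hx (by simpa using hC)
  refine ⟨max A 1, hA0, hlip, fun x hx => ⟨?_, hgr x hx⟩⟩
  have := (convex_closedBall (0 : Euc n) ‖x‖).norm_image_sub_le_of_norm_fderiv_le
      (𝕜 := ℝ) (f := V) (C := max A 1 * ‖x‖) (fun z _ => hV.differentiable (by norm_num) z)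
      (fun z hz => by
        have hz' : ‖z‖ ≤ ‖x‖ := by simpa using hz
        have h1 := hgr z (hz'.trans hx)
        rw [gradient, LinearIsometryEquiv.norm_map] at h1
        exact h1.trans (by gcongr)) (x := 0) (y := x) (by simp) (by simp)
  rw [hV0, sub_zero, sub_zero, Real.norm_eq_abs] at this
  nlinarith

/-! ### Regularity of radially symmetric solutions -/

/-- Uniform bound on a solution and on its first derivatives. -/
def SolBound (u : ℝ → ℝ → Euc n) (C : ℝ) : Prop :=
  0 < C ∧ ∀ r t : ℝ, 0 ≤ r → 0 < t →
    ‖u r t‖ ≤ C ∧ ‖ur u r t‖ ≤ C ∧ ‖urr u r t‖ ≤ C ∧ ‖ut u r t‖ ≤ C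

namespace IsRadialSolution

variable {d : ℕ} {V : Euc n → ℝ} {u : ℝ → ℝ → Euc n} {C : ℝ}

theorem exists_solBound (hu : IsRadialSolution d V u) : ∃ C, SolBound u C := by
  obtain ⟨C, hC⟩ := hu.bounded
  refine ⟨max C 1, lt_max_of_lt_right one_pos, fun r t hr ht => ?_⟩
  have h := (hC r t hr ht).trans (le_max_left C 1)
  have h1 := norm_nonneg (u r t)
  have h2 := norm_nonneg (ur u r t)
  have h3 := norm_nonneg (urr u r t)
  have h4 := norm_nonneg (ut u r t)
  refine ⟨?_, ?_, ?_, ?_⟩ <;> linarith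

theorem hasDerivAt_r (hu : IsRadialSolution d V u) {t : ℝ} (ht : 0 < t) (r : ℝ) :
    HasDerivAt (fun s => u s t) (ur u r t) r := (hu.diff_r t ht r).hasDerivAt

theorem hasDerivAt_rr (hu : IsRadialSolution d V u) {t : ℝ} (ht : 0 < t) (r : ℝ) :
    HasDerivAt (fun s => ur u s t) (urr u r t) r := (hu.diff_rr t ht r).hasDerivAt

theorem hasDerivAt_t (hu : IsRadialSolution d V u) {t : ℝ} (ht : 0 < t) (r : ℝ) :
    HasDerivAt (fun s => u r s) (ut u r t) t := (hu.diff_t t ht r).hasDerivAt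

theorem continuous_r (hu : IsRadialSolution d V u) {t : ℝ} (ht : 0 < t) :
    Continuous fun r => u r t :=
  continuous_iff_continuousAt.2 fun r => (hu.hasDerivAt_r ht r).continuousAt

theorem continuous_ur (hu : IsRadialSolution d V u) {t : ℝ} (ht : 0 < t) :
    Continuous fun r => ur u r t :=
  continuous_iff_continuousAt.2 fun r => (hu.hasDerivAt_rr ht r).continuousAt

theorem continuousOn_ut (hu : IsRadialSolution d V u) (hV : ContDiff ℝ 2 V) {t : ℝ} (ht : 0 < t) :
    ContinuousOn (fun r => ut u r t) (Ioi 0) := by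
  have h : ContinuousOn (fun r => -gradient V (u r t) + (((d : ℝ) - 1) / r) • ur u r t + urr u r t)
      (Ioi 0) := by
    have h1 : ContinuousOn (fun r : ℝ => ((d : ℝ) - 1) / r) (Ioi 0) :=
      continuousOn_const.div continuousOn_id fun r hr => (mem_Ioi.1 hr).ne'
    exact (((contDiff_gradient hV).continuous.comp (hu.continuous_r ht)).neg.continuousOn.add
      (h1.smul (hu.continuous_ur ht).continuousOn)).add (hu.cont_rr t ht).continuousOn
  exact h.congr fun r hr => hu.pde r hr t ht

theorem norm_ur_sub_le (hu : IsRadialSolution d V u) (hC : SolBound u C) {t : ℝ} (ht : 0 < t)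
    {r r' : ℝ} (hr : 0 ≤ r) (hr' : 0 ≤ r') : ‖ur u r' t - ur u r t‖ ≤ C * |r' - r| :=
  (convex_Ici (0 : ℝ)).norm_image_sub_le_of_norm_hasDerivWithin_le
    (f := fun s => ur u s t) (fun s _ => (hu.hasDerivAt_rr ht s).hasDerivWithinAt)
    (fun s hs => (hC.2 s t hs ht).2.2.1) hr hr'

theorem norm_r_sub_le (hu : IsRadialSolution d V u) (hC : SolBound u C) {t : ℝ} (ht : 0 < t)
    {r r' : ℝ} (hr : 0 ≤ r) (hr' : 0 ≤ r') : ‖u r' t - u r t‖ ≤ C * |r' - r| :=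
  (convex_Ici (0 : ℝ)).norm_image_sub_le_of_norm_hasDerivWithin_le
    (f := fun s => u s t) (fun s _ => (hu.hasDerivAt_r ht s).hasDerivWithinAt)
    (fun s hs => (hC.2 s t hs ht).2.1) hr hr'

theorem norm_t_sub_le (hu : IsRadialSolution d V u) (hC : SolBound u C) {r t t' : ℝ} (hr : 0 ≤ r)
    (ht : 0 < t) (ht' : 0 < t') : ‖u r t' - u r t‖ ≤ C * |t' - t| :=
  (convex_Ioi (0 : ℝ)).norm_image_sub_le_of_norm_hasDerivWithin_le
    (f := fun s => u r s) (fun _ hs => (hu.hasDerivAt_t hs r).hasDerivWithinAt)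
    (fun s hs => (hC.2 r s hr hs).2.2.2) ht ht'

theorem norm_taylor_le (hu : IsRadialSolution d V u) (hC : SolBound u C) {t : ℝ} (ht : 0 < t)
    {r r' : ℝ} (hr : 0 ≤ r) (hr' : 0 ≤ r') :
    ‖u r' t - u r t - (r' - r) • ur u r t‖ ≤ C * (r' - r) ^ 2 := by
  have hsub : ∀ s ∈ uIcc r r', 0 ≤ s := fun s hs => (le_min hr hr').trans hs.1
  have hd : ∀ s ∈ uIcc r r', HasDerivWithinAt (fun s => u s t - s • ur u r t)
      (ur u s t - (1 : ℝ) • ur u r t) (uIcc r r') s := fun s _ =>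
    ((hu.hasDerivAt_r ht s).sub ((hasDerivAt_id s).smul_const _)).hasDerivWithinAt
  have h := (convex_uIcc r r').norm_image_sub_le_of_norm_hasDerivWithin_le (C := C * |r' - r|) hd
    (fun s hs => by
      rw [one_smul]
      refine (hu.norm_ur_sub_le hC ht hr (hsub s hs)).trans ?_
      exact mul_le_mul_of_nonneg_left (abs_sub_left_of_mem_uIcc hs) hC.1.le)
    left_mem_uIcc right_mem_uIcc
  have e : u r' t - u r t - (r' - r) • ur u r t
      = (u r' t - r' • ur u r t) - (u r t - r • ur u r t) := by module
  rw [e]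
  refine h.trans (le_of_eq ?_)
  rw [Real.norm_eq_abs, mul_assoc, abs_mul_abs_self, sq]

theorem continuousAt_ur_t (hu : IsRadialSolution d V u) (hC : SolBound u C) {r t : ℝ} (hr : 0 ≤ r)
    (ht : 0 < t) : ContinuousAt (fun s => ur u r s) t := by
  rw [Metric.continuousAt_iff]
  intro ε hε
  have hC0 := hC.1
  set h := ε / (4 * C) with hh
  have hh0 : 0 < h := by positivity
  refine ⟨min t (h * ε / (4 * C)), lt_min ht (by positivity), fun {t'} htt' => ?_⟩
  rw [Real.dist_eq] at htt'
  have h1 : |t' - t| < t := htt'.trans_le (min_le_left _ _)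
  have h2 : |t' - t| < h * ε / (4 * C) := htt'.trans_le (min_le_right _ _)
  have ht' : 0 < t' := by have := (abs_lt.1 h1).1; linarith
  have hrh : 0 ≤ r + h := by linarith
  have a1 := hu.norm_taylor_le hC ht hr hrh
  have a2 := hu.norm_taylor_le hC ht' hr hrh
  have a3 := hu.norm_t_sub_le hC hr ht ht'
  have a4 := hu.norm_t_sub_le hC hrh ht ht'
  rw [add_sub_cancel_left] at a1 a2
  have key : h • (ur u r t' - ur u r t) = (u (r + h) t' - u (r + h) t) - (u r t' - u r t)
      + (u (r + h) t - u r t - h • ur u r t) - (u (r + h) t' - u r t' - h • ur u r t') := by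
    module
  have hn : h * ‖ur u r t' - ur u r t‖ ≤
      C * |t' - t| + C * |t' - t| + C * h ^ 2 + C * h ^ 2 := by
    calc h * ‖ur u r t' - ur u r t‖ = ‖h • (ur u r t' - ur u r t)‖ := by
          rw [norm_smul, Real.norm_of_nonneg hh0.le]
      _ ≤ _ := by
          rw [key]
          refine (norm_sub_le _ _).trans (add_le_add ((norm_add_le _ _).trans
            (add_le_add ((norm_sub_le _ _).trans (add_le_add a4 a3)) a1)) a2)
  rw [dist_eq_norm]
  have e1 : C * h = ε / 4 := by rw [hh]; field_simp
  have e2 : C * |t' - t| < h * ε / 4 := by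
    have := mul_lt_mul_of_pos_left h2 hC0
    have e : C * (h * ε / (4 * C)) = h * ε / 4 := by field_simp
    linarith
  have : h * ‖ur u r t' - ur u r t‖ < h * ε := by nlinarith
  exact lt_of_mul_lt_mul_left this hh0.le

theorem continuousAt_urr_t (hu : IsRadialSolution d V u) (hC : SolBound u C) (hV : ContDiff ℝ 2 V)
    {r t : ℝ} (hr : 0 < r) (ht : 0 < t) : ContinuousAt (fun s => urr u r s) t := by
  have h : ContinuousAt
      (fun s => ut u r s + gradient V (u r s) - (((d : ℝ) - 1) / r) • ur u r s) t := by
    have h1 : ContinuousAt (fun s => ut u r s) t := (hu.cont_t r).continuousAt (Ioi_mem_nhds ht)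
    have h2 : ContinuousAt (fun s => gradient V (u r s)) t :=
      (contDiff_gradient hV).continuous.continuousAt.comp
        (f := fun s => u r s) (hu.hasDerivAt_t ht r).continuousAt
    have h3 : Tendsto (fun s => (((d : ℝ) - 1) / r) • ur u r s) (𝓝 t)
        (𝓝 ((((d : ℝ) - 1) / r) • ur u r t)) :=
      Tendsto.const_smul (hu.continuousAt_ur_t hC hr.le ht) _
    exact (h1.add h2).sub h3
  refine h.congr ?_
  filter_upwards [Ioi_mem_nhds ht] with s hs
  rw [hu.pde r hr s hs]
  abel

end IsRadialSolution

/-! ### Time derivatives of weighted integrals along a solution -/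

/-- A weight depending on space and time, with its partial derivatives. -/
structure IsWeight (χ χr χt : ℝ → ℝ → ℝ) : Prop where
  hasDerivAt_r : ∀ r t, HasDerivAt (fun s => χ s t) (χr r t) r
  hasDerivAt_t : ∀ r t, HasDerivAt (fun s => χ r s) (χt r t) t
  continuous_r : Continuous fun p : ℝ × ℝ => χr p.1 p.2
  continuous_t : Continuous fun p : ℝ × ℝ => χt p.1 p.2
  continuous : Continuous fun p : ℝ × ℝ => χ p.1 p.2

theorem IsWeight.exists_bound {χ χr χt : ℝ → ℝ → ℝ} (h : IsWeight χ χr χt) (R1 R2 T1 T2 : ℝ) :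
    ∃ M, ∀ r ∈ Icc R1 R2, ∀ t ∈ Icc T1 T2, |χ r t| ≤ M ∧ |χr r t| ≤ M ∧ |χt r t| ≤ M := by
  have hK : IsCompact (Icc R1 R2 ×ˢ Icc T1 T2) := isCompact_Icc.prod isCompact_Icc
  obtain ⟨M1, h1⟩ := hK.exists_bound_of_continuousOn h.continuous.continuousOn
  obtain ⟨M2, h2⟩ := hK.exists_bound_of_continuousOn h.continuous_r.continuousOn
  obtain ⟨M3, h3⟩ := hK.exists_bound_of_continuousOn h.continuous_t.continuousOn
  refine ⟨max M1 (max M2 M3), fun r hr t ht => ⟨?_, ?_, ?_⟩⟩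
  · exact (h1 (r, t) ⟨hr, ht⟩).trans (le_max_left _ _)
  · exact (h2 (r, t) ⟨hr, ht⟩).trans ((le_max_left _ _).trans (le_max_right _ _))
  · exact (h3 (r, t) ⟨hr, ht⟩).trans ((le_max_right _ _).trans (le_max_right _ _))

theorem IsWeight.continuous_slice {χ χr χt : ℝ → ℝ → ℝ} (h : IsWeight χ χr χt) (t : ℝ) :
    Continuous fun r => χ r t := h.continuous.comp (by fun_prop : Continuous fun r : ℝ => (r, t))

theorem IsWeight.continuous_slice_r {χ χr χt : ℝ → ℝ → ℝ} (h : IsWeight χ χr χt) (t : ℝ) :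
    Continuous fun r => χr r t := h.continuous_r.comp (by fun_prop : Continuous fun r : ℝ => (r, t))

theorem IsWeight.continuous_slice_t {χ χr χt : ℝ → ℝ → ℝ} (h : IsWeight χ χr χt) (t : ℝ) :
    Continuous fun r => χt r t := h.continuous_t.comp (by fun_prop : Continuous fun r : ℝ => (r, t))

namespace IsRadialSolution

variable {d : ℕ} {V : Euc n → ℝ} {u : ℝ → ℝ → Euc n} {C : ℝ} {χ χr χt : ℝ → ℝ → ℝ}

theorem hasDerivAt_integral_weight_comp (hu : IsRadialSolution d V u) (hV : ContDiff ℝ 2 V)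
    (hC : SolBound u C) (hχ : IsWeight χ χr χt) {P : Euc n → ℝ} {g : Euc n → Euc n}
    (hg : Continuous g)
    (hP : ∀ (f : ℝ → Euc n) (f' : Euc n) (s : ℝ), HasDerivAt f f' s →
      HasDerivAt (fun s => P (f s)) ⟪g (f s), f'⟫ s) (hPc : Continuous P)
    {R1 R2 t : ℝ} (hR1 : 0 < R1) (hR : R1 ≤ R2) (ht : 0 < t) :
    HasDerivAt (fun s => ∫ r in R1..R2, χ r s * P (u r s))
      (∫ r in R1..R2, (χt r t * P (u r t) + χ r t * ⟪g (u r t), ut u r t⟫)) t := by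
  obtain ⟨M, hM⟩ := hχ.exists_bound R1 R2 (t / 2) (2 * t)
  obtain ⟨M1, hM1⟩ := (isCompact_closedBall (0 : Euc n) C).exists_bound_of_continuousOn
    hPc.continuousOn
  obtain ⟨M2, hM2⟩ := (isCompact_closedBall (0 : Euc n) C).exists_bound_of_continuousOn
    hg.continuousOn
  have hsub : uIoc R1 R2 ⊆ Icc R1 R2 := by
    rw [uIoc_of_le hR]; exact Ioc_subset_Icc_self
  refine (intervalIntegral.hasDerivAt_integral_of_dominated_loc_of_deriv_le
    (F := fun s r => χ r s * P (u r s))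
    (F' := fun s r => χt r s * P (u r s) + χ r s * ⟪g (u r s), ut u r s⟫)
    (bound := fun _ => M * M1 + M * (M2 * C))
    (s := Ioo (t / 2) (2 * t)) (Ioo_mem_nhds (by linarith) (by linarith)) ?_ ?_ ?_ ?_ ?_ ?_).2
  · filter_upwards [Ioi_mem_nhds ht] with s hs
    exact ((hχ.continuous_slice s).mul
      (hPc.comp (hu.continuous_r hs))).aestronglyMeasurable
  · exact ((hχ.continuous_slice t).mul (hPc.comp (hu.continuous_r ht))).intervalIntegrable _ _
  · have hc : ContinuousOn (fun r => χt r t * P (u r t) + χ r t * ⟪g (u r t), ut u r t⟫)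
        (Ioi 0) :=
      ((hχ.continuous_slice_t t).mul (hPc.comp (hu.continuous_r ht))).continuousOn.add
        ((hχ.continuous_slice t).continuousOn.mul
          ((hg.comp (hu.continuous_r ht)).continuousOn.inner (hu.continuousOn_ut hV ht)))
    exact (hc.mono fun r hr => hR1.trans_le (hsub hr).1).aestronglyMeasurable measurableSet_uIoc
  · refine ae_of_all _ fun r hr s hs => ?_
    have hr' := hsub hr
    obtain ⟨m1, -, m3⟩ := hM r hr' s ⟨hs.1.le, hs.2.le⟩
    have hs0 : 0 < s := by linarith [hs.1]
    obtain ⟨b1, -, -, b4⟩ := hC.2 r s (hR1.le.trans hr'.1) hs0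
    have hb : u r s ∈ Metric.closedBall (0 : Euc n) C := by simpa using b1
    have n1 := hM1 _ hb
    have n2 := hM2 _ hb
    have M0 : 0 ≤ M := (abs_nonneg _).trans m1
    refine (norm_add_le _ _).trans (add_le_add ?_ ?_)
    · rw [norm_mul]; exact mul_le_mul m3 n1 (norm_nonneg _) M0
    · rw [norm_mul]
      refine mul_le_mul m1 ((norm_inner_le_norm _ _).trans ?_) (norm_nonneg _) M0
      exact mul_le_mul n2 b4 (norm_nonneg _) ((norm_nonneg _).trans n2)
  · exact intervalIntegrable_const
  · refine ae_of_all _ fun r _ s hs => ?_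
    have hs0 : 0 < s := by linarith [hs.1]
    exact (hχ.hasDerivAt_t r s).mul (hP _ _ _ (hu.hasDerivAt_t hs0 r))

theorem hasDerivAt_integral_weight_ur_sq (hu : IsRadialSolution d V u) (hV : ContDiff ℝ 2 V)
    (hC : SolBound u C) (hχ : IsWeight χ χr χt) {R1 R2 t : ℝ} (hR1 : 0 < R1) (hR : R1 ≤ R2)
    (ht : 0 < t) :
    HasDerivAt (fun s => ∫ r in R1..R2, χ r s * (‖ur u r s‖ ^ 2 / 2))
      ((∫ r in R1..R2, (χt r t * (‖ur u r t‖ ^ 2 / 2)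
          - (χr r t * ⟪ur u r t, ut u r t⟫ + χ r t * ⟪urr u r t, ut u r t⟫)))
        + (χ R2 t * ⟪ur u R2 t, ut u R2 t⟫ - χ R1 t * ⟪ur u R1 t, ut u R1 t⟫)) t := by
  obtain ⟨M, hM⟩ := hχ.exists_bound R1 R2 (t / 2) (2 * t)
  have htI : t ∈ Icc (t / 2) (2 * t) := ⟨by linarith, by linarith⟩
  have hsub : uIoc R1 R2 ⊆ Icc R1 R2 := by
    rw [uIoc_of_le hR]; exact Ioc_subset_Icc_self
  have hpos : ∀ r ∈ Icc R1 R2, 0 < r := fun r hr => hR1.trans_le hr.1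
  have hnear : ∀ᶠ t' in 𝓝[≠] t, t' ∈ Ioo (t / 2) (2 * t) ∧ t' ≠ t :=
    (eventually_nhdsWithin_of_eventually_nhds
      (Ioo_mem_nhds (by linarith) (by linarith))).and self_mem_nhdsWithin
  rw [hasDerivAt_iff_tendsto_slope]
  set m : ℝ → ℝ → Euc n := fun t' r => (2⁻¹ : ℝ) • (ur u r t' + ur u r t) with hm
  set q : ℝ → ℝ → Euc n := fun t' r => (2⁻¹ : ℝ) • (urr u r t' + urr u r t) with hq
  set su : ℝ → ℝ → Euc n := fun t' r => slope (fun s => u r s) t t' with hsu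
  have hconv_su : ∀ r, Tendsto (fun t' => su t' r) (𝓝[≠] t) (𝓝 (ut u r t)) := fun r =>
    hasDerivAt_iff_tendsto_slope.1 (hu.hasDerivAt_t ht r)
  have hconv_m : ∀ r, 0 ≤ r → Tendsto (fun t' => m t' r) (𝓝[≠] t) (𝓝 (ur u r t)) := by
    intro r hr
    have h := ((hu.continuousAt_ur_t hC hr ht).tendsto.mono_left
      (nhdsWithin_le_nhds (s := {t}ᶜ))).add_const (ur u r t) |>.const_smul (2⁻¹ : ℝ)
    convert h using 2
    module
  have hconv_q : ∀ r, 0 < r → Tendsto (fun t' => q t' r) (𝓝[≠] t) (𝓝 (urr u r t)) := by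
    intro r hr
    have h := ((hu.continuousAt_urr_t hC hV hr ht).tendsto.mono_left
      (nhdsWithin_le_nhds (s := {t}ᶜ))).add_const (urr u r t) |>.const_smul (2⁻¹ : ℝ)
    convert h using 2
    module
  have hlim : Tendsto (fun t' => (∫ r in R1..R2, (slope (fun s => χ r s) t t' * (‖ur u r t'‖ ^ 2 / 2)
          - (χr r t * ⟪m t' r, su t' r⟫ + χ r t * ⟪q t' r, su t' r⟫)))
        + (χ R2 t * ⟪m t' R2, su t' R2⟫ - χ R1 t * ⟪m t' R1, su t' R1⟫)) (𝓝[≠] t)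
      (𝓝 ((∫ r in R1..R2, (χt r t * (‖ur u r t‖ ^ 2 / 2)
          - (χr r t * ⟪ur u r t, ut u r t⟫ + χ r t * ⟪urr u r t, ut u r t⟫)))
        + (χ R2 t * ⟪ur u R2 t, ut u R2 t⟫ - χ R1 t * ⟪ur u R1 t, ut u R1 t⟫))) := by
    refine Tendsto.add ?_ (Tendsto.sub
      (((hconv_m R2 (hR1.le.trans hR)).inner (hconv_su R2)).const_mul _)
      (((hconv_m R1 hR1.le).inner (hconv_su R1)).const_mul _))
    refine intervalIntegral.tendsto_integral_filter_of_dominated_convergence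
      (fun _ => M * (C ^ 2 / 2) + (M * (C * C) + M * (C * C))) ?_ ?_ intervalIntegrable_const ?_
    · filter_upwards [hnear] with t' ht'
      have ht'0 : 0 < t' := by linarith [ht'.1.1]
      have c1 : Continuous fun r => slope (fun s => χ r s) t t' := by
        simp only [slope_def_field]
        exact ((hχ.continuous_slice t').sub (hχ.continuous_slice t)).div_const _
      have c2 : Continuous fun r => su t' r := by
        simp only [hsu, slope_def_module]
        exact ((hu.continuous_r ht'0).sub (hu.continuous_r ht)).const_smul (t' - t)⁻¹
      have c3 : Continuous fun r => m t' r :=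
        ((hu.continuous_ur ht'0).add (hu.continuous_ur ht)).const_smul (2⁻¹ : ℝ)
      have c4 : Continuous fun r => q t' r :=
        ((hu.cont_rr t' ht'0).add (hu.cont_rr t ht)).const_smul (2⁻¹ : ℝ)
      exact ((c1.mul (((hu.continuous_ur ht'0).norm.pow 2).div_const 2)).sub
        (((hχ.continuous_slice_r t).mul (c3.inner c2)).add
          ((hχ.continuous_slice t).mul (c4.inner c2)))).aestronglyMeasurable
    · filter_upwards [hnear] with t' ht'
      refine ae_of_all _ fun r hr => ?_
      have hrI := hsub hr
      have hr0 := hpos r hrI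
      have ht'0 : 0 < t' := by linarith [ht'.1.1]
      have htt : 0 < |t' - t| := abs_pos.2 (sub_ne_zero.2 ht'.2)
      obtain ⟨a1, a2, a3⟩ := hM r hrI t htI
      have M0 : 0 ≤ M := (abs_nonneg _).trans a1
      have C0 := hC.1.le
      obtain ⟨-, b2, b3, -⟩ := hC.2 r t hr0.le ht
      obtain ⟨-, b2', b3', -⟩ := hC.2 r t' hr0.le ht'0
      have hsl : |slope (fun s => χ r s) t t'| ≤ M := by
        rw [slope_def_field, abs_div, div_le_iff₀ htt]
        exact (convex_Icc (t / 2) (2 * t)).norm_image_sub_le_of_norm_hasDerivWithin_le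
          (f := fun s => χ r s) (fun s _ => (hχ.hasDerivAt_t r s).hasDerivWithinAt)
          (fun s hs => (hM r hrI s hs).2.2) htI ⟨ht'.1.1.le, ht'.1.2.le⟩
      have hsu' : ‖su t' r‖ ≤ C := by
        simp only [hsu, slope_def_module]
        rw [norm_smul, norm_inv, Real.norm_eq_abs, inv_mul_le_iff₀ htt, mul_comm]
        exact hu.norm_t_sub_le hC hr0.le ht ht'0
      have hm' : ‖m t' r‖ ≤ C := by
        simp only [hm]
        rw [norm_smul, Real.norm_of_nonneg (by norm_num)]
        linarith [norm_add_le (ur u r t') (ur u r t)]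
      have hq' : ‖q t' r‖ ≤ C := by
        simp only [hq]
        rw [norm_smul, Real.norm_of_nonneg (by norm_num)]
        linarith [norm_add_le (urr u r t') (urr u r t)]
      refine (norm_sub_le _ _).trans (add_le_add ?_ ((norm_add_le _ _).trans (add_le_add ?_ ?_)))
      · rw [norm_mul]
        refine mul_le_mul hsl ?_ (norm_nonneg _) M0
        rw [Real.norm_of_nonneg (by positivity)]
        gcongr
      · rw [norm_mul]
        exact mul_le_mul a2 ((norm_inner_le_norm _ _).trans
          (mul_le_mul hm' hsu' (norm_nonneg _) C0)) (norm_nonneg _) M0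
      · rw [norm_mul]
        exact mul_le_mul a1 ((norm_inner_le_norm _ _).trans
          (mul_le_mul hq' hsu' (norm_nonneg _) C0)) (norm_nonneg _) M0
    · refine ae_of_all _ fun r hr => ?_
      have hr0 := hpos r (hsub hr)
      have h1 : Tendsto (fun t' => slope (fun s => χ r s) t t') (𝓝[≠] t) (𝓝 (χt r t)) :=
        hasDerivAt_iff_tendsto_slope.1 (hχ.hasDerivAt_t r t)
      have h2 := ((hu.continuousAt_ur_t hC hr0.le ht).tendsto.mono_left
        (nhdsWithin_le_nhds (s := {t}ᶜ)))
      exact (h1.mul ((h2.norm.pow 2).div_const 2)).sub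
        ((((hconv_m r hr0.le).inner (hconv_su r)).const_mul _).add
          (((hconv_q r hr0).inner (hconv_su r)).const_mul _))
  refine hlim.congr' ?_
  filter_upwards [hnear] with t' ht'
  have ht'0 : 0 < t' := by linarith [ht'.1.1]
  have htt : t' - t ≠ 0 := sub_ne_zero.2 ht'.2
  set Δ : ℝ → Euc n := fun r => (t' - t)⁻¹ • (ur u r t' - ur u r t) with hΔ
  have hder : ∀ r, HasDerivAt (fun r => χ r t * ⟪m t' r, su t' r⟫)
      (χr r t * ⟪m t' r, su t' r⟫ + χ r t * (⟪m t' r, Δ r⟫ + ⟪q t' r, su t' r⟫)) r := by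
    intro r
    have e1 : HasDerivAt (fun r => m t' r) (q t' r) r :=
      ((hu.hasDerivAt_rr ht'0 r).add (hu.hasDerivAt_rr ht r)).const_smul (2⁻¹ : ℝ)
    have e2 : HasDerivAt (fun r => su t' r) (Δ r) r := by
      simp only [hsu, slope_def_module]
      exact ((hu.hasDerivAt_r ht'0 r).sub (hu.hasDerivAt_r ht r)).const_smul (t' - t)⁻¹
    exact (hχ.hasDerivAt_r r t).mul (e1.inner ℝ e2)
  have c2 : Continuous fun r => su t' r := by
    simp only [hsu, slope_def_module]
    exact ((hu.continuous_r ht'0).sub (hu.continuous_r ht)).const_smul (t' - t)⁻¹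
  have c3 : Continuous fun r => m t' r :=
    ((hu.continuous_ur ht'0).add (hu.continuous_ur ht)).const_smul (2⁻¹ : ℝ)
  have c4 : Continuous fun r => q t' r :=
    ((hu.cont_rr t' ht'0).add (hu.cont_rr t ht)).const_smul (2⁻¹ : ℝ)
  have c5 : Continuous Δ := ((hu.continuous_ur ht'0).sub (hu.continuous_ur ht)).const_smul (t' - t)⁻¹
  have c6 : Continuous fun r => slope (fun s => χ r s) t t' * (‖ur u r t'‖ ^ 2 / 2) := by
    simp only [slope_def_field]
    exact (((hχ.continuous_slice t').sub (hχ.continuous_slice t)).div_const _).mul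
      (((hu.continuous_ur ht'0).norm.pow 2).div_const 2)
  have c7 := hχ.continuous_slice_r t
  have c8 := hχ.continuous_slice t
  have c9 := hχ.continuous_slice t'
  have hFTC := intervalIntegral.integral_eq_sub_of_hasDerivAt (a := R1) (b := R2)
    (fun r _ => hder r)
    (((c7.mul (c3.inner c2)).add (c8.mul ((c3.inner c5).add (c4.inner c2)))).intervalIntegrable _ _)
  rw [slope_def_field, ← hFTC, ← intervalIntegral.integral_add, ← intervalIntegral.integral_sub,
    div_eq_inv_mul, ← intervalIntegral.integral_const_mul]
  · refine intervalIntegral.integral_congr fun r _ => ?_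
    have e : ⟪m t' r, Δ r⟫ = (t' - t)⁻¹ * (‖ur u r t'‖ ^ 2 / 2 - ‖ur u r t‖ ^ 2 / 2) := by
      simp only [hΔ, hm, real_inner_smul_left, real_inner_smul_right, inner_add_left,
        inner_sub_right, real_inner_self_eq_norm_sq]
      rw [real_inner_comm (ur u r t) (ur u r t')]
      ring
    simp only [slope_def_field, e]
    field_simp
    ring
  · exact (c9.mul (((hu.continuous_ur ht'0).norm.pow 2).div_const 2)).intervalIntegrable _ _
  · exact (c8.mul (((hu.continuous_ur ht).norm.pow 2).div_const 2)).intervalIntegrable _ _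
  · exact (c6.sub ((c7.mul (c3.inner c2)).add (c8.mul (c4.inner c2)))).intervalIntegrable _ _
  · exact ((c7.mul (c3.inner c2)).add
      (c8.mul ((c3.inner c5).add (c4.inner c2)))).intervalIntegrable _ _

end IsRadialSolution

/-! ### Weight functions in a travelling frame -/

/-- Parameters of the weight functions: the speed `c` of the frame, the decay rate `κ`, the speed
`c₁` of the cut-off point, and the origins `a` of the frame and `b` of the cut-off point. -/
structure TravWeight where
  c : ℝ
  κ : ℝ
  c₁ : ℝ
  a : ℝ
  b : ℝ
  c_pos : 0 < c
  κ_pos : 0 < κ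
  κ_le : κ ≤ c

namespace TravWeight

variable (p : TravWeight)

/-- The exponential that detects the cut-off. -/
def cutExp (r t : ℝ) : ℝ := Real.exp (p.κ * (r - p.c₁ * t - p.b))

/-- The transition function from `0` (before the cut-off) to `1` (after it). -/
def sig (r t : ℝ) : ℝ := p.cutExp r t / (1 + p.cutExp r t)

/-- The weight of the energy. -/
def chi (r t : ℝ) : ℝ :=
  Real.exp (p.c * (r - p.c * t - p.a) - (p.c + p.κ) / p.κ * Real.log (1 + p.cutExp r t))

/-- The weight of the firewall. -/
def psi (r t : ℝ) : ℝ := p.sig r t * p.chi r t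

/-- The logarithmic space derivative of the weight of the firewall. -/
def rate (r t : ℝ) : ℝ := p.c + p.κ - (p.c + 2 * p.κ) * p.sig r t

/-- The maximal order of magnitude of the weight of the energy. -/
def top (t : ℝ) : ℝ := Real.exp (p.c * (p.c₁ * t + p.b - p.c * t - p.a))

theorem cutExp_pos (r t : ℝ) : 0 < p.cutExp r t := Real.exp_pos _

theorem chi_pos (r t : ℝ) : 0 < p.chi r t := Real.exp_pos _

theorem top_pos (t : ℝ) : 0 < p.top t := Real.exp_pos _

theorem sig_pos (r t : ℝ) : 0 < p.sig r t :=
  div_pos (p.cutExp_pos r t) (by linarith [p.cutExp_pos r t])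

theorem sig_lt_one (r t : ℝ) : p.sig r t < 1 := by
  rw [sig, div_lt_one (by linarith [p.cutExp_pos r t])]
  linarith [p.cutExp_pos r t]

theorem psi_pos (r t : ℝ) : 0 < p.psi r t := mul_pos (p.sig_pos r t) (p.chi_pos r t)

theorem psi_le_chi (r t : ℝ) : p.psi r t ≤ p.chi r t :=
  mul_le_of_le_one_left (p.chi_pos r t).le (p.sig_lt_one r t).le

theorem hasDerivAt_cutExp_r (r t : ℝ) :
    HasDerivAt (fun s => p.cutExp s t) (p.κ * p.cutExp r t) r := by
  have h : HasDerivAt (fun s => p.κ * (s - p.c₁ * t - p.b)) (p.κ * 1) r :=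
    (((hasDerivAt_id r).sub_const _).sub_const _).const_mul _
  exact h.exp.congr_deriv (by unfold cutExp; ring)

theorem hasDerivAt_cutExp_t (r t : ℝ) :
    HasDerivAt (fun s => p.cutExp r s) (-(p.κ * p.c₁) * p.cutExp r t) t := by
  have h : HasDerivAt (fun s => p.κ * (r - p.c₁ * s - p.b)) (p.κ * (-(p.c₁ * 1))) t :=
    ((((hasDerivAt_id t).const_mul _).const_sub _).sub_const _).const_mul _
  exact h.exp.congr_deriv (by unfold cutExp; ring)

theorem hasDerivAt_sig_r (r t : ℝ) :
    HasDerivAt (fun s => p.sig s t) (p.κ * p.sig r t * (1 - p.sig r t)) r := by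
  have h := p.hasDerivAt_cutExp_r r t
  have h0 : 1 + p.cutExp r t ≠ 0 := by linarith [p.cutExp_pos r t]
  refine (h.div (h.const_add 1) h0).congr_deriv ?_
  rw [sig]; field_simp

theorem hasDerivAt_sig_t (r t : ℝ) :
    HasDerivAt (fun s => p.sig r s) (-(p.κ * p.c₁) * p.sig r t * (1 - p.sig r t)) t := by
  have h := p.hasDerivAt_cutExp_t r t
  have h0 : 1 + p.cutExp r t ≠ 0 := by linarith [p.cutExp_pos r t]
  refine (h.div (h.const_add 1) h0).congr_deriv ?_
  rw [sig]; field_simp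
  ring

theorem hasDerivAt_chi_r (r t : ℝ) :
    HasDerivAt (fun s => p.chi s t) (p.chi r t * (p.c - (p.c + p.κ) * p.sig r t)) r := by
  have h := p.hasDerivAt_cutExp_r r t
  have h0 : 1 + p.cutExp r t ≠ 0 := by linarith [p.cutExp_pos r t]
  have h1 : HasDerivAt (fun s => p.c * (s - p.c * t - p.a)) (p.c * 1) r :=
    (((hasDerivAt_id r).sub_const _).sub_const _).const_mul _
  have h2 := (h1.sub (((h.const_add 1).log h0).const_mul ((p.c + p.κ) / p.κ))).exp
  refine h2.congr_deriv ?_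
  have := p.κ_pos.ne'
  simp only [Pi.sub_apply]
  rw [chi, sig]
  congr 1
  field_simp

theorem hasDerivAt_chi_t (r t : ℝ) :
    HasDerivAt (fun s => p.chi r s)
      (p.chi r t * (-p.c ^ 2 + (p.c + p.κ) * p.c₁ * p.sig r t)) t := by
  have h := p.hasDerivAt_cutExp_t r t
  have h0 : 1 + p.cutExp r t ≠ 0 := by linarith [p.cutExp_pos r t]
  have h1 : HasDerivAt (fun s => p.c * (r - p.c * s - p.a)) (p.c * (-(p.c * 1))) t :=
    ((((hasDerivAt_id t).const_mul _).const_sub _).sub_const _).const_mul _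
  have h2 := (h1.sub (((h.const_add 1).log h0).const_mul ((p.c + p.κ) / p.κ))).exp
  refine h2.congr_deriv ?_
  have := p.κ_pos.ne'
  simp only [Pi.sub_apply]
  rw [chi, sig]
  congr 1
  field_simp
  ring

theorem hasDerivAt_psi_r (r t : ℝ) :
    HasDerivAt (fun s => p.psi s t) (p.psi r t * p.rate r t) r := by
  refine ((p.hasDerivAt_sig_r r t).mul (p.hasDerivAt_chi_r r t)).congr_deriv ?_
  rw [psi, rate]; ring

theorem hasDerivAt_psi_t (r t : ℝ) :
    HasDerivAt (fun s => p.psi r s)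
      (p.psi r t * (-p.c * p.rate r t - (p.c₁ - p.c) * (p.rate r t - p.c))) t := by
  refine ((p.hasDerivAt_sig_t r t).mul (p.hasDerivAt_chi_t r t)).congr_deriv ?_
  rw [psi, rate]; ring

theorem hasDerivAt_psi_rr (r t : ℝ) :
    HasDerivAt (fun s => p.psi s t * p.rate s t)
      (p.psi r t * (p.rate r t ^ 2 -
        (p.c + 2 * p.κ) * p.κ * p.sig r t * (1 - p.sig r t))) r := by
  have h : HasDerivAt (fun s => p.rate s t)
      (-((p.c + 2 * p.κ) * (p.κ * p.sig r t * (1 - p.sig r t)))) r :=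
    ((p.hasDerivAt_sig_r r t).const_mul _).const_sub _
  refine ((p.hasDerivAt_psi_r r t).mul h).congr_deriv ?_
  ring

theorem continuous_cutExp : Continuous fun q : ℝ × ℝ => p.cutExp q.1 q.2 := by
  unfold cutExp; fun_prop

theorem continuous_sig : Continuous fun q : ℝ × ℝ => p.sig q.1 q.2 :=
  p.continuous_cutExp.div (continuous_const.add p.continuous_cutExp)
    fun q => (by linarith [p.cutExp_pos q.1 q.2] : (1 : ℝ) + p.cutExp q.1 q.2 ≠ 0)

theorem continuous_chi : Continuous fun q : ℝ × ℝ => p.chi q.1 q.2 := by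
  have h : Continuous fun q : ℝ × ℝ => Real.log (1 + p.cutExp q.1 q.2) :=
    (continuous_const.add p.continuous_cutExp).log fun q =>
      (by linarith [p.cutExp_pos q.1 q.2] : (1 : ℝ) + p.cutExp q.1 q.2 ≠ 0)
  unfold chi; fun_prop

theorem continuous_psi : Continuous fun q : ℝ × ℝ => p.psi q.1 q.2 :=
  p.continuous_sig.mul p.continuous_chi

theorem isWeight_chi : IsWeight p.chi (fun r t => p.chi r t * (p.c - (p.c + p.κ) * p.sig r t))
    (fun r t => p.chi r t * (-p.c ^ 2 + (p.c + p.κ) * p.c₁ * p.sig r t)) where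
  hasDerivAt_r := p.hasDerivAt_chi_r
  hasDerivAt_t := p.hasDerivAt_chi_t
  continuous := p.continuous_chi
  continuous_r := by have := p.continuous_sig; have := p.continuous_chi; fun_prop
  continuous_t := by have := p.continuous_sig; have := p.continuous_chi; fun_prop

theorem isWeight_psi : IsWeight p.psi (fun r t => p.psi r t * p.rate r t)
    (fun r t => p.psi r t * (-p.c * p.rate r t - (p.c₁ - p.c) * (p.rate r t - p.c))) where
  hasDerivAt_r := p.hasDerivAt_psi_r
  hasDerivAt_t := p.hasDerivAt_psi_t
  continuous := p.continuous_psi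
  continuous_r := by have := p.continuous_sig; have := p.continuous_psi; unfold rate; fun_prop
  continuous_t := by have := p.continuous_sig; have := p.continuous_psi; unfold rate; fun_prop

theorem neg_κ_le_rate (r t : ℝ) : -p.κ ≤ p.rate r t := by
  have := p.sig_lt_one r t
  have := p.c_pos
  have := p.κ_pos
  unfold rate; nlinarith

theorem rate_le (r t : ℝ) : p.rate r t ≤ p.c + p.κ := by
  have := p.sig_pos r t
  have := p.c_pos
  have := p.κ_pos
  unfold rate; nlinarith

theorem abs_rate_le (r t : ℝ) : |p.rate r t| ≤ p.c + p.κ :=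
  abs_le.2 ⟨by linarith [p.neg_κ_le_rate r t, p.c_pos], p.rate_le r t⟩

theorem rate_quadratic_le (hc₁ : p.c ≤ p.c₁) (r t : ℝ) :
    -p.c * p.rate r t - (p.c₁ - p.c) * (p.rate r t - p.c) + (p.rate r t ^ 2 -
        (p.c + 2 * p.κ) * p.κ * p.sig r t * (1 - p.sig r t))
      ≤ (p.c + p.κ) * (p.κ + (p.c₁ - p.c)) := by
  have h1 := p.neg_κ_le_rate r t
  have h2 := p.rate_le r t
  have h3 : 0 ≤ (p.c + 2 * p.κ) * p.κ * p.sig r t * (1 - p.sig r t) := by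
    have := p.sig_lt_one r t
    have := p.sig_pos r t
    have := p.c_pos
    have := p.κ_pos
    have : 0 ≤ 1 - p.sig r t := by linarith
    positivity
  have hc := p.c_pos
  have hκ := p.κ_pos
  set l := p.rate r t
  nlinarith [mul_nonneg (sub_nonneg.2 h1) (sub_nonneg.2 h2), mul_nonneg (sub_nonneg.2 hc₁) (sub_nonneg.2 h2),
    mul_nonneg (sub_nonneg.2 hc₁) (by linarith : 0 ≤ l + p.κ)]

theorem chi_le_exp (r t : ℝ) : p.chi r t ≤ Real.exp (p.c * (r - p.c * t - p.a)) := by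
  refine Real.exp_le_exp.2 (sub_le_self _ ?_)
  have := p.c_pos
  have := p.κ_pos
  have := Real.log_nonneg (by linarith [p.cutExp_pos r t] : 1 ≤ 1 + p.cutExp r t)
  positivity

theorem psi_le_exp (r t : ℝ) : p.psi r t ≤
    Real.exp (p.κ * (r - p.c₁ * t - p.b)) * Real.exp (p.c * (r - p.c * t - p.a)) := by
  refine mul_le_mul ?_ (p.chi_le_exp r t) (p.chi_pos r t).le (Real.exp_pos _).le
  exact div_le_self (p.cutExp_pos r t).le (by linarith [p.cutExp_pos r t])

theorem chi_le_top (r t : ℝ) :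
    p.chi r t ≤ p.top t * Real.exp (-p.κ * |r - (p.c₁ * t + p.b)|) := by
  rw [top, ← Real.exp_add]
  have hc := p.c_pos
  have hκ := p.κ_pos
  have hle := p.κ_le
  rcases le_total r (p.c₁ * t + p.b) with h | h
  · refine (p.chi_le_exp r t).trans (Real.exp_le_exp.2 ?_)
    rw [abs_of_nonpos (by linarith)]
    nlinarith
  · refine Real.exp_le_exp.2 ?_
    rw [abs_of_nonneg (by linarith)]
    have h1 : p.κ * (r - p.c₁ * t - p.b) ≤ Real.log (1 + p.cutExp r t) := by
      rw [Real.le_log_iff_exp_le (by linarith [p.cutExp_pos r t])]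
      change p.cutExp r t ≤ _
      linarith
    have h2 : (p.c + p.κ) * (r - p.c₁ * t - p.b)
        ≤ (p.c + p.κ) / p.κ * Real.log (1 + p.cutExp r t) := by
      calc _ = (p.c + p.κ) / p.κ * (p.κ * (r - p.c₁ * t - p.b)) := by field_simp
        _ ≤ _ := mul_le_mul_of_nonneg_left h1 (by positivity)
    nlinarith

theorem le_chi {r t : ℝ} (h : r ≤ p.c₁ * t + p.b) :
    Real.exp (-((p.c + p.κ) / p.κ)) * Real.exp (p.c * (r - p.c * t - p.a)) ≤ p.chi r t := by
  rw [← Real.exp_add]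
  refine Real.exp_le_exp.2 ?_
  have hc := p.c_pos
  have hκ := p.κ_pos
  have h0 := p.cutExp_pos r t
  have h1 : p.cutExp r t ≤ 1 := by
    rw [cutExp, Real.exp_le_one_iff]; nlinarith
  have h2 : Real.log (1 + p.cutExp r t) ≤ 1 := by
    have := Real.log_le_sub_one_of_pos (by linarith : 0 < 1 + p.cutExp r t)
    linarith
  have : (p.c + p.κ) / p.κ * Real.log (1 + p.cutExp r t) ≤ (p.c + p.κ) / p.κ * 1 :=
    mul_le_mul_of_nonneg_left h2 (by positivity)
  linarith

end TravWeight

theorem intervalIntegral_exp_neg_abs_le {μ : ℝ} (hμ : 0 < μ) (x : ℝ) {R1 R2 : ℝ} (hR : R1 ≤ R2) :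
    ∫ r in R1..R2, Real.exp (-μ * |r - x|) ≤ 2 / μ := by
  have key : ∀ a b : ℝ, a ≤ b → (0 ≤ a → ∫ r in a..b, Real.exp (-μ * |r|) ≤ 1 / μ) ∧
      (b ≤ 0 → ∫ r in a..b, Real.exp (-μ * |r|) ≤ 1 / μ) := by
    intro a b hab
    constructor
    · intro ha
      have e : ∫ r in a..b, Real.exp (-μ * |r|) = ∫ r in a..b, Real.exp (-μ * r) := by
        refine intervalIntegral.integral_congr fun r hr => ?_
        rw [uIcc_of_le hab] at hr
        simp only [abs_of_nonneg (ha.trans hr.1)]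
      rw [e, intervalIntegral.integral_comp_mul_left (fun r => Real.exp r) (neg_ne_zero.2 hμ.ne'),
        integral_exp, smul_eq_mul, div_eq_inv_mul]
      have h1 : Real.exp (-μ * a) ≤ 1 := Real.exp_le_one_iff.2 (by nlinarith)
      have h2 := Real.exp_pos (-μ * b)
      rw [inv_neg, mul_one]
      have := inv_pos.2 hμ
      nlinarith
    · intro hb
      have e : ∫ r in a..b, Real.exp (-μ * |r|) = ∫ r in a..b, Real.exp (μ * r) := by
        refine intervalIntegral.integral_congr fun r hr => ?_
        rw [uIcc_of_le hab] at hr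
        simp only [abs_of_nonpos (hr.2.trans hb)]
        congr 1; ring
      rw [e, intervalIntegral.integral_comp_mul_left (fun r => Real.exp r) hμ.ne',
        integral_exp, smul_eq_mul, div_eq_inv_mul]
      have h1 : Real.exp (μ * b) ≤ 1 := Real.exp_le_one_iff.2 (by nlinarith)
      have h2 := Real.exp_pos (μ * a)
      have := inv_pos.2 hμ
      nlinarith
  rw [intervalIntegral.integral_comp_sub_right (fun r => Real.exp (-μ * |r|)) x]
  set a := R1 - x
  set b := R2 - x
  have hab : a ≤ b := by simp only [a, b]; linarith
  have h2 : 2 / μ = 1 / μ + 1 / μ := by ring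
  have hpos : 0 < 1 / μ := by positivity
  rcases le_total 0 a with ha | ha
  · linarith [(key a b hab).1 ha]
  rcases le_total b 0 with hb | hb
  · linarith [(key a b hab).2 hb]
  have hintv : ∀ a b : ℝ, IntervalIntegrable (fun r => Real.exp (-μ * |r|)) volume a b :=
    fun a b => (by fun_prop : Continuous fun r : ℝ => Real.exp (-μ * |r|)).intervalIntegrable _ _
  rw [← intervalIntegral.integral_add_adjacent_intervals (hintv a 0) (hintv 0 b)]
  linarith [(key a 0 ha).2 le_rfl, (key 0 b hb).1 le_rfl]

/-! ### The localized energy in a travelling frame -/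

section pointwise

variable {c κ c₁ lam AV A k C χ σ S v : ℝ} {a p g y : Euc n}

/-- The part of the time derivative of the energy that is not a space derivative. -/
def energyRest (c κ c₁ A k χ σ S v : ℝ) (a p g y : Euc n) : ℝ :=
  -(χ * ‖y + c • p‖ ^ 2) + (c + κ) * (σ * χ) * (c₁ * (‖p‖ ^ 2 / 2 + v) + ⟪p, y⟫
    + c * (‖p‖ ^ 2 / 2 - v)) + χ * k * ⟪p, y + c • p⟫
    + A * (σ * χ * S / 2 * ‖a‖ ^ 2 - σ * χ * ‖p‖ ^ 2 + σ * χ * k * ⟪a, p⟫ - σ * χ * ⟪a, g⟫)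

theorem continuousOn_energyRest {s : Set ℝ} {k χ σ S v : ℝ → ℝ} {a p g y : ℝ → Euc n}
    (c κ c₁ A : ℝ) (hk : ContinuousOn k s) (hχ : ContinuousOn χ s) (hσ : ContinuousOn σ s)
    (hS : ContinuousOn S s) (hv : ContinuousOn v s) (ha : ContinuousOn a s)
    (hp : ContinuousOn p s) (hg : ContinuousOn g s) (hy : ContinuousOn y s) :
    ContinuousOn (fun r => energyRest c κ c₁ A (k r) (χ r) (σ r) (S r) (v r) (a r) (p r) (g r)
      (y r)) s := by
  have hY : ContinuousOn (fun r => y r + c • p r) s := hy.add (hp.const_smul c)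
  have i1 : ContinuousOn (fun r => ⟪p r, y r⟫) s := hp.inner hy
  have i2 : ContinuousOn (fun r => ⟪p r, y r + c • p r⟫) s := hp.inner hY
  have i3 : ContinuousOn (fun r => ⟪a r, p r⟫) s := ha.inner hp
  have i4 : ContinuousOn (fun r => ⟪a r, g r⟫) s := ha.inner hg
  unfold energyRest
  have n1 : ContinuousOn (fun r => ‖y r + c • p r‖) s := hY.norm
  have n2 : ContinuousOn (fun r => ‖p r‖) s := hp.norm
  have n3 : ContinuousOn (fun r => ‖a r‖) s := ha.norm
  refine ((((hχ.mul (n1.pow 2)).neg.add (((continuousOn_const.mul (hσ.mul hχ)).mul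
    (((continuousOn_const.mul (((n2.pow 2).div_const 2).add hv)).add i1).add
      (continuousOn_const.mul (((n2.pow 2).div_const 2).sub hv))))))).add
    ((hχ.mul hk).mul i2)).add (continuousOn_const.mul ?_)
  exact ((((((hσ.mul hχ).mul hS).div_const 2).mul (n3.pow 2)).sub
    ((hσ.mul hχ).mul (n2.pow 2))).add (((hσ.mul hχ).mul hk).mul i3)).sub ((hσ.mul hχ).mul i4)

theorem energyRest_curvature_le (hc : 0 < c) (hk : 0 ≤ k) (hχ : 0 < χ) (hσ : 0 < σ)
    (hσ1 : σ ≤ 1) (hA : 0 ≤ A) (ha : ‖a‖ ≤ C) (hp : ‖p‖ ≤ C) (hy : ‖y‖ ≤ C) :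
    χ * k * ⟪p, y + c • p⟫ + A * (σ * χ * k * ⟪a, p⟫) ≤ χ * k * ((1 + c + A) * C ^ 2) := by
  have C0 : 0 ≤ C := (norm_nonneg _).trans ha
  have h1 : ⟪p, y + c • p⟫ ≤ (1 + c) * C ^ 2 := by
    have hY : ‖y + c • p‖ ≤ (1 + c) * C := by
      refine (norm_add_le _ _).trans ?_
      rw [norm_smul, Real.norm_of_nonneg hc.le]
      nlinarith
    calc _ ≤ ‖p‖ * ‖y + c • p‖ := real_inner_le_norm _ _
      _ ≤ C * ((1 + c) * C) := mul_le_mul hp hY (norm_nonneg _) C0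
      _ = _ := by ring
  have h2 : σ * ⟪a, p⟫ ≤ C ^ 2 := by
    have h3 : ⟪a, p⟫ ≤ C ^ 2 := by
      calc _ ≤ ‖a‖ * ‖p‖ := real_inner_le_norm _ _
        _ ≤ C * C := mul_le_mul ha hp (norm_nonneg _) C0
        _ = _ := by ring
    nlinarith [sq_nonneg C]
  have hkχ : 0 ≤ χ * k := by positivity
  calc _ = χ * k * (⟪p, y + c • p⟫ + A * (σ * ⟪a, p⟫)) := by ring
    _ ≤ χ * k * ((1 + c) * C ^ 2 + A * C ^ 2) :=
      mul_le_mul_of_nonneg_left (add_le_add h1 (mul_le_mul_of_nonneg_left h2 hA)) hkχ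
    _ = _ := by ring

theorem energyRest_transport_le (hc : 0 < c) (hκ : 0 < κ) (hc₁ : c ≤ c₁) (hχ : 0 < χ)
    (hσ : 0 < σ) (hσ1 : σ ≤ 1) (hAV0 : 0 ≤ AV) (hv : |v| ≤ AV * ‖a‖ ^ 2) :
    (c + κ) * (σ * χ) * (c₁ * (‖p‖ ^ 2 / 2 + v) + ⟪p, y⟫ + c * (‖p‖ ^ 2 / 2 - v)) ≤
      χ * ‖y + c • p‖ ^ 2 / 4
        + σ * χ * (((c + κ) ^ 2 + (c + κ) * (c₁ + c₁ * AV)) * (‖p‖ ^ 2 + ‖a‖ ^ 2)) := by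
  have e : ⟪p, y⟫ = ⟪p, y + c • p⟫ - c * ‖p‖ ^ 2 := by
    rw [inner_add_right, real_inner_smul_right, real_inner_self_eq_norm_sq]; ring
  set Y := y + c • p
  have h1 : (c + κ) * ⟪p, Y⟫ ≤ (c + κ) ^ 2 * ‖p‖ ^ 2 + ‖Y‖ ^ 2 / 4 := by
    have := real_inner_le_norm p Y
    nlinarith [sq_nonneg ((c + κ) * ‖p‖ - ‖Y‖ / 2)]
  have hv1 := (abs_le.1 hv).1
  have hv2 := (abs_le.1 hv).2
  have h2 : (c₁ - c) * v ≤ c₁ * AV * ‖a‖ ^ 2 := by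
    have : 0 ≤ AV * ‖a‖ ^ 2 := (abs_nonneg _).trans hv
    nlinarith
  have hσχ : 0 < σ * χ := by positivity
  have h3 : σ * χ * (‖Y‖ ^ 2 / 4) ≤ χ * ‖Y‖ ^ 2 / 4 := by
    have : 0 ≤ χ * ‖Y‖ ^ 2 / 4 := by positivity
    nlinarith
  have h4 : (c + κ) * (c₁ * (‖p‖ ^ 2 / 2 + v) + ⟪p, y⟫ + c * (‖p‖ ^ 2 / 2 - v)) ≤
      ‖Y‖ ^ 2 / 4 + ((c + κ) ^ 2 + (c + κ) * c₁) * ‖p‖ ^ 2 + (c + κ) * (c₁ * AV * ‖a‖ ^ 2) := by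
    rw [e]
    have hp := sq_nonneg ‖p‖
    have h5 := mul_le_mul_of_nonneg_left h2 (by positivity : 0 ≤ c + κ)
    have h6 : 0 ≤ (c + κ) * c * ‖p‖ ^ 2 := by positivity
    have h7 : 0 ≤ (c + κ) * (c₁ * ‖p‖ ^ 2) := by
      have : 0 ≤ c₁ := hc.le.trans hc₁
      positivity
    nlinarith
  have h8 : ((c + κ) ^ 2 + (c + κ) * c₁) * ‖p‖ ^ 2 + (c + κ) * (c₁ * AV * ‖a‖ ^ 2) ≤
      ((c + κ) ^ 2 + (c + κ) * (c₁ + c₁ * AV)) * (‖p‖ ^ 2 + ‖a‖ ^ 2) := by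
    have c1 : 0 ≤ c₁ := hc.le.trans hc₁
    have : 0 ≤ (c + κ) * (c₁ * AV) * ‖p‖ ^ 2 := by positivity
    have : 0 ≤ ((c + κ) ^ 2 + (c + κ) * c₁) * ‖a‖ ^ 2 := by positivity
    nlinarith
  calc _ = σ * χ * ((c + κ) * (c₁ * (‖p‖ ^ 2 / 2 + v) + ⟪p, y⟫ + c * (‖p‖ ^ 2 / 2 - v))) := by ring
    _ ≤ σ * χ * (‖Y‖ ^ 2 / 4 + ((c + κ) ^ 2 + (c + κ) * (c₁ + c₁ * AV)) * (‖p‖ ^ 2 + ‖a‖ ^ 2)) :=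
      mul_le_mul_of_nonneg_left (by linarith) hσχ.le
    _ ≤ _ := by rw [mul_add]; linarith

/-- Coefficient of the firewall in the energy. -/
def energyCoef (c κ c₁ lam AV : ℝ) : ℝ :=
  ((c + κ) ^ 2 + (c + κ) * (c₁ + c₁ * AV)) * (1 + 4 / lam)

theorem energyRest_le_near (hc : 0 < c) (hκ : 0 < κ) (hc₁ : c ≤ c₁) (hlam : 0 < lam) (hk : 0 ≤ k)
    (hχ : 0 < χ) (hσ : 0 < σ) (hσ1 : σ ≤ 1) (hAV0 : 0 ≤ AV) (hv : |v| ≤ AV * ‖a‖ ^ 2)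
    (hA : A = energyCoef c κ c₁ lam AV) (hS : S ≤ lam / 2) (hag : lam / 2 * ‖a‖ ^ 2 ≤ ⟪a, g⟫)
    (ha : ‖a‖ ≤ C) (hp : ‖p‖ ≤ C) (hy : ‖y‖ ≤ C) :
    energyRest c κ c₁ A k χ σ S v a p g y ≤
      -(χ * ‖y + c • p‖ ^ 2 / 2) + χ * k * ((1 + c + A) * C ^ 2) := by
  have c1 : 0 ≤ c₁ := hc.le.trans hc₁
  have hA0 : 0 ≤ A := by rw [hA]; unfold energyCoef; positivity
  have h1 := energyRest_curvature_le hc hk hχ hσ hσ1 hA0 ha hp hy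
  have h2 := energyRest_transport_le (p := p) (y := y) hc hκ hc₁ hχ hσ hσ1 hAV0 hv
  set B := (c + κ) ^ 2 + (c + κ) * (c₁ + c₁ * AV)
  have hB : 0 ≤ B := by positivity
  have hA1 : B ≤ A := by
    rw [hA]; unfold energyCoef
    have : 0 ≤ 4 / lam := by positivity
    nlinarith
  have hA2 : B ≤ A * (lam / 4) := by
    have : A * (lam / 4) = B * (lam / 4) + B := by
      rw [hA]; unfold energyCoef; simp only [B]; field_simp
    rw [this]
    have : 0 ≤ B * (lam / 4) := by positivity
    linarith
  have hσχ : 0 < σ * χ := by positivity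
  have ha2 := sq_nonneg ‖a‖
  have h3 : B * (‖p‖ ^ 2 + ‖a‖ ^ 2) + A * (S / 2 * ‖a‖ ^ 2 - ‖p‖ ^ 2 - ⟪a, g⟫) ≤ 0 := by
    have e1 : S / 2 * ‖a‖ ^ 2 - ⟪a, g⟫ ≤ -(lam / 4) * ‖a‖ ^ 2 := by nlinarith
    have e2 := mul_le_mul_of_nonneg_left e1 hA0
    nlinarith [mul_le_mul_of_nonneg_right hA1 (sq_nonneg ‖p‖),
      mul_le_mul_of_nonneg_right hA2 (sq_nonneg ‖a‖)]
  have h4 := mul_nonpos_of_nonneg_of_nonpos hσχ.le h3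
  have h5 : 0 ≤ χ * ‖y + c • p‖ ^ 2 := by positivity
  unfold energyRest
  linarith

theorem energyRest_le_far (hc : 0 < c) (hκ : 0 < κ) (hc₁ : c ≤ c₁) (hlam : 0 < lam) (hk : 0 ≤ k)
    (hχ : 0 < χ) (hσ : 0 < σ) (hσ1 : σ ≤ 1) (hAV0 : 0 ≤ AV) (hv : |v| ≤ AV * ‖a‖ ^ 2)
    (hA : A = energyCoef c κ c₁ lam AV) (hS : S ≤ lam / 2) (hg : ‖g‖ ≤ AV * ‖a‖)
    (ha : ‖a‖ ≤ C) (hp : ‖p‖ ≤ C) (hy : ‖y‖ ≤ C) :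
    energyRest c κ c₁ A k χ σ S v a p g y ≤
      -(χ * ‖y + c • p‖ ^ 2 / 2) + χ * k * ((1 + c + A) * C ^ 2)
        + σ * χ * (A * (2 + lam + AV) * C ^ 2) := by
  have c1 : 0 ≤ c₁ := hc.le.trans hc₁
  have hA0 : 0 ≤ A := by rw [hA]; unfold energyCoef; positivity
  have h1 := energyRest_curvature_le hc hk hχ hσ hσ1 hA0 ha hp hy
  have h2 := energyRest_transport_le (p := p) (y := y) hc hκ hc₁ hχ hσ hσ1 hAV0 hv
  set B := (c + κ) ^ 2 + (c + κ) * (c₁ + c₁ * AV)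
  have hB : 0 ≤ B := by positivity
  have hA1 : B ≤ A := by
    rw [hA]; unfold energyCoef
    have : 0 ≤ 4 / lam := by positivity
    nlinarith
  have hσχ : 0 < σ * χ := by positivity
  have ha2 : ‖a‖ ^ 2 ≤ C ^ 2 := by gcongr
  have hp2 : ‖p‖ ^ 2 ≤ C ^ 2 := by gcongr
  have h3 : B * (‖p‖ ^ 2 + ‖a‖ ^ 2) + A * (S / 2 * ‖a‖ ^ 2 - ‖p‖ ^ 2 - ⟪a, g⟫)
      ≤ A * (2 + lam + AV) * C ^ 2 := by
    have e0 : -⟪a, g⟫ ≤ AV * C ^ 2 := by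
      have h := (abs_le.1 (abs_real_inner_le_norm a g)).1
      have h1 := mul_le_mul_of_nonneg_left hg (norm_nonneg a)
      have h2 := mul_le_mul_of_nonneg_left ha2 hAV0
      linarith
    have e1 : S / 2 * ‖a‖ ^ 2 ≤ lam * C ^ 2 := by
      have h1 := mul_le_mul_of_nonneg_right hS (sq_nonneg ‖a‖)
      have h2 := mul_le_mul_of_nonneg_left ha2 hlam.le
      have h3 : 0 ≤ lam * C ^ 2 := by positivity
      linarith
    have e2 : B * (‖p‖ ^ 2 + ‖a‖ ^ 2) ≤ A * (2 * C ^ 2) :=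
      mul_le_mul hA1 (by linarith) (by positivity) hA0
    have e3 : S / 2 * ‖a‖ ^ 2 - ‖p‖ ^ 2 - ⟪a, g⟫ ≤ lam * C ^ 2 + AV * C ^ 2 := by
      linarith [sq_nonneg ‖p‖]
    have e4 := mul_le_mul_of_nonneg_left e3 hA0
    linarith
  have h4 := mul_le_mul_of_nonneg_left h3 hσχ.le
  have h5 : 0 ≤ χ * ‖y + c • p‖ ^ 2 := by positivity
  unfold energyRest
  linarith

end pointwise

namespace TravWeight

/-- The localized energy in a travelling frame, combined with a firewall functional. -/
def energy (w : TravWeight) (V : Euc n → ℝ) (u : ℝ → ℝ → Euc n) (A R1 R2 t : ℝ) : ℝ :=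
  (∫ r in R1..R2, w.chi r t * (‖ur u r t‖ ^ 2 / 2)) + (∫ r in R1..R2, w.chi r t * V (u r t))
    + A * ∫ r in R1..R2, w.psi r t * (‖u r t‖ ^ 2 / 2)

/-- The flux of the energy. -/
def flux (w : TravWeight) (V : Euc n → ℝ) (u : ℝ → ℝ → Euc n) (A r t : ℝ) : ℝ :=
  w.c * w.chi r t * (‖ur u r t‖ ^ 2 / 2 - V (u r t))
    + A * (w.psi r t * ⟪u r t, ur u r t⟫ - w.psi r t * w.rate r t * (‖u r t‖ ^ 2 / 2))
    + w.chi r t * ⟪ur u r t, ut u r t⟫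

variable {d : ℕ} {V : Euc n → ℝ} {u : ℝ → ℝ → Euc n} {C : ℝ}

theorem hasDerivAt_energy (w : TravWeight) (hu : IsRadialSolution d V u) (hV : ContDiff ℝ 2 V)
    (hC : SolBound u C) (A : ℝ) {R1 R2 t : ℝ} (hR1 : 0 < R1) (hR : R1 ≤ R2) (ht : 0 < t) :
    ContinuousOn (fun r => energyRest w.c w.κ w.c₁ A (((d : ℝ) - 1) / r) (w.chi r t) (w.sig r t)
        (-w.c * w.rate r t - (w.c₁ - w.c) * (w.rate r t - w.c) + (w.rate r t ^ 2 -
        (w.c + 2 * w.κ) * w.κ * w.sig r t * (1 - w.sig r t)))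
        (V (u r t)) (u r t) (ur u r t) (gradient V (u r t)) (ut u r t)) (Ioi 0) ∧
    HasDerivAt (fun s => w.energy V u A R1 R2 s)
      ((∫ r in R1..R2, energyRest w.c w.κ w.c₁ A (((d : ℝ) - 1) / r) (w.chi r t) (w.sig r t)
        (-w.c * w.rate r t - (w.c₁ - w.c) * (w.rate r t - w.c) + (w.rate r t ^ 2 -
        (w.c + 2 * w.κ) * w.κ * w.sig r t * (1 - w.sig r t)))
        (V (u r t)) (u r t) (ur u r t) (gradient V (u r t)) (ut u r t))
        + (w.flux V u A R2 t - w.flux V u A R1 t)) t := by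
  have hχ := w.isWeight_chi
  have hψ := w.isWeight_psi
  have cχ := hχ.continuous_slice t
  have cψ := hψ.continuous_slice t
  have cσ : Continuous fun r => w.sig r t :=
    w.continuous_sig.comp (by fun_prop : Continuous fun r : ℝ => (r, t))
  have cl : Continuous fun r => w.rate r t := by unfold rate; fun_prop
  have cu := hu.continuous_r ht
  have cur := hu.continuous_ur ht
  have curr := hu.cont_rr t ht
  have cut := hu.continuousOn_ut hV ht
  have cV : Continuous fun r => V (u r t) := hV.continuous.comp cu
  have cg : Continuous fun r => gradient V (u r t) := (contDiff_gradient hV).continuous.comp cu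
  have ck : ContinuousOn (fun r : ℝ => ((d : ℝ) - 1) / r) (Ioi 0) :=
    continuousOn_const.div continuousOn_id fun r hr => (mem_Ioi.1 hr).ne'
  have hI : Icc R1 R2 ⊆ Ioi 0 := fun r hr => hR1.trans_le hr.1
  have hrest : ContinuousOn (fun r => energyRest w.c w.κ w.c₁ A (((d : ℝ) - 1) / r) (w.chi r t)
        (w.sig r t)
        (-w.c * w.rate r t - (w.c₁ - w.c) * (w.rate r t - w.c) + (w.rate r t ^ 2 -
        (w.c + 2 * w.κ) * w.κ * w.sig r t * (1 - w.sig r t)))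
        (V (u r t)) (u r t) (ur u r t) (gradient V (u r t)) (ut u r t)) (Ioi 0) := by
    have cS : Continuous fun r => -w.c * w.rate r t - (w.c₁ - w.c) * (w.rate r t - w.c)
        + (w.rate r t ^ 2 - (w.c + 2 * w.κ) * w.κ * w.sig r t * (1 - w.sig r t)) := by fun_prop
    exact continuousOn_energyRest _ _ _ _ ck cχ.continuousOn cσ.continuousOn cS.continuousOn
      cV.continuousOn cu.continuousOn cur.continuousOn cg.continuousOn cut
  refine ⟨hrest, ?_⟩
  have h1 := hu.hasDerivAt_integral_weight_ur_sq hV hC hχ hR1 hR ht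
  have h2 := hu.hasDerivAt_integral_weight_comp hV hC hχ (contDiff_gradient hV).continuous
    (fun f f' s hf => hasDerivAt_comp_gradient hV hf) hV.continuous hR1 hR ht
  have h3 := hu.hasDerivAt_integral_weight_comp hV hC hψ (P := fun x => ‖x‖ ^ 2 / 2) (g := id)
    continuous_id (fun f f' s hf => (hf.norm_sq.div_const 2).congr_deriv (by simp))
    (by fun_prop) hR1 hR ht
  refine ((h1.add h2).add (h3.const_mul A)).congr_deriv ?_
  have hflux : ∀ r, HasDerivAt (fun r => w.c * w.chi r t * (‖ur u r t‖ ^ 2 / 2 - V (u r t))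
      + A * (w.psi r t * ⟪u r t, ur u r t⟫ - w.psi r t * w.rate r t * (‖u r t‖ ^ 2 / 2)))
      (w.c * (w.chi r t * (w.c - (w.c + w.κ) * w.sig r t)) * (‖ur u r t‖ ^ 2 / 2 - V (u r t))
        + w.c * w.chi r t * (⟪ur u r t, urr u r t⟫ - ⟪gradient V (u r t), ur u r t⟫)
        + A * (w.psi r t * w.rate r t * ⟪u r t, ur u r t⟫
          + w.psi r t * (⟪u r t, urr u r t⟫ + ⟪ur u r t, ur u r t⟫)
          - (w.psi r t * (w.rate r t ^ 2 - (w.c + 2 * w.κ) * w.κ * w.sig r t * (1 - w.sig r t))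
            * (‖u r t‖ ^ 2 / 2) + w.psi r t * w.rate r t * ⟪u r t, ur u r t⟫))) r := by
    intro r
    have d1 := hu.hasDerivAt_r ht r
    have d2 := hu.hasDerivAt_rr ht r
    have d3 : HasDerivAt (fun r => ‖u r t‖ ^ 2 / 2) ⟪u r t, ur u r t⟫ r :=
      (d1.norm_sq.div_const 2).congr_deriv (by simp)
    have d4 : HasDerivAt (fun r => ‖ur u r t‖ ^ 2 / 2) ⟪ur u r t, urr u r t⟫ r :=
      (d2.norm_sq.div_const 2).congr_deriv (by simp)
    exact (((w.hasDerivAt_chi_r r t).const_mul w.c).mul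
      (d4.sub (hasDerivAt_comp_gradient hV d1))).add
      ((((w.hasDerivAt_psi_r r t).mul (d1.inner ℝ d2)).sub
        ((w.hasDerivAt_psi_rr r t).mul d3)).const_mul A)
  have i3 : Continuous (fun r => ⟪u r t, ur u r t⟫) := cu.inner cur
  have i5 : Continuous (fun r => ⟪ur u r t, urr u r t⟫) := cur.inner curr
  have i6 : Continuous (fun r => ⟪gradient V (u r t), ur u r t⟫) := cg.inner cur
  have i7 : Continuous (fun r => ⟪u r t, urr u r t⟫) := cu.inner curr
  have i8 : Continuous (fun r => ⟪ur u r t, ur u r t⟫) := cur.inner cur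
  have i1 : ContinuousOn (fun r => ⟪ur u r t, ut u r t⟫) (Ioi 0) := cur.continuousOn.inner cut
  have i9 : ContinuousOn (fun r => ⟪urr u r t, ut u r t⟫) (Ioi 0) := curr.continuousOn.inner cut
  have i10 : ContinuousOn (fun r => ⟪gradient V (u r t), ut u r t⟫) (Ioi 0) :=
    cg.continuousOn.inner cut
  have i11 : ContinuousOn (fun r => ⟪u r t, ut u r t⟫) (Ioi 0) := cu.continuousOn.inner cut
  have hFTC := intervalIntegral.integral_eq_sub_of_hasDerivAt (a := R1) (b := R2)
    (fun r _ => hflux r) (Continuous.intervalIntegrable (by fun_prop) _ _)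
  have hintv : ∀ {f : ℝ → ℝ}, ContinuousOn f (Ioi 0) → IntervalIntegrable f volume R1 R2 :=
    fun hf => (hf.mono (by rw [uIcc_of_le hR]; exact hI)).intervalIntegrable
  have e : w.flux V u A R2 t - w.flux V u A R1 t =
      ((w.c * w.chi R2 t * (‖ur u R2 t‖ ^ 2 / 2 - V (u R2 t))
      + A * (w.psi R2 t * ⟪u R2 t, ur u R2 t⟫ - w.psi R2 t * w.rate R2 t * (‖u R2 t‖ ^ 2 / 2)))
      - (w.c * w.chi R1 t * (‖ur u R1 t‖ ^ 2 / 2 - V (u R1 t))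
      + A * (w.psi R1 t * ⟪u R1 t, ur u R1 t⟫ - w.psi R1 t * w.rate R1 t * (‖u R1 t‖ ^ 2 / 2))))
      + (w.chi R2 t * ⟪ur u R2 t, ut u R2 t⟫ - w.chi R1 t * ⟪ur u R1 t, ut u R1 t⟫) := by
    unfold flux; ring
  rw [e, ← hFTC]
  suffices h : ∀ a b c d e f : ℝ, a + c + d = e + f → a + b + c + d = e + (f + b) from
    h _ _ _ _ _ _ ?_
  swap
  · intro a b c d e f h; linarith
  have hχt := hχ.continuous_slice_t t
  have hχr := hχ.continuous_slice_r t
  have hψt := hψ.continuous_slice_t t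
  have hintv1 := hintv ((hχt.mul ((cur.norm.pow 2).div_const 2)).continuousOn.sub
    ((hχr.continuousOn.mul i1).add (cχ.continuousOn.mul i9)))
  have hintv2 := hintv ((hχt.mul cV).continuousOn.add (cχ.continuousOn.mul i10))
  have hintv3 := hintv ((hψt.mul ((cu.norm.pow 2).div_const 2)).continuousOn.add
    (cψ.continuousOn.mul i11))
  have hintv4 : IntervalIntegrable (fun r => w.c * (w.chi r t * (w.c - (w.c + w.κ) * w.sig r t))
        * (‖ur u r t‖ ^ 2 / 2 - V (u r t))
        + w.c * w.chi r t * (⟪ur u r t, urr u r t⟫ - ⟪gradient V (u r t), ur u r t⟫)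
        + A * (w.psi r t * w.rate r t * ⟪u r t, ur u r t⟫
          + w.psi r t * (⟪u r t, urr u r t⟫ + ⟪ur u r t, ur u r t⟫)
          - (w.psi r t * (w.rate r t ^ 2 - (w.c + 2 * w.κ) * w.κ * w.sig r t * (1 - w.sig r t))
            * (‖u r t‖ ^ 2 / 2) + w.psi r t * w.rate r t * ⟪u r t, ur u r t⟫))) volume R1 R2 :=
    Continuous.intervalIntegrable (by fun_prop) _ _
  simp only [id]
  rw [← intervalIntegral.integral_const_mul, ← intervalIntegral.integral_add, ← intervalIntegral.integral_add,
    ← intervalIntegral.integral_add (hintv hrest) hintv4]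
  · refine intervalIntegral.integral_congr fun r hr => ?_
    rw [uIcc_of_le hR] at hr
    have hpde := hu.pde r (hI hr) t ht
    have hq : urr u r t = ut u r t + gradient V (u r t) - (((d : ℝ) - 1) / r) • ur u r t := by
      rw [hpde]; abel
    simp only [energyRest, psi]
    have e1 : ‖ut u r t + w.c • ur u r t‖ ^ 2 = ‖ut u r t‖ ^ 2 + 2 * w.c * ⟪ur u r t, ut u r t⟫
        + w.c ^ 2 * ‖ur u r t‖ ^ 2 := by
      rw [norm_add_sq_real, norm_smul, real_inner_smul_right, real_inner_comm, mul_pow,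
        Real.norm_eq_abs, sq_abs]
      ring
    rw [hq, e1]
    simp only [inner_add_left, inner_add_right, inner_sub_left, inner_sub_right,
      real_inner_smul_left, real_inner_smul_right, real_inner_self_eq_norm_sq]
    rw [real_inner_comm (gradient V (u r t)) (ur u r t)]
    ring
  · exact hintv1.add hintv2
  · exact hintv3.const_mul A
  · exact hintv1
  · exact hintv2

end TravWeight

/-! ### The energy inequality -/

namespace TravWeight

variable {d : ℕ} {V : Euc n → ℝ} {u : ℝ → ℝ → Euc n} {C AV : ℝ}

theorem continuous_chi_slice (w : TravWeight) (t : ℝ) : Continuous fun r => w.chi r t :=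
  w.continuous_chi.comp (by fun_prop : Continuous fun r : ℝ => (r, t))

theorem continuous_psi_slice (w : TravWeight) (t : ℝ) : Continuous fun r => w.psi r t :=
  w.continuous_psi.comp (by fun_prop : Continuous fun r : ℝ => (r, t))

theorem integral_chi_le (w : TravWeight) (t : ℝ) {R1 R2 : ℝ} (hR : R1 ≤ R2) :
    ∫ r in R1..R2, w.chi r t ≤ w.top t * (2 / w.κ) := by
  have h1 := intervalIntegral_exp_neg_abs_le w.κ_pos (w.c₁ * t + w.b) hR
  calc _ ≤ ∫ r in R1..R2, w.top t * Real.exp (-w.κ * |r - (w.c₁ * t + w.b)|) :=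
        intervalIntegral.integral_mono_on hR ((w.continuous_chi_slice t).intervalIntegrable _ _)
          (Continuous.intervalIntegrable (by fun_prop) _ _) fun r _ => w.chi_le_top r t
    _ = w.top t * ∫ r in R1..R2, Real.exp (-w.κ * |r - (w.c₁ * t + w.b)|) :=
        intervalIntegral.integral_const_mul _ _
    _ ≤ _ := mul_le_mul_of_nonneg_left h1 (w.top_pos t).le

theorem abs_flux_le (w : TravWeight) (hC : SolBound u C) (hAV0 : 0 ≤ AV)
    (hAV : ∀ x, ‖x‖ ≤ C → |V x| ≤ AV * ‖x‖ ^ 2) {A : ℝ} (hA : 0 ≤ A) {r t : ℝ} (hr : 0 ≤ r)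
    (ht : 0 < t) :
    |w.flux V u A r t| ≤
      (w.c * (1 + AV) + A * (1 + (w.c + w.κ)) + 1) * C ^ 2 * w.chi r t := by
  obtain ⟨C0, h⟩ := hC
  obtain ⟨h1, h2, -, h4⟩ := h r t hr ht
  have s1 : ‖u r t‖ ^ 2 ≤ C ^ 2 := by gcongr
  have s2 : ‖ur u r t‖ ^ 2 ≤ C ^ 2 := by gcongr
  have hv := hAV _ h1
  have hv' : |V (u r t)| ≤ AV * C ^ 2 := hv.trans (mul_le_mul_of_nonneg_left s1 hAV0)
  have hχ := w.chi_pos r t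
  have hψ := w.psi_pos r t
  have hψχ := w.psi_le_chi r t
  have hrate := w.abs_rate_le r t
  have i1 : |⟪u r t, ur u r t⟫| ≤ C ^ 2 := (abs_real_inner_le_norm _ _).trans
    ((mul_le_mul h1 h2 (norm_nonneg _) C0.le).trans_eq (by ring))
  have i2 : |⟪ur u r t, ut u r t⟫| ≤ C ^ 2 := (abs_real_inner_le_norm _ _).trans
    ((mul_le_mul h2 h4 (norm_nonneg _) C0.le).trans_eq (by ring))
  have hc := w.c_pos
  have hκ := w.κ_pos
  have e1 : |w.c * w.chi r t * (‖ur u r t‖ ^ 2 / 2 - V (u r t))| ≤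
      w.c * w.chi r t * ((1 + AV) * C ^ 2) := by
    rw [abs_mul, abs_of_pos (by positivity : 0 < w.c * w.chi r t)]
    refine mul_le_mul_of_nonneg_left ?_ (by positivity)
    refine (abs_sub _ _).trans ?_
    rw [abs_of_nonneg (by positivity : 0 ≤ ‖ur u r t‖ ^ 2 / 2)]
    nlinarith [sq_nonneg C]
  have e2 : |w.psi r t * ⟪u r t, ur u r t⟫| ≤ w.chi r t * C ^ 2 := by
    rw [abs_mul, abs_of_pos hψ]
    exact mul_le_mul hψχ i1 (abs_nonneg _) hχ.le
  have e3 : |w.psi r t * w.rate r t * (‖u r t‖ ^ 2 / 2)| ≤ w.chi r t * (w.c + w.κ) * C ^ 2 := by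
    rw [abs_mul, abs_mul, abs_of_pos hψ, abs_of_nonneg (by positivity : 0 ≤ ‖u r t‖ ^ 2 / 2)]
    refine mul_le_mul (mul_le_mul hψχ hrate (abs_nonneg _) hχ.le) ?_ (by positivity) (by positivity)
    linarith [sq_nonneg C]
  have e4 : |w.chi r t * ⟪ur u r t, ut u r t⟫| ≤ w.chi r t * C ^ 2 := by
    rw [abs_mul, abs_of_pos hχ]
    exact mul_le_mul_of_nonneg_left i2 hχ.le
  unfold flux
  refine (abs_add_le _ _).trans ?_
  have e5 : |A * (w.psi r t * ⟪u r t, ur u r t⟫ - w.psi r t * w.rate r t * (‖u r t‖ ^ 2 / 2))| ≤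
      A * (w.chi r t * C ^ 2 + w.chi r t * (w.c + w.κ) * C ^ 2) := by
    rw [abs_mul, abs_of_nonneg hA]
    exact mul_le_mul_of_nonneg_left ((abs_sub _ _).trans (add_le_add e2 e3)) hA
  have e6 := abs_add_le (w.c * w.chi r t * (‖ur u r t‖ ^ 2 / 2 - V (u r t)))
    (A * (w.psi r t * ⟪u r t, ur u r t⟫ - w.psi r t * w.rate r t * (‖u r t‖ ^ 2 / 2)))
  linarith

theorem abs_energy_le (w : TravWeight) (hu : IsRadialSolution d V u) (hV : ContDiff ℝ 2 V)
    (hC : SolBound u C) (hAV0 : 0 ≤ AV)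
    (hAV : ∀ x, ‖x‖ ≤ C → |V x| ≤ AV * ‖x‖ ^ 2) {A : ℝ} (hA : 0 ≤ A) {R1 R2 t : ℝ} (hR1 : 0 < R1)
    (hR : R1 ≤ R2) (ht : 0 < t) :
    |w.energy V u A R1 R2 t| ≤ (1 + AV + A) * C ^ 2 * (2 / w.κ) * w.top t := by
  obtain ⟨C0, h⟩ := hC
  have cχ := w.continuous_chi_slice t
  have cψ := w.continuous_psi_slice t
  have cu := hu.continuous_r ht
  have cur := hu.continuous_ur ht
  have cV : Continuous fun r => V (u r t) := hV.continuous.comp cu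
  have key : ∀ {f : ℝ → ℝ} {M : ℝ}, Continuous f → 0 ≤ M →
      (∀ r ∈ Icc R1 R2, |f r| ≤ w.chi r t * M) → |∫ r in R1..R2, f r| ≤
      M * (w.top t * (2 / w.κ)) := by
    intro f M hf hM hb
    calc _ ≤ ∫ r in R1..R2, |f r| := intervalIntegral.abs_integral_le_integral_abs hR
      _ ≤ ∫ r in R1..R2, w.chi r t * M := intervalIntegral.integral_mono_on hR
          (hf.abs.intervalIntegrable _ _) ((cχ.mul_const M).intervalIntegrable _ _) hb
      _ = M * ∫ r in R1..R2, w.chi r t := by rw [intervalIntegral.integral_mul_const, mul_comm]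
      _ ≤ _ := mul_le_mul_of_nonneg_left (w.integral_chi_le t hR) hM
  have k1 := key (f := fun r => w.chi r t * (‖ur u r t‖ ^ 2 / 2)) (M := C ^ 2) (by fun_prop)
    (by positivity) fun r hr => by
      obtain ⟨-, h2, -⟩ := h r t (hR1.le.trans hr.1) ht
      have s2 : ‖ur u r t‖ ^ 2 ≤ C ^ 2 := by gcongr
      rw [abs_mul, abs_of_pos (w.chi_pos r t), abs_of_nonneg (by positivity)]
      exact mul_le_mul_of_nonneg_left (by linarith [sq_nonneg C]) (w.chi_pos r t).le
  have k2 := key (f := fun r => w.chi r t * V (u r t)) (M := AV * C ^ 2) (by fun_prop)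
    (by positivity) fun r hr => by
      obtain ⟨h1, -⟩ := h r t (hR1.le.trans hr.1) ht
      have s2 : ‖u r t‖ ^ 2 ≤ C ^ 2 := by gcongr
      rw [abs_mul, abs_of_pos (w.chi_pos r t)]
      exact mul_le_mul_of_nonneg_left ((hAV _ h1).trans (mul_le_mul_of_nonneg_left s2 hAV0))
        (w.chi_pos r t).le
  have k3 := key (f := fun r => w.psi r t * (‖u r t‖ ^ 2 / 2)) (M := C ^ 2) (by fun_prop)
    (by positivity) fun r hr => by
      obtain ⟨h1, -⟩ := h r t (hR1.le.trans hr.1) ht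
      have s2 : ‖u r t‖ ^ 2 ≤ C ^ 2 := by gcongr
      rw [abs_mul, abs_of_pos (w.psi_pos r t), abs_of_nonneg (by positivity)]
      exact mul_le_mul (w.psi_le_chi r t) (by linarith [sq_nonneg C]) (by positivity)
        (w.chi_pos r t).le
  unfold energy
  have k4 : |A * ∫ r in R1..R2, w.psi r t * (‖u r t‖ ^ 2 / 2)| ≤
      A * (C ^ 2 * (w.top t * (2 / w.κ))) := by
    rw [abs_mul, abs_of_nonneg hA]; exact mul_le_mul_of_nonneg_left k3 hA
  refine (abs_add_le _ _).trans ?_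
  have := abs_add_le (∫ r in R1..R2, w.chi r t * (‖ur u r t‖ ^ 2 / 2))
    (∫ r in R1..R2, w.chi r t * V (u r t))
  linarith

theorem neg_le_energy (w : TravWeight) (hu : IsRadialSolution d V u) (hV : ContDiff ℝ 2 V)
    (hC : SolBound u C) (hAV0 : 0 ≤ AV)
    (hAV : ∀ x, ‖x‖ ≤ C → |V x| ≤ AV * ‖x‖ ^ 2) {A : ℝ} (hA : 0 ≤ A) {R1 R2 t X : ℝ}
    (hR1 : 0 < R1) (hR : R1 ≤ R2) (ht : 0 < t) (hX : ∀ r ∈ Icc R1 R2, X < r → 0 ≤ V (u r t)) :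
    -(AV * C ^ 2 * (2 / w.c) * Real.exp (w.c * (X - w.c * t - w.a))) ≤
      w.energy V u A R1 R2 t := by
  obtain ⟨C0, h⟩ := hC
  have cχ := w.continuous_chi_slice t
  have cu := hu.continuous_r ht
  have cV : Continuous fun r => V (u r t) := hV.continuous.comp cu
  have k1 : 0 ≤ ∫ r in R1..R2, w.chi r t * (‖ur u r t‖ ^ 2 / 2) :=
    intervalIntegral.integral_nonneg hR fun r _ => mul_nonneg (w.chi_pos r t).le (by positivity)
  have k3 : 0 ≤ ∫ r in R1..R2, w.psi r t * (‖u r t‖ ^ 2 / 2) :=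
    intervalIntegral.integral_nonneg hR fun r _ => mul_nonneg (w.psi_pos r t).le (by positivity)
  have k2 : ∫ r in R1..R2, -(w.chi r t * V (u r t)) ≤
      AV * C ^ 2 * (2 / w.c) * Real.exp (w.c * (X - w.c * t - w.a)) := by
    calc _ ≤ ∫ r in R1..R2, (AV * C ^ 2 * Real.exp (w.c * (X - w.c * t - w.a))) *
          Real.exp (-w.c * |r - X|) := by
          refine intervalIntegral.integral_mono_on hR ((cχ.mul cV).neg.intervalIntegrable _ _)
            (Continuous.intervalIntegrable (by fun_prop) _ _) fun r hr => ?_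
          obtain ⟨h1, -⟩ := h r t (hR1.le.trans hr.1) ht
          have hpos : 0 ≤ (AV * C ^ 2 * Real.exp (w.c * (X - w.c * t - w.a))) *
            Real.exp (-w.c * |r - X|) := by positivity
          rcases lt_or_ge X r with hlt | hle
          · have := mul_nonneg (w.chi_pos r t).le (hX r hr hlt)
            linarith
          · have s2 : ‖u r t‖ ^ 2 ≤ C ^ 2 := by gcongr
            have hv : -V (u r t) ≤ AV * C ^ 2 := ((neg_le_abs _).trans (hAV _ h1)).trans
              (mul_le_mul_of_nonneg_left s2 hAV0)
            calc -(w.chi r t * V (u r t)) = w.chi r t * -V (u r t) := by ring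
              _ ≤ w.chi r t * (AV * C ^ 2) := mul_le_mul_of_nonneg_left hv (w.chi_pos r t).le
              _ ≤ Real.exp (w.c * (r - w.c * t - w.a)) * (AV * C ^ 2) :=
                mul_le_mul_of_nonneg_right (w.chi_le_exp r t) (by positivity)
              _ = _ := by
                have : w.c * (r - w.c * t - w.a) =
                    w.c * (X - w.c * t - w.a) + -w.c * |r - X| := by
                  rw [abs_of_nonpos (by linarith)]; ring
                rw [this, Real.exp_add]; ring
      _ = (AV * C ^ 2 * Real.exp (w.c * (X - w.c * t - w.a))) *
          ∫ r in R1..R2, Real.exp (-w.c * |r - X|) := intervalIntegral.integral_const_mul _ _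
      _ ≤ (AV * C ^ 2 * Real.exp (w.c * (X - w.c * t - w.a))) * (2 / w.c) :=
          mul_le_mul_of_nonneg_left (intervalIntegral_exp_neg_abs_le w.c_pos X hR) (by positivity)
      _ = _ := by ring
  rw [intervalIntegral.integral_neg] at k2
  unfold energy
  have := mul_nonneg hA k3
  linarith

theorem le_integral_dissipation (w : TravWeight) (hu : IsRadialSolution d V u)
    (hV : ContDiff ℝ 2 V) {R1 R2 t X ρ₀ : ℝ} (hR1 : 0 < R1) (ht : 0 < t) (hρ : 0 ≤ ρ₀)
    (h1 : R1 ≤ X - ρ₀) (h2 : X + ρ₀ ≤ R2) (h3 : X + ρ₀ ≤ w.c₁ * t + w.b) :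
    Real.exp (-((w.c + w.κ) / w.κ)) * Real.exp (-(w.c * ρ₀)) *
        Real.exp (w.c * (X - w.c * t - w.a)) *
        (∫ ρ in (-ρ₀)..ρ₀, ‖ut u (X + ρ) t + w.c • ur u (X + ρ) t‖ ^ 2) ≤
      ∫ r in R1..R2, w.chi r t * ‖ut u r t + w.c • ur u r t‖ ^ 2 := by
  have cχ := w.continuous_chi_slice t
  have cY : ContinuousOn (fun r => ‖ut u r t + w.c • ur u r t‖ ^ 2) (Ioi 0) :=
    (((hu.continuousOn_ut hV ht).add
      ((hu.continuous_ur ht).continuousOn.const_smul w.c)).norm).pow 2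
  have hsub : Icc (X - ρ₀) (X + ρ₀) ⊆ Icc R1 R2 := Icc_subset_Icc h1 h2
  have hpos : Icc R1 R2 ⊆ Ioi 0 := fun r hr => hR1.trans_le hr.1
  have hle : X - ρ₀ ≤ X + ρ₀ := by linarith
  have e : ∫ ρ in (-ρ₀)..ρ₀, ‖ut u (X + ρ) t + w.c • ur u (X + ρ) t‖ ^ 2 =
      ∫ r in (X - ρ₀)..(X + ρ₀), ‖ut u r t + w.c • ur u r t‖ ^ 2 := by
    rw [intervalIntegral.integral_comp_add_left
      (fun r => ‖ut u r t + w.c • ur u r t‖ ^ 2), sub_eq_add_neg]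
  rw [e, ← intervalIntegral.integral_const_mul]
  have ci : IntervalIntegrable (fun r => w.chi r t * ‖ut u r t + w.c • ur u r t‖ ^ 2) volume R1 R2 :=
    ((cχ.continuousOn.mul cY).mono (by rw [uIcc_of_le (by linarith)]; exact hpos)).intervalIntegrable
  calc _ ≤ ∫ r in (X - ρ₀)..(X + ρ₀), w.chi r t * ‖ut u r t + w.c • ur u r t‖ ^ 2 := by
        refine intervalIntegral.integral_mono_on hle ?_ ?_ fun r hr => ?_
        · exact ((continuousOn_const.mul cY).mono
            (by rw [uIcc_of_le hle]; exact hsub.trans hpos)).intervalIntegrable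
        · exact ((cχ.continuousOn.mul cY).mono
            (by rw [uIcc_of_le hle]; exact hsub.trans hpos)).intervalIntegrable
        · refine mul_le_mul_of_nonneg_right ?_ (by positivity)
          refine le_trans ?_ (w.le_chi (hr.2.trans h3))
          rw [mul_assoc, ← Real.exp_add]
          refine mul_le_mul_of_nonneg_left (Real.exp_le_exp.2 ?_) (Real.exp_pos _).le
          have := mul_le_mul_of_nonneg_left hr.1 w.c_pos.le
          linarith
    _ ≤ _ := by
        refine intervalIntegral.integral_mono_interval h1 hle h2 ?_ ci
        exact Eventually.of_forall fun r => mul_nonneg (w.chi_pos r t).le (by positivity)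

theorem deriv_energy_le (w : TravWeight) (hu : IsRadialSolution d V u) (hV : ContDiff ℝ 2 V)
    (hd : 1 ≤ d) (D : EscData n V) (h0 : (0 : Euc n) ∈ MinSet V) (hC : SolBound u C)
    (hAV0 : 0 ≤ AV)
    (hAV : ∀ x, ‖x‖ ≤ C → |V x| ≤ AV * ‖x‖ ^ 2 ∧ ‖gradient V x‖ ≤ AV * ‖x‖)
    (hc₁ : w.c ≤ w.c₁) (hlam : (w.c + w.κ) * (w.κ + (w.c₁ - w.c)) ≤ D.lmin / 2)
    {A : ℝ} (hA : A = energyCoef w.c w.κ w.c₁ D.lmin AV) {R1 R2 t X : ℝ} (hR1 : 0 < R1)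
    (hR : R1 ≤ R2) (ht : 0 < t) (hX : ∀ r ∈ Icc R1 R2, X < r → ‖u r t‖ ≤ D.dEsc) :
    ∃ E', HasDerivAt (fun s => w.energy V u A R1 R2 s) E' t ∧
      E' ≤ -((∫ r in R1..R2, w.chi r t * ‖ut u r t + w.c • ur u r t‖ ^ 2) / 2)
        + A * (2 + D.lmin + AV) * C ^ 2 * (2 / w.c) *
          Real.exp (w.c * (X - w.c * t - w.a) - w.κ * (w.c₁ * t + w.b - X))
        + (1 + w.c + A) * C ^ 2 * (2 / w.κ) * (((d : ℝ) - 1) / R1) * w.top t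
        + (w.c * (1 + AV) + A * (1 + (w.c + w.κ)) + 1) * C ^ 2 *
          (w.chi R1 t + w.chi R2 t) := by
  obtain ⟨hcont, hder⟩ := w.hasDerivAt_energy hu hV hC A hR1 hR ht
  refine ⟨_, hder, ?_⟩
  have hc := w.c_pos
  have hκ := w.κ_pos
  have hc1 : 0 ≤ w.c₁ := hc.le.trans hc₁
  have hl := D.lmin_pos
  have hA0 : 0 ≤ A := by rw [hA]; unfold energyCoef; positivity
  have hf1 := w.abs_flux_le hC hAV0 (fun x hx => (hAV x hx).1) hA0 hR1.le ht
  have hf2 := w.abs_flux_le hC hAV0 (fun x hx => (hAV x hx).1) hA0 (hR1.le.trans hR) ht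
  have hd1 : 0 ≤ (d : ℝ) - 1 := by
    have : (1 : ℝ) ≤ d := by exact_mod_cast hd
    linarith
  have cχ := w.continuous_chi_slice t
  have hpos : Icc R1 R2 ⊆ Ioi 0 := fun r hr => hR1.trans_le hr.1
  have cY : ContinuousOn (fun r => ‖ut u r t + w.c • ur u r t‖ ^ 2) (Ioi 0) :=
    (((hu.continuousOn_ut hV ht).add
      ((hu.continuous_ur ht).continuousOn.const_smul w.c)).norm).pow 2
  have hintv : ∀ {f : ℝ → ℝ}, ContinuousOn f (Ioi 0) → IntervalIntegrable f volume R1 R2 :=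
    fun hf => (hf.mono (by rw [uIcc_of_le hR]; exact hpos)).intervalIntegrable
  set P := Real.exp (w.c * (X - w.c * t - w.a) - w.κ * (w.c₁ * t + w.b - X)) with hP
  set K1 := (1 + w.c + A) * C ^ 2 with hK1
  set K2 := A * (2 + D.lmin + AV) * C ^ 2 with hK2
  have K1pos : 0 ≤ K1 := by positivity
  have K2pos : 0 ≤ K2 := by positivity
  have hi1 : IntervalIntegrable (fun r => -(w.chi r t * ‖ut u r t + w.c • ur u r t‖ ^ 2 / 2))
      volume R1 R2 := hintv ((cχ.continuousOn.mul cY).div_const 2).neg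
  have hi2 : IntervalIntegrable (fun r => K2 * P * Real.exp (-w.c * |r - X|)) volume R1 R2 :=
    Continuous.intervalIntegrable (by fun_prop) _ _
  have hi3 : IntervalIntegrable (fun r => K1 * (((d : ℝ) - 1) / R1) * w.chi r t) volume R1 R2 :=
    Continuous.intervalIntegrable (by fun_prop) _ _
  have hrest := intervalIntegral.integral_mono_on hR (hintv hcont)
    ((hi1.add hi2).add hi3) (fun r hr => by
      have hr0 : 0 < r := hpos hr
      obtain ⟨h1, h2, -, h4⟩ := hC.2 r t hr0.le ht
      have hS := (w.rate_quadratic_le hc₁ r t).trans hlam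
      have hk : 0 ≤ ((d : ℝ) - 1) / r := by positivity
      have hk' : w.chi r t * (((d : ℝ) - 1) / r) * K1 ≤ K1 * (((d : ℝ) - 1) / R1) * w.chi r t := by
        have : ((d : ℝ) - 1) / r ≤ ((d : ℝ) - 1) / R1 :=
          div_le_div_of_nonneg_left hd1 hR1 hr.1
        have := mul_le_mul_of_nonneg_left this (mul_nonneg (w.chi_pos r t).le K1pos)
        linarith
      have hgauss : 0 ≤ K2 * P * Real.exp (-w.c * |r - X|) := by positivity
      show _ ≤ -(w.chi r t * ‖ut u r t + w.c • ur u r t‖ ^ 2 / 2)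
        + K2 * P * Real.exp (-w.c * |r - X|) + K1 * (((d : ℝ) - 1) / R1) * w.chi r t
      rcases lt_or_ge X r with hlt | hle
      · have hag := inner_gradient_ge_of_near_min hV D h0 (x := u r t)
          (by simpa using hX r hr hlt)
        rw [sub_zero] at hag
        have := energyRest_le_near hc hκ hc₁ hl hk (w.chi_pos r t) (w.sig_pos r t)
          (w.sig_lt_one r t).le hAV0 (hAV _ h1).1 hA hS hag h1 h2 h4
        linarith
      · have := energyRest_le_far hc hκ hc₁ hl hk (w.chi_pos r t) (w.sig_pos r t)
          (w.sig_lt_one r t).le hAV0 (hAV _ h1).1 hA hS (hAV _ h1).2 h1 h2 h4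
        have hψ : w.sig r t * w.chi r t ≤ P * Real.exp (-w.c * |r - X|) := by
          refine (w.psi_le_exp r t).trans ?_
          rw [hP, ← Real.exp_add, ← Real.exp_add, Real.exp_le_exp, abs_of_nonpos (by linarith)]
          have := mul_le_mul_of_nonneg_left hle hκ.le
          linarith
        have := mul_le_mul_of_nonneg_right hψ K2pos
        linarith)
  rw [intervalIntegral.integral_add (hi1.add hi2) hi3, intervalIntegral.integral_add hi1 hi2, intervalIntegral.integral_neg,
    intervalIntegral.integral_div, intervalIntegral.integral_const_mul,
    intervalIntegral.integral_const_mul] at hrest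
  have g1 := mul_le_mul_of_nonneg_left (intervalIntegral_exp_neg_abs_le hc X hR)
    (by positivity : 0 ≤ K2 * P)
  have g2 := mul_le_mul_of_nonneg_left (w.integral_chi_le t hR)
    (by positivity : 0 ≤ K1 * (((d : ℝ) - 1) / R1))
  have f1 := (abs_le.1 hf1).1
  have f2 := (abs_le.1 hf2).2
  linarith

end TravWeight

/-! ### Relaxation of the energy around the escape point -/

/-- The properties of the escape point `X` and of the homogeneous point `R` that are used to
study the invasion; `c₀` is the mean speed of `X`. -/
structure IsEscapePoint (V : Euc n → ℝ) (D : EscData n V) (u : ℝ → ℝ → Euc n) (X R : ℝ → ℝ)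
    (c₀ : ℝ) : Prop where
  norm_le : ∀ t > 0, ∀ r, X t < r → r ≤ R t → ‖u r t‖ ≤ D.dEsc
  mono : MonotoneOn R (Ici 0)
  gap : Tendsto (fun t => R t - X t) atTop atTop
  speed_pos : 0 < c₀
  tendsto_div : Tendsto (fun t => X t / t) atTop (𝓝 c₀)
  exists_speed : ∃ c C T, ∀ t ≥ T, ∀ s ≥ 0, X (t + s) ≤ X t + c * s + C
  exists_trigger : ∃ M η T, 0 < η ∧ ∀ t ≥ T, ∃ r, |r - X t| ≤ M ∧ η ≤ ‖u r t‖ + ‖ur u r t‖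

/-- The dissipation around the escape point, in a frame travelling at the speed `c`. -/
def dissip (u : ℝ → ℝ → Euc n) (X : ℝ → ℝ) (c ρ₀ t : ℝ) : ℝ :=
  ∫ ρ in (-ρ₀)..ρ₀, ‖ut u (X t + ρ) t + c • ur u (X t + ρ) t‖ ^ 2

/-- The upper bound `c` on the mean speed of `X` holds, up to a bounded error. -/
def HasUpperSpeed (X : ℝ → ℝ) (c : ℝ) : Prop :=
  ∃ C T, ∀ t ≥ T, ∀ s ≥ 0, X (t + s) ≤ X t + c * s + C

theorem HasUpperSpeed.exists_pos {X : ℝ → ℝ} {c : ℝ} (h : HasUpperSpeed X c) :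
    ∃ C T, 0 < C ∧ 0 < T ∧ ∀ t ≥ T, ∀ s ≥ 0, X (t + s) ≤ X t + c * s + C := by
  obtain ⟨C, T, h⟩ := h
  exact ⟨max C 1, max T 1, by positivity, by positivity, fun t ht s hs =>
    (h t ((le_max_left _ _).trans ht) s hs).trans (by linarith [le_max_left C 1])⟩

theorem IsEscapePoint.eventually_ge {V : Euc n → ℝ} {D : EscData n V} {u : ℝ → ℝ → Euc n}
    {X R : ℝ → ℝ} {c₀ : ℝ} (hX : IsEscapePoint V D u X R c₀) :
    ∃ T > 0, ∀ t ≥ T, c₀ * (3 / 4) * t ≤ X t := by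
  have h := hX.tendsto_div.eventually (eventually_gt_nhds
    (by linarith [hX.speed_pos] : c₀ * (3 / 4) < c₀))
  obtain ⟨T, hT⟩ := eventually_atTop.1 h
  refine ⟨max T 1, by positivity, fun t ht => ?_⟩
  have ht0 : 0 < t := lt_of_lt_of_le one_pos ((le_max_right _ _).trans ht)
  exact ((lt_div_iff₀ ht0).1 (hT t ((le_max_left _ _).trans ht))).le

theorem exists_relaxation {d : ℕ} {V : Euc n → ℝ} {u : ℝ → ℝ → Euc n} (hu : IsRadialSolution d V u)
    (hV : ContDiff ℝ 2 V) (hd : 1 ≤ d) (D : EscData n V) (h0 : (0 : Euc n) ∈ MinSet V)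
    (hV0 : V 0 = 0) {X R : ℝ → ℝ} {c₀ : ℝ} (hX : IsEscapePoint V D u X R c₀)
    {c κ c₁ : ℝ} (hc : 0 < c) (hκ : 0 < κ) (hκc : κ ≤ c) (hc₁ : c ≤ c₁)
    (hlam : (c + κ) * (κ + (c₁ - c)) ≤ D.lmin / 2) (hup : HasUpperSpeed X c₁)
    {ρ₀ ε : ℝ} (hρ : 0 ≤ ρ₀) (hε : 0 < ε) :
    ∃ C B : ℝ, 0 < C ∧ 0 < B ∧ ∀ N : ℕ, ∃ T, ∀ t₀ ≥ T,
      (∀ j < N, ∃ φ : ℝ → ℝ,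
        IntervalIntegrable φ volume (t₀ + 2 * (j : ℝ)) (t₀ + 2 * (j : ℝ) + 2) ∧
        (∀ t ∈ Icc (t₀ + 2 * (j : ℝ)) (t₀ + 2 * (j : ℝ) + 2), φ t ≤ dissip u X c ρ₀ t) ∧
        ε ≤ ∫ t in (t₀ + 2 * (j : ℝ))..(t₀ + 2 * (j : ℝ) + 2), φ t) →
      ∀ k ≤ N, ∑ j ∈ Finset.range k,
          Real.exp (c * (X (t₀ + 2 * ((j + 1 : ℕ) : ℝ)) - X t₀ - c * (2 * ((j + 1 : ℕ) : ℝ)))) ≤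
        C + B * Real.exp (c * (X (t₀ + 2 * (k : ℝ)) - X t₀ - c * (2 * (k : ℝ)))) := by
  obtain ⟨C, hC⟩ := hu.exists_solBound
  have C0 := hC.1
  obtain ⟨AV, hAV0, -, hAV⟩ := exists_quadratic_bounds hV hV0 h0.1 C
  have hl := D.lmin_pos
  set A := energyCoef c κ c₁ D.lmin AV with hA
  have hc1 : 0 ≤ c₁ := hc.le.trans hc₁
  have hA0 : 0 ≤ A := by rw [hA]; unfold energyCoef; positivity
  obtain ⟨Cs, Ts, hCs, hTs, hsp⟩ := hup.exists_pos
  obtain ⟨Tl, hTl, hlow⟩ := hX.eventually_ge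
  have hc0 := hX.speed_pos
  have hd1 : 0 ≤ (d : ℝ) - 1 := by
    have : (1 : ℝ) ≤ d := by exact_mod_cast hd
    linarith
  -- the constants
  set G := Real.exp (c * (2 * (c₁ - c) + Cs)) with hG
  have G0 : 0 < G := Real.exp_pos _
  set K2 := A * (2 + D.lmin + AV) * C ^ 2 * (2 / c) with hK2
  set K1 := (1 + c + A) * C ^ 2 * (2 / κ) with hK1
  set Kf := (c * (1 + AV) + A * (1 + (c + κ)) + 1) * C ^ 2 with hKf
  set KE := (1 + AV + A) * C ^ 2 * (2 / κ) with hKE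
  set Kn := AV * C ^ 2 * (2 / c) with hKn
  have K20 : 0 ≤ K2 := by positivity
  have K10 : 0 ≤ K1 := by positivity
  have Kf0 : 0 ≤ Kf := by positivity
  have KE0 : 0 ≤ KE := by positivity
  have Kn0 : 0 ≤ Kn := by positivity
  set α := Real.exp (-((c + κ) / κ)) * Real.exp (-(c * ρ₀)) / 2 / G with hα
  have α0 : 0 < α := by positivity
  obtain ⟨ℓ, hℓρ, hℓ⟩ : ∃ ℓ, ρ₀ ≤ ℓ ∧ 2 * (K2 * G * Real.exp (-(κ * ℓ))) ≤ α * ε / 2 := by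
    have h : Tendsto (fun ℓ : ℝ => 2 * (K2 * G * Real.exp (-(κ * ℓ)))) atTop
        (𝓝 (2 * (K2 * G * 0))) :=
      ((Real.tendsto_exp_neg_atTop_nhds_zero.comp
        (tendsto_id.const_mul_atTop hκ)).const_mul _).const_mul _
    simp only [mul_zero] at h
    obtain ⟨ℓ, h1, h2⟩ := ((eventually_ge_atTop ρ₀).and
      (h.eventually (eventually_le_nhds (by positivity : 0 < α * ε / 2)))).exists
    exact ⟨ℓ, h1, h2⟩
  have hℓ0 : 0 ≤ ℓ := hρ.trans hℓρ
  refine ⟨(KE * Real.exp (c * (ℓ + Cs)) + α * ε / 2 + 1) / (α * ε / 2), Kn / (α * ε / 2) + 1,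
    by positivity, by positivity, fun N => ?_⟩
  set Θ := Real.exp (c * (ℓ + Cs + (c₁ - c) * (2 * N))) with hΘ
  have Θ0 : 0 < Θ := Real.exp_pos _
  -- the error terms
  have htiny : Tendsto (fun t₀ => K1 * (((d : ℝ) - 1) / (c₀ / 2 * t₀)) * Θ
      + Kf * (Θ * Real.exp (-(κ * (c₀ / 4 * t₀)))
      + Θ * Real.exp (-(κ * (R t₀ - X t₀ - (ℓ + Cs + c₁ * (2 * N))))))) atTop (𝓝 0) := by
    have e1 : Tendsto (fun t₀ : ℝ => ((d : ℝ) - 1) / (c₀ / 2 * t₀)) atTop (𝓝 0) :=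
      (tendsto_id.const_mul_atTop (by positivity : 0 < c₀ / 2)).const_div_atTop _
    have e2 : Tendsto (fun t₀ : ℝ => Real.exp (-(κ * (c₀ / 4 * t₀)))) atTop (𝓝 0) :=
      Real.tendsto_exp_neg_atTop_nhds_zero.comp
        ((tendsto_id.const_mul_atTop (by positivity : 0 < c₀ / 4)).const_mul_atTop hκ)
    have e3 : Tendsto (fun t₀ : ℝ => Real.exp (-(κ * (R t₀ - X t₀ - (ℓ + Cs + c₁ * (2 * N))))))
        atTop (𝓝 0) :=
      Real.tendsto_exp_neg_atTop_nhds_zero.comp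
        ((tendsto_atTop_add_const_right _ _ hX.gap).const_mul_atTop hκ)
    have := ((e1.const_mul K1).mul_const Θ).add (((e2.const_mul Θ).add (e3.const_mul Θ)).const_mul Kf)
    simpa using this
  have hθ : (0 : ℝ) < 1 / (2 * (N + 1)) := by positivity
  have hev := (htiny.eventually (eventually_le_nhds hθ)).and
    ((hX.gap.eventually_ge_atTop (Cs + c₁ * (2 * N) + ρ₀)).and
    ((eventually_ge_atTop (max Ts Tl)).and (eventually_ge_atTop (4 * ρ₀ / c₀))))
  obtain ⟨T, hT⟩ := eventually_atTop.1 hev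
  refine ⟨T, fun t₀ ht₀ hφ k hk => ?_⟩
  obtain ⟨htin, hgap, htm, htr⟩ := hT t₀ ht₀
  have hTs' : Ts ≤ t₀ := (le_max_left _ _).trans htm
  have hTl' : Tl ≤ t₀ := (le_max_right _ _).trans htm
  have ht0 : 0 < t₀ := hTs.trans_le hTs'
  set w : TravWeight := ⟨c, κ, c₁, X t₀ - c * t₀, X t₀ + ℓ + Cs - c₁ * t₀, hc, hκ, hκc⟩ with hw
  set R1 := c₀ / 2 * t₀ with hR1
  set R2 := R t₀ with hR2
  have R10 : 0 < R1 := by positivity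
  have hX0 : c₀ * (3 / 4) * t₀ ≤ X t₀ := hlow t₀ hTl'
  have hR12 : R1 ≤ R2 := by
    have : 0 ≤ Cs + c₁ * (2 * N) + ρ₀ := by positivity
    have : 0 < c₀ * t₀ := by positivity
    simp only [hR1, hR2]; linarith
  set W : ℝ → ℝ := fun t => Real.exp (c * (X t - w.c * t - w.a)) with hW
  have hWj : ∀ j : ℕ, Real.exp (c * (X (t₀ + 2 * (j : ℝ)) - X t₀ - c * (2 * (j : ℝ)))) =
      W (t₀ + 2 * (j : ℝ)) := by
    intro j; simp only [hW, hw]; congr 1; ring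
  have hEnear : ∀ t ≥ t₀, ∀ r ∈ Icc R1 R2, X t < r → ‖u r t‖ ≤ D.dEsc := fun t ht r hr hlt =>
    hX.norm_le t (ht0.trans_le ht) r hlt
      (hr.2.trans (hX.mono ht0.le (ht0.le.trans ht) ht))
  set E : ℝ → ℝ := fun t => w.energy V u A R1 R2 t with hE
  have hder : ∀ t ∈ Icc t₀ (t₀ + 2 * N), ∃ E', HasDerivAt E E' t ∧
      E' ≤ -(α * G * W t * dissip u X c ρ₀ t) + K2 * Real.exp (-(κ * ℓ)) * W t
        + 1 / (2 * (N + 1)) := by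
    intro t ht
    have htpos : 0 < t := ht0.trans_le ht.1
    obtain ⟨E', h1, h2⟩ := w.deriv_energy_le hu hV hd D h0 hC hAV0.le hAV hc₁ hlam (A := A) rfl
      R10 hR12 htpos (hEnear t ht.1)
    refine ⟨E', h1, h2.trans ?_⟩
    have hXt : X t ≤ X t₀ + c₁ * (t - t₀) + Cs := by
      have := hsp t₀ hTs' (t - t₀) (by linarith [ht.1])
      rwa [add_sub_cancel] at this
    have htN : c₁ * (t - t₀) ≤ c₁ * (2 * N) := mul_le_mul_of_nonneg_left (by linarith [ht.2]) hc1
    have hz : w.c₁ * t + w.b = X t₀ + ℓ + Cs + c₁ * (t - t₀) := by simp only [hw]; ring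
    have hXl : c₀ * (3 / 4) * t₀ ≤ X t :=
      le_trans (mul_le_mul_of_nonneg_left ht.1 (by positivity)) (hlow t (hTl'.trans ht.1))
    have hr' : ρ₀ ≤ c₀ / 4 * t₀ := by
      rw [div_le_iff₀ hc0] at htr; linarith
    have hlo := w.le_integral_dissipation hu hV (R1 := R1) (R2 := R2) (X := X t) (ρ₀ := ρ₀)
      R10 htpos hρ (by simp only [hR1]; linarith) (by simp only [hR2]; linarith)
      (by rw [hz]; linarith)
    have htop : w.top t ≤ Θ := by
      unfold TravWeight.top
      refine Real.exp_le_exp.2 (mul_le_mul_of_nonneg_left ?_ hc.le)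
      rw [hz]
      have : (c₁ - c) * (t - t₀) ≤ (c₁ - c) * (2 * N) :=
        mul_le_mul_of_nonneg_left (by linarith [ht.2]) (by linarith)
      simp only [hw]; linarith
    have hchi1 : w.chi R1 t ≤ Θ * Real.exp (-(κ * (c₀ / 4 * t₀))) := by
      refine (w.chi_le_top R1 t).trans (mul_le_mul htop (Real.exp_le_exp.2 ?_)
        (Real.exp_pos _).le Θ0.le)
      have h1 : c₀ / 4 * t₀ ≤ |R1 - (w.c₁ * t + w.b)| := by
        rw [abs_sub_comm, hz]
        refine le_trans ?_ (le_abs_self _)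
        have : 0 ≤ c₁ * (t - t₀) := mul_nonneg hc1 (by linarith [ht.1])
        simp only [hR1]; linarith
      have := mul_le_mul_of_nonneg_left h1 hκ.le
      simp only [hw] at this ⊢; linarith
    have hchi2 : w.chi R2 t ≤
        Θ * Real.exp (-(κ * (R t₀ - X t₀ - (ℓ + Cs + c₁ * (2 * N))))) := by
      refine (w.chi_le_top R2 t).trans (mul_le_mul htop (Real.exp_le_exp.2 ?_)
        (Real.exp_pos _).le Θ0.le)
      have h1 : R t₀ - X t₀ - (ℓ + Cs + c₁ * (2 * N)) ≤ |R2 - (w.c₁ * t + w.b)| := by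
        rw [hz]
        refine le_trans ?_ (le_abs_self _)
        simp only [hR2]; linarith
      have := mul_le_mul_of_nonneg_left h1 hκ.le
      simp only [hw] at this ⊢; linarith
    have hpsi : Real.exp (w.c * (X t - w.c * t - w.a) - w.κ * (w.c₁ * t + w.b - X t)) ≤
        Real.exp (-(κ * ℓ)) * W t := by
      rw [hz]
      simp only [hW]
      rw [← Real.exp_add, Real.exp_le_exp]
      have := mul_le_mul_of_nonneg_left
        (by linarith : ℓ ≤ X t₀ + ℓ + Cs + c₁ * (t - t₀) - X t) hκ.le
      simp only [hw]; linarith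
    have f1 := mul_le_mul_of_nonneg_left hpsi K20
    have f2 := mul_le_mul_of_nonneg_left (add_le_add hchi1 hchi2) Kf0
    have f3 := mul_le_mul_of_nonneg_left htop
      (by positivity : 0 ≤ K1 * (((d : ℝ) - 1) / R1))
    have f4 : α * G * W t * dissip u X c ρ₀ t ≤
        (∫ r in R1..R2, w.chi r t * ‖ut u r t + w.c • ur u r t‖ ^ 2) / 2 := by
      have e : α * G = Real.exp (-((c + κ) / κ)) * Real.exp (-(c * ρ₀)) / 2 := by
        rw [hα]; field_simp
      rw [e]
      have : Real.exp (-((c + κ) / κ)) * Real.exp (-(c * ρ₀)) * W t * dissip u X c ρ₀ t ≤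
        ∫ r in R1..R2, w.chi r t * ‖ut u r t + w.c • ur u r t‖ ^ 2 := hlo
      linarith
    change -((∫ r in R1..R2, w.chi r t * ‖ut u r t + w.c • ur u r t‖ ^ 2) / 2)
      + K2 * Real.exp (w.c * (X t - w.c * t - w.a) - w.κ * (w.c₁ * t + w.b - X t))
      + K1 * (((d : ℝ) - 1) / R1) * w.top t + Kf * (w.chi R1 t + w.chi R2 t) ≤ _
    linarith
  choose! E' hE'1 hE'2 using hder
  -- comparison of the weights within a time window
  have hWup : ∀ s ≥ t₀, ∀ t, s ≤ t → t ≤ s + 2 → W t ≤ G * W s := by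
    intro s hs t hst hts
    have h := hsp s (hTs'.trans hs) (t - s) (by linarith)
    rw [add_sub_cancel] at h
    simp only [hW, hG]
    rw [← Real.exp_add, Real.exp_le_exp, ← mul_add]
    refine mul_le_mul_of_nonneg_left ?_ hc.le
    have : (c₁ - c) * (t - s) ≤ (c₁ - c) * 2 :=
      mul_le_mul_of_nonneg_left (by linarith) (by linarith)
    simp only [hw]; linarith
  have hstep : ∀ j < N, E (t₀ + 2 * ((j + 1 : ℕ) : ℝ)) - E (t₀ + 2 * (j : ℝ)) ≤
      -(α * ε * W (t₀ + 2 * ((j + 1 : ℕ) : ℝ))) + α * ε / 2 * W (t₀ + 2 * (j : ℝ))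
        + 1 / (N + 1) := by
    intro j hj
    obtain ⟨φ, hφi, hφd, hφε⟩ := hφ j hj
    set s := t₀ + 2 * (j : ℝ) with hs
    have hs0 : t₀ ≤ s := by simp only [hs]; linarith [(Nat.cast_nonneg j : (0 : ℝ) ≤ j)]
    have hsN : s + 2 ≤ t₀ + 2 * N := by
      have : (j : ℝ) + 1 ≤ N := by exact_mod_cast hj
      simp only [hs]; linarith
    have es : t₀ + 2 * ((j + 1 : ℕ) : ℝ) = s + 2 := by push_cast; simp only [hs]; ring
    rw [es]
    have hsub : Icc s (s + 2) ⊆ Icc t₀ (t₀ + 2 * N) := Icc_subset_Icc hs0 hsN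
    set β := K2 * Real.exp (-(κ * ℓ)) * (G * W s) + 1 / (2 * (N + 1)) with hβ
    have hintv : IntervalIntegrable (fun t => -(α * W (s + 2)) * φ t + β) volume s (s + 2) :=
      (hφi.const_mul _).add intervalIntegrable_const
    have hle : s ≤ s + 2 := by linarith
    have hmain := intervalIntegral.sub_le_integral_of_hasDeriv_right_of_le hle
      (fun t ht => (hE'1 t (hsub ht)).continuousAt.continuousWithinAt)
      (fun t ht => (hE'1 t (hsub (Ioo_subset_Icc_self ht))).hasDerivWithinAt)
      ((intervalIntegrable_iff_integrableOn_Icc_of_le hle).1 hintv) (fun t ht => by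
        have htI := Ioo_subset_Icc_self ht
        refine (hE'2 t (hsub htI)).trans ?_
        have hW1 := hWup s hs0 t htI.1 htI.2
        have hW2 := hWup t (hs0.trans htI.1) (s + 2) htI.2 (by linarith [htI.1])
        have hd0 : 0 ≤ dissip u X c ρ₀ t :=
          intervalIntegral.integral_nonneg (by linarith) fun _ _ => by positivity
        have hWp : 0 < W (s + 2) := Real.exp_pos _
        have g1 : α * W (s + 2) * φ t ≤ α * G * W t * dissip u X c ρ₀ t := by
          calc _ ≤ α * W (s + 2) * dissip u X c ρ₀ t :=
                mul_le_mul_of_nonneg_left (hφd t htI) (by positivity)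
            _ ≤ α * (G * W t) * dissip u X c ρ₀ t :=
                mul_le_mul_of_nonneg_right (mul_le_mul_of_nonneg_left hW2 α0.le) hd0
            _ = _ := by ring
        have g2 := mul_le_mul_of_nonneg_left hW1
          (by positivity : 0 ≤ K2 * Real.exp (-(κ * ℓ)))
        simp only [hβ]
        linarith)
    rw [intervalIntegral.integral_add (hφi.const_mul _) intervalIntegrable_const,
      intervalIntegral.integral_const_mul, intervalIntegral.integral_const, smul_eq_mul] at hmain
    have hWp : 0 < W (s + 2) := Real.exp_pos _
    have g1 := mul_le_mul_of_nonneg_left hφε (by positivity : 0 ≤ α * W (s + 2))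
    have g2 := mul_le_mul_of_nonneg_right hℓ (Real.exp_pos _ : 0 < W s).le
    have g3 : (s + 2 - s) * β = 2 * (K2 * G * Real.exp (-(κ * ℓ))) * W s + 1 / (N + 1) := by
      simp only [hβ]; field_simp; ring
    rw [g3] at hmain
    linarith
  have hsum : ∀ k ≤ N, E (t₀ + 2 * (k : ℝ)) - E t₀ ≤
      -(α * ε / 2 * ∑ j ∈ Finset.range k, W (t₀ + 2 * ((j + 1 : ℕ) : ℝ)))
        - α * ε / 2 * W (t₀ + 2 * (k : ℝ)) + α * ε / 2 * W t₀ + k / (N + 1) := by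
    intro k
    induction k with
    | zero => intro _; simp
    | succ k ih =>
      intro hk
      have h1 := ih (by omega)
      have h2 := hstep k (by omega)
      rw [Finset.sum_range_succ]
      have : ((k + 1 : ℕ) : ℝ) / (N + 1) = k / (N + 1) + 1 / (N + 1) := by push_cast; ring
      rw [this]
      linarith
  have hk1 := hsum k hk
  have hW0 : W t₀ = 1 := by simp only [hW, hw]; simp
  have hlowE := w.neg_le_energy hu hV hC hAV0.le (fun x hx => (hAV x hx).1) hA0 (X := X (t₀ + 2 * k))
    R10 hR12 (by positivity : 0 < t₀ + 2 * (k : ℝ)) (fun r hr hlt => by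
      have h := le_of_near_min hV D h0 (x := u r (t₀ + 2 * k))
        (by simpa using hEnear (t₀ + 2 * k) (by simp) r hr hlt)
      rwa [hV0] at h)
  have hupE := (le_abs_self _).trans (w.abs_energy_le hu hV hC hAV0.le (fun x hx => (hAV x hx).1) hA0
    R10 hR12 ht0)
  have htop0 : w.top t₀ = Real.exp (c * (ℓ + Cs)) := by
    unfold TravWeight.top
    simp only [hw]; congr 1; ring
  rw [htop0] at hupE
  have hkN : (k : ℝ) / (N + 1) ≤ 1 := by
    rw [div_le_one (by positivity)]
    have : (k : ℝ) ≤ N := by exact_mod_cast hk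
    linarith
  have hlowE' : -(Kn * W (t₀ + 2 * k)) ≤ E (t₀ + 2 * k) := hlowE
  have hupE' : E t₀ ≤ KE * Real.exp (c * (ℓ + Cs)) := hupE
  rw [hW0] at hk1
  simp only [hWj]
  set S := ∑ j ∈ Finset.range k, W (t₀ + 2 * ((j + 1 : ℕ) : ℝ)) with hS
  have hαε : 0 < α * ε / 2 := by positivity
  have hWp : 0 < W (t₀ + 2 * k) := Real.exp_pos _
  have hfin : S * (α * ε / 2) ≤ (KE * Real.exp (c * (ℓ + Cs)) + α * ε / 2 + 1)
      + Kn * W (t₀ + 2 * k) := by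
    have := mul_pos hαε hWp
    linarith
  calc S ≤ ((KE * Real.exp (c * (ℓ + Cs)) + α * ε / 2 + 1) + Kn * W (t₀ + 2 * k)) / (α * ε / 2) :=
        (le_div_iff₀ hαε).2 hfin
    _ = (KE * Real.exp (c * (ℓ + Cs)) + α * ε / 2 + 1) / (α * ε / 2)
        + Kn / (α * ε / 2) * W (t₀ + 2 * k) := by ring
    _ ≤ _ := by linarith

/-! ### Bounded solutions of the travelling wave equation -/

/-- A Lipschitz function whose square is the rate of decay of a function with vanishing
increments converges to zero. -/
theorem tendsto_zero_of_increments {l : Filter ℝ} {H : ℝ → ℝ} {f : ℝ → Euc n} {c K : ℝ}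
    (hc : 0 < c) (hK : 0 < K)
    (hH : ∀ x, HasDerivAt H (-(c * ‖f x‖ ^ 2)) x)
    (hf : ∀ x y, ‖f y - f x‖ ≤ K * |y - x|)
    (hl : ∀ τ > 0, Tendsto (fun x => H (x + τ) - H x) l (𝓝 0)) : Tendsto f l (𝓝 0) := by
  rw [tendsto_zero_iff_norm_tendsto_zero, Metric.tendsto_nhds]
  intro e he
  have hη : 0 < e / 2 := by positivity
  have hτ : 0 < e / 2 / K := by positivity
  have hpos : 0 < c * (e / 2) ^ 2 * (e / 2 / K) := by positivity
  filter_upwards [(Metric.tendsto_nhds.1 (hl _ hτ)) _ hpos] with x hx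
  rw [Real.dist_eq, sub_zero, abs_of_nonneg (norm_nonneg _)]
  by_contra! hcon
  rw [Real.dist_eq, sub_zero] at hx
  obtain ⟨y, hy, hyeq⟩ := exists_hasDerivAt_eq_slope H (fun x => -(c * ‖f x‖ ^ 2))
    (by linarith : x < x + e / 2 / K)
    (fun y _ => (hH y).continuousAt.continuousWithinAt) (fun y _ => hH y)
  have h1 : H (x + e / 2 / K) - H x = -(c * ‖f y‖ ^ 2) * (e / 2 / K) := by
    rw [hyeq, add_sub_cancel_left, div_mul_cancel₀ _ hτ.ne']
  have h2 : ‖f y - f x‖ ≤ e / 2 := by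
    refine (hf x y).trans ?_
    rw [abs_of_pos (by linarith [hy.1])]
    calc K * (y - x) ≤ K * (e / 2 / K) := by
          apply mul_le_mul_of_nonneg_left _ hK.le; linarith [hy.2]
      _ = e / 2 := by field_simp
  have h3 : e / 2 ≤ ‖f y‖ := by
    have := norm_sub_norm_le (f x) (f y)
    rw [norm_sub_rev] at this
    linarith
  have h4 : c * (e / 2) ^ 2 * (e / 2 / K) ≤ c * ‖f y‖ ^ 2 * (e / 2 / K) := by gcongr
  have h5 := (abs_lt.1 hx).1
  rw [h1] at h5
  linarith

/-- The derivative of a function converging to zero converges to zero when it is Lipschitz. -/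
theorem tendsto_zero_of_lipschitz_deriv {l : Filter ℝ} {f g : ℝ → Euc n} {L : ℝ} (hL : 0 < L)
    (hfg : ∀ x y, ‖f y - f x - (y - x) • g x‖ ≤ L * (y - x) ^ 2)
    (hf : ∀ τ : ℝ, Tendsto (fun x => f (x + τ)) l (𝓝 0)) : Tendsto g l (𝓝 0) := by
  rw [tendsto_zero_iff_norm_tendsto_zero, Metric.tendsto_nhds]
  intro e he
  set τ : ℝ := e / 2 / L with hτdef
  have hτ : 0 < τ := by positivity
  have hLτ : L * τ = e / 2 := by rw [hτdef]; field_simp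
  have hpos : 0 < e * τ / 4 := by positivity
  have h0 := hf 0
  simp only [add_zero] at h0
  filter_upwards [(Metric.tendsto_nhds.1 (hf τ)) _ hpos, (Metric.tendsto_nhds.1 h0) _ hpos]
    with x h1 h2
  rw [dist_zero_right] at h1 h2
  rw [Real.dist_eq, sub_zero, abs_of_nonneg (norm_nonneg _)]
  have h3 := hfg x (x + τ)
  rw [add_sub_cancel_left] at h3
  have h4 : τ * ‖g x‖ ≤ ‖f (x + τ)‖ + ‖f x‖ + L * τ ^ 2 := by
    calc τ * ‖g x‖ = ‖τ • g x‖ := by rw [norm_smul, Real.norm_of_nonneg hτ.le]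
      _ = ‖(f (x + τ) - f x) - (f (x + τ) - f x - τ • g x)‖ := by congr 1; abel
      _ ≤ ‖f (x + τ) - f x‖ + ‖f (x + τ) - f x - τ • g x‖ := norm_sub_le _ _
      _ ≤ _ := add_le_add (norm_sub_le _ _) h3
  have h5 : τ * ‖g x‖ < τ * e := by
    have : L * τ ^ 2 = e / 2 * τ := by rw [← hLτ]; ring
    nlinarith
  exact lt_of_mul_lt_mul_left h5 hτ.le

/-- A bounded continuous curve along which a vector field with isolated zeros converges to zero
converges to one of these zeros. -/
theorem exists_tendsto_of_isolated_zeros {f : ℝ → Euc n} {G : Euc n → Euc n} {C : ℝ}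
    (hf : Continuous f) (hC : ∀ x, ‖f x‖ ≤ C) (hG : Continuous G)
    (hiso : ∀ x, G x = 0 → ∀ᶠ z in 𝓝[≠] x, G z ≠ 0)
    (hlim : Tendsto (fun x => G (f x)) atTop (𝓝 0)) :
    ∃ m, G m = 0 ∧ Tendsto f atTop (𝓝 m) := by
  obtain ⟨m, -, hm⟩ := (isCompact_closedBall (0 : Euc n) C).exists_mapClusterPt (u := f)
    (f := atTop) (tendsto_principal.2 (Eventually.of_forall fun x => by simpa using hC x))
  have hfreq : ∀ e > 0, ∃ᶠ x in atTop, ‖f x - m‖ < e := by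
    intro e he
    have := hm.frequently (Metric.ball_mem_nhds m he)
    simpa [dist_eq_norm] using this
  have hGm : G m = 0 := by
    by_contra hne
    have hpos : 0 < ‖G m‖ := norm_pos_iff.2 hne
    have h1 : ∀ᶠ z in 𝓝 m, ‖G m‖ / 2 < ‖G z‖ :=
      hG.norm.continuousAt.eventually_const_lt (by linarith)
    have h2 : ∀ᶠ x in atTop, ‖G (f x)‖ < ‖G m‖ / 2 := by
      have := hlim.norm
      rw [norm_zero] at this
      exact this.eventually_lt_const (by linarith)
    obtain ⟨x, h3, h4⟩ := ((hm.frequently h1).and_eventually h2).exists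
    exact lt_asymm h3 h4
  refine ⟨m, hGm, ?_⟩
  obtain ⟨r, hr, hball⟩ := Metric.mem_nhdsWithin_iff.1 (hiso m hGm)
  rw [Metric.tendsto_nhds]
  intro e he
  set a := min e r / 2 with ha
  have hmin : 0 < min e r := lt_min he hr
  have ha0 : 0 < a := by positivity
  have har : a < r := lt_of_lt_of_le (by linarith) (min_le_right e r)
  have hae : a < e := lt_of_lt_of_le (by linarith) (min_le_left e r)
  obtain ⟨μ, hμ, hμle⟩ := (isCompact_sphere m a).exists_forall_le' (f := fun z => ‖G z‖)
    hG.norm.continuousOn (a := 0) (by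
      intro b hb
      rw [norm_pos_iff]
      have hb' : dist b m = a := hb
      refine hball ⟨by rw [Metric.mem_ball, hb']; exact har, ?_⟩
      rintro rfl
      rw [dist_self] at hb'
      exact ha0.ne hb')
  have hev : ∀ᶠ x in atTop, ‖G (f x)‖ < μ := by
    have := hlim.norm
    rw [norm_zero] at this
    exact this.eventually_lt_const hμ
  obtain ⟨T, hT⟩ := eventually_atTop.1 hev
  obtain ⟨x₀, hx₀, hTx⟩ := ((hfreq a ha0).and_eventually (eventually_ge_atTop T)).exists
  filter_upwards [eventually_ge_atTop x₀] with x hx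
  rw [dist_eq_norm]
  by_contra! hcon
  obtain ⟨y, hy, hya⟩ := intermediate_value_Icc hx
    ((hf.sub continuous_const).norm.continuousOn : ContinuousOn (fun x => ‖f x - m‖) _)
    ⟨hx₀.le, hae.le.trans hcon⟩
  have := hμle (f y) (by rw [mem_sphere_iff_norm]; exact hya)
  exact absurd (hT y (hTx.trans hy.1)) (not_lt.2 this)

/-- Critical points of a potential satisfying the nondegeneracy hypothesis are isolated. -/
theorem eventually_gradient_ne_zero {V : Euc n → ℝ} (hV : ContDiff ℝ 2 V) (hnd : HNonDeg V)
    {x : Euc n} (hx : gradient V x = 0) : ∀ᶠ z in 𝓝[≠] x, gradient V z ≠ 0 := by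
  refine (hasFDerivAt_gradient hV x).eventually_ne ?_
  obtain ⟨K, -, hK⟩ := LinearMap.exists_antilipschitzWith (hess V x : Euc n →ₗ[ℝ] Euc n)
    (LinearMap.ker_eq_bot'.2 fun v hv => hnd x hx v hv)
  exact ⟨K, hK⟩

theorem norm_taylor_le_of_lipschitz_deriv {f f' : ℝ → Euc n} {L : ℝ}
    (hf : ∀ x, HasDerivAt f (f' x) x) (hf' : ∀ x y, ‖f' y - f' x‖ ≤ L * |y - x|) (x y : ℝ) :
    ‖f y - f x - (y - x) • f' x‖ ≤ L * (y - x) ^ 2 := by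
  have hL : 0 ≤ L := by
    have := (norm_nonneg _).trans (hf' 0 1)
    simpa using this
  have key := (convex_uIcc x y).norm_image_sub_le_of_norm_hasDerivWithin_le
    (f := fun s => f s - (s - x) • f' x) (f' := fun s => f' s - f' x) (C := L * |y - x|)
    (fun s _ => by
      have h := (hf s).sub (((hasDerivAt_id s).sub_const x).smul_const (f' x))
      simp only [one_smul] at h
      exact h.hasDerivWithinAt)
    (fun s hs => (hf' x s).trans (mul_le_mul_of_nonneg_left (abs_sub_left_of_mem_uIcc hs) hL))
    left_mem_uIcc right_mem_uIcc
  simp only [sub_self, zero_smul, sub_zero] at key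
  rw [Real.norm_eq_abs, mul_assoc, ← sq, sq_abs] at key
  calc _ = ‖f y - (y - x) • f' x - f x‖ := by congr 1; abel
    _ ≤ _ := key

/-- A nontrivial bounded solution of the travelling wave equation remaining close to the origin
at the right is the profile of a front invading the origin. -/
theorem exists_mem_Phi_of_bounded {V : Euc n → ℝ} (hV : ContDiff ℝ 2 V) (D : EscData n V)
    (h0 : (0 : Euc n) ∈ MinSet V) (hV0 : V 0 = 0) (hnd : HNonDeg V) (hbist : HOnlyBist V)
    {c C s : ℝ} (hc : 0 < c) {φ φ₁ : ℝ → Euc n}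
    (hφ : ∀ x, HasDerivAt φ (φ₁ x) x)
    (hφ₁ : ∀ x, HasDerivAt φ₁ (-(c • φ₁ x) + gradient V (φ x)) x)
    (hC : ∀ x, ‖φ x‖ ≤ C) (hC₁ : ∀ x, ‖φ₁ x‖ ≤ C)
    (hesc : ∀ x > 0, ‖φ x‖ ≤ D.dEsc) (hs : 0 < ‖φ s‖ + ‖φ₁ s‖) :
    ∃ mm ∈ MinSet V, φ ∈ Phi V c mm 0 := by
  have hC0 : 0 ≤ C := (norm_nonneg _).trans (hC 0)
  obtain ⟨A, hA, hlip, hquad⟩ := exists_quadratic_bounds hV hV0 h0.1 C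
  have hφlip : ∀ x y, ‖φ y - φ x‖ ≤ C * |y - x| := fun x y => by
    simpa using convex_univ.norm_image_sub_le_of_norm_hasDerivWithin_le
      (fun z _ => (hφ z).hasDerivWithinAt) (fun z _ => hC₁ z) (mem_univ x) (mem_univ y)
  have hG : ∀ x, ‖-(c • φ₁ x) + gradient V (φ x)‖ ≤ c * C + A * C := fun x => by
    refine (norm_add_le _ _).trans ?_
    rw [norm_neg, norm_smul, Real.norm_of_nonneg hc.le]
    have h1 := (hquad (φ x) (hC x)).2
    gcongr
    · exact hC₁ x
    · exact h1.trans (by gcongr; exact hC x)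
  have hφ₁lip : ∀ x y, ‖φ₁ y - φ₁ x‖ ≤ (c * C + A * C) * |y - x| := fun x y => by
    simpa using convex_univ.norm_image_sub_le_of_norm_hasDerivWithin_le
      (fun z _ => (hφ₁ z).hasDerivWithinAt) (fun z _ => hG z) (mem_univ x) (mem_univ y)
  have hGlip : ∀ x y, ‖(-(c • φ₁ y) + gradient V (φ y)) - (-(c • φ₁ x) + gradient V (φ x))‖ ≤
      (c * (c * C + A * C) + A * C) * |y - x| := fun x y => by
    calc _ = ‖-(c • (φ₁ y - φ₁ x)) + (gradient V (φ y) - gradient V (φ x))‖ := by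
          congr 1; rw [smul_sub]; abel
      _ ≤ c * ‖φ₁ y - φ₁ x‖ + A * ‖φ y - φ x‖ := by
          refine (norm_add_le _ _).trans ?_
          rw [norm_neg, norm_smul, Real.norm_of_nonneg hc.le]
          gcongr
          exact hlip _ _ (hC y) (hC x)
      _ ≤ c * ((c * C + A * C) * |y - x|) + A * (C * |y - x|) := by
          gcongr
          · exact hφ₁lip x y
          · exact hφlip x y
      _ = _ := by ring
  set H : ℝ → ℝ := fun x => ‖φ₁ x‖ ^ 2 / 2 - V (φ x) with hHdef
  have hH : ∀ x, HasDerivAt H (-(c * ‖φ₁ x‖ ^ 2)) x := fun x => by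
    have h1 := ((hφ₁ x).norm_sq.div_const 2).sub (hasDerivAt_comp_gradient hV (hφ x))
    refine h1.congr_deriv ?_
    rw [inner_add_right, inner_neg_right, inner_smul_right, real_inner_self_eq_norm_sq,
      real_inner_comm (φ₁ x) (gradient V (φ x))]
    ring
  have hHanti : Antitone H := antitone_of_hasDerivAt_nonpos hH fun x => by
    have : 0 ≤ c * ‖φ₁ x‖ ^ 2 := by positivity
    simpa using this
  have hHbdd : ∀ x, |H x| ≤ C ^ 2 / 2 + A * C ^ 2 := fun x => by
    have h1 := (hquad (φ x) (hC x)).1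
    have h2 : ‖φ₁ x‖ ^ 2 ≤ C ^ 2 := by gcongr; exact hC₁ x
    have h3 : A * ‖φ x‖ ^ 2 ≤ A * C ^ 2 := by gcongr; exact hC x
    refine (abs_sub _ _).trans ?_
    rw [abs_of_nonneg (by positivity : 0 ≤ ‖φ₁ x‖ ^ 2 / 2)]
    linarith
  have hHtop := tendsto_atTop_ciInf hHanti
    ⟨-(C ^ 2 / 2 + A * C ^ 2), by rintro _ ⟨x, rfl⟩; exact (abs_le.1 (hHbdd x)).1⟩
  have hHbot := tendsto_atBot_ciSup hHanti
    ⟨C ^ 2 / 2 + A * C ^ 2, by rintro _ ⟨x, rfl⟩; exact (abs_le.1 (hHbdd x)).2⟩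
  have hgrad : ∀ l : Filter ℝ, (∀ τ : ℝ, Tendsto (fun x => x + τ) l l) →
      (∃ a, Tendsto H l (𝓝 a)) → Tendsto (fun x => gradient V (φ x)) l (𝓝 0) := by
    rintro l hl ⟨a, ha⟩
    have h1 : Tendsto φ₁ l (𝓝 0) := by
      refine tendsto_zero_of_increments (K := c * C + A * C + 1) hc (by positivity) hH
        (fun x y => (hφ₁lip x y).trans
          (mul_le_mul_of_nonneg_right (by linarith) (abs_nonneg _))) fun τ _ => ?_
      simpa using (ha.comp (hl τ)).sub ha
    have h2 : Tendsto (fun x => -(c • φ₁ x) + gradient V (φ x)) l (𝓝 0) :=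
      tendsto_zero_of_lipschitz_deriv (L := c * (c * C + A * C) + A * C + 1) (by positivity)
        (fun x y => (norm_taylor_le_of_lipschitz_deriv hφ₁ hGlip x y).trans
          (mul_le_mul_of_nonneg_right (by linarith) (sq_nonneg _))) fun τ => h1.comp (hl τ)
    simpa using h2.add (h1.const_smul c)
  have hφc : Continuous φ := continuous_iff_continuousAt.2 fun x => (hφ x).continuousAt
  have hgc : Continuous (gradient V) := (contDiff_gradient hV).continuous
  obtain ⟨mp, hmp, htop⟩ := exists_tendsto_of_isolated_zeros hφc hC hgc
    (fun x hx => eventually_gradient_ne_zero hV hnd hx)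
    (hgrad atTop (fun τ => tendsto_atTop_add_const_right _ τ tendsto_id) ⟨_, hHtop⟩)
  obtain ⟨mm, hmm, hbot'⟩ := exists_tendsto_of_isolated_zeros (f := fun x => φ (-x))
    (hφc.comp continuous_neg) (fun x => hC (-x)) hgc
    (fun x hx => eventually_gradient_ne_zero hV hnd hx)
    ((hgrad atBot (fun τ => tendsto_atBot_add_const_right _ τ tendsto_id) ⟨_, hHbot⟩).comp
      tendsto_neg_atTop_atBot)
  have hbot : Tendsto φ atBot (𝓝 mm) := by
    simpa [Function.comp_def] using hbot'.comp tendsto_neg_atBot_atTop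
  have hmpesc : ‖mp‖ ≤ D.dEsc :=
    le_of_tendsto htop.norm ((eventually_gt_atTop 0).mono fun x hx => hesc x hx)
  have hmp0 : mp = 0 := by
    have h1 := inner_gradient_ge_of_near_min hV D h0 (x := mp) (by simpa using hmpesc)
    rw [hmp, inner_zero_right, sub_zero] at h1
    have h2 : ‖mp‖ ^ 2 ≤ 0 := by nlinarith [D.lmin_pos, sq_nonneg ‖mp‖]
    simpa using h2
  subst hmp0
  have hderiv : deriv φ = φ₁ := funext fun x => (hφ x).deriv
  have hmem : φ ∈ Phi V c mm 0 := by
    refine ⟨?_, fun x => (hφ x).differentiableAt, fun x => ?_, fun x => ?_, hbot, htop⟩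
    · by_contra! hcon
      have hconst : φ = fun _ => φ 0 := funext fun x => hcon x 0
      have hφ0 : φ 0 = 0 := by
        rw [hconst] at htop
        exact tendsto_nhds_unique tendsto_const_nhds htop
      have h1 : φ₁ s = 0 := by
        rw [← hderiv, hconst, deriv_const]
      rw [hcon s 0, hφ0, h1] at hs
      simp at hs
    · rw [hderiv]; exact (hφ₁ x).differentiableAt
    · rw [hderiv]; exact (hφ₁ x).deriv
  exact ⟨mm, hbist 0 h0 mm hmm c hc ⟨φ, hmem⟩, hmem⟩

/-! ### Compactness around the escape point -/

theorem exists_tendsto_of_eventually_norm_le {ι E : Type*} [NormedAddCommGroup E] [ProperSpace E]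
    (U : Ultrafilter ι) {f : ι → E} {C : ℝ} (h : ∀ᶠ i in (U : Filter ι), ‖f i‖ ≤ C) :
    ∃ x, Tendsto f U (𝓝 x) := by
  obtain ⟨x, -, hx⟩ := (isCompact_closedBall (0 : E) C).ultrafilter_le_nhds' (U.map f)
    (by
      rw [Ultrafilter.mem_map]
      filter_upwards [h] with i hi
      simpa using hi)
  exact ⟨x, hx⟩

theorem hasDerivAt_of_norm_sub_le_sq {f : ℝ → Euc n} {f' : Euc n} {x K : ℝ}
    (h : ∀ y, ‖f y - f x - (y - x) • f'‖ ≤ K * (y - x) ^ 2) : HasDerivAt f f' x := by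
  rw [hasDerivAt_iff_isLittleO]
  refine Asymptotics.IsBigO.trans_isLittleO ?_
    (Asymptotics.isLittleO_pow_sub_sub x (one_lt_two))
  refine Asymptotics.IsBigO.of_bound K (Eventually.of_forall fun y => ?_)
  simpa using h y

namespace IsRadialSolution

variable {d : ℕ} {V : Euc n → ℝ} {u : ℝ → ℝ → Euc n} {C : ℝ}

/-- Where the dissipation is small, the solution almost solves the travelling wave equation. -/
theorem norm_ur_sub_sub_le (hu : IsRadialSolution d V u) (hC : SolBound u C)
    (hV : ContDiff ℝ 2 V) (hd : 1 ≤ d) {A : ℝ} (hA : 0 ≤ A)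
    (hlip : ∀ x y : Euc n, ‖x‖ ≤ C → ‖y‖ ≤ C → ‖gradient V x - gradient V y‖ ≤ A * ‖x - y‖)
    {X : ℝ → ℝ} {c ρ₀ t a b e : ℝ} (hc : 0 ≤ c) (ht : 0 < t) (hX : 0 < X t - ρ₀) (hab : a < b)
    (ha : X t - ρ₀ ≤ a) (hb : b ≤ X t + ρ₀) (he : e ∈ Icc a b) :
    ‖ur u b t - ur u a t - (b - a) • (-(c • ur u e t) + gradient V (u e t))‖ ≤
      (1 + (c + A) * C) * (b - a) ^ 2 + dissip u X c ρ₀ t / (b - a) +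
        (d - 1) / a * C * (b - a) := by
  have ha0 : 0 < a := hX.trans_le ha
  have hba : 0 < b - a := sub_pos.2 hab
  have hd' : (0 : ℝ) ≤ d - 1 := by
    have : (1 : ℝ) ≤ d := by exact_mod_cast hd
    linarith
  set F : Euc n := -(c • ur u e t) + gradient V (u e t) with hF
  set Y : ℝ → Euc n := fun r => ut u r t + c • ur u r t with hY
  have hYc : ContinuousOn Y (Ioi 0) :=
    (hu.continuousOn_ut hV ht).add ((hu.continuous_ur ht).const_smul c).continuousOn
  have hYsq : IntervalIntegrable (fun r => ‖Y r‖ ^ 2) volume a b :=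
    ((hYc.norm.pow 2).mono fun r hr => ha0.trans_le
      (by rw [uIcc_of_le hab.le] at hr; exact hr.1)).intervalIntegrable
  have hintv : ∫ r in a..b, (urr u r t - F) = ur u b t - ur u a t - (b - a) • F := by
    rw [intervalIntegral.integral_sub ((hu.cont_rr t ht).intervalIntegrable a b)
      intervalIntegrable_const, intervalIntegral.integral_const,
      intervalIntegral.integral_eq_sub_of_hasDerivAt (fun r _ => hu.hasDerivAt_rr ht r)
        ((hu.cont_rr t ht).intervalIntegrable a b)]
  have hpt : ∀ r ∈ Icc a b, ‖urr u r t - F‖ ≤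
      ((1 + (c + A) * C) * (b - a) + (d - 1) / a * C) + ‖Y r‖ ^ 2 / (b - a) := by
    intro r hr
    have hr0 : 0 < r := ha0.trans_le hr.1
    have he0 : 0 < e := ha0.trans_le he.1
    have hre : |r - e| ≤ b - a := abs_sub_le_of_le_of_le hr.1 hr.2 he.1 he.2
    have h1 : urr u r t - F = Y r - c • (ur u r t - ur u e t) +
        (gradient V (u r t) - gradient V (u e t)) - ((d - 1 : ℝ) / r) • ur u r t := by
      rw [hF, hY, smul_sub]
      simp only [hu.pde r hr0 t ht]
      abel
    have h2 : ‖Y r‖ ≤ (b - a) + ‖Y r‖ ^ 2 / (b - a) := by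
      rw [← sub_le_iff_le_add', le_div_iff₀ hba]
      nlinarith [sq_nonneg (‖Y r‖ - (b - a)), norm_nonneg (Y r), sq_nonneg (‖Y r‖)]
    have h3 : ‖ur u r t - ur u e t‖ ≤ C * (b - a) :=
      (hu.norm_ur_sub_le hC ht he0.le hr0.le).trans
        (mul_le_mul_of_nonneg_left hre hC.1.le)
    have h4 : ‖gradient V (u r t) - gradient V (u e t)‖ ≤ A * (C * (b - a)) := by
      refine (hlip _ _ (hC.2 r t hr0.le ht).1 (hC.2 e t he0.le ht).1).trans ?_
      gcongr
      exact (hu.norm_r_sub_le hC ht he0.le hr0.le).trans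
        (mul_le_mul_of_nonneg_left hre hC.1.le)
    have h5 : ‖((d - 1 : ℝ) / r) • ur u r t‖ ≤ (d - 1) / a * C := by
      rw [norm_smul, Real.norm_of_nonneg (by positivity)]
      gcongr
      · exact hr.1
      · exact (hC.2 r t hr0.le ht).2.1
    rw [h1]
    calc _ ≤ ‖Y r‖ + ‖c • (ur u r t - ur u e t)‖ +
          ‖gradient V (u r t) - gradient V (u e t)‖ + ‖((d - 1 : ℝ) / r) • ur u r t‖ := by
          refine (norm_sub_le _ _).trans (add_le_add_left ?_ _)
          exact (norm_add_le _ _).trans (add_le_add_left (norm_sub_le _ _) _)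
      _ ≤ ((b - a) + ‖Y r‖ ^ 2 / (b - a)) + c * (C * (b - a)) + A * (C * (b - a)) +
          (d - 1) / a * C := by
          rw [norm_smul c, Real.norm_of_nonneg hc]
          gcongr
      _ = _ := by ring
  have hle : ‖∫ r in a..b, (urr u r t - F)‖ ≤
      ∫ r in a..b, (((1 + (c + A) * C) * (b - a) + (d - 1) / a * C) + ‖Y r‖ ^ 2 / (b - a)) :=
    intervalIntegral.norm_integral_le_of_norm_le hab.le
      (Eventually.of_forall fun r hr => hpt r ⟨hr.1.le, hr.2⟩)
      (intervalIntegrable_const.add (hYsq.div_const _))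
  rw [intervalIntegral.integral_add intervalIntegrable_const (hYsq.div_const _),
    intervalIntegral.integral_const, intervalIntegral.integral_div, smul_eq_mul, hintv] at hle
  have hdis : ∫ r in a..b, ‖Y r‖ ^ 2 ≤ dissip u X c ρ₀ t := by
    have heq : dissip u X c ρ₀ t = ∫ r in (X t - ρ₀)..(X t + ρ₀), ‖Y r‖ ^ 2 := by
      rw [dissip, intervalIntegral.integral_comp_add_left (fun r => ‖Y r‖ ^ 2), ← sub_eq_add_neg]
    rw [heq]
    refine intervalIntegral.integral_mono_interval ha hab.le hb
      (Eventually.of_forall fun r => sq_nonneg _) ?_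
    refine ((hYc.norm.pow 2).mono fun r hr => ?_).intervalIntegrable
    rw [uIcc_of_le (by linarith)] at hr
    exact hX.trans_le hr.1
  refine hle.trans ?_
  have : (∫ r in a..b, ‖Y r‖ ^ 2) / (b - a) ≤ dissip u X c ρ₀ t / (b - a) := by gcongr
  calc _ = (1 + (c + A) * C) * (b - a) ^ 2 + (d - 1) / a * C * (b - a) +
        (∫ r in a..b, ‖Y r‖ ^ 2) / (b - a) := by ring
    _ ≤ _ := by linarith

end IsRadialSolution

/-- If no front invades the origin at the speed `c`, the dissipation around the escape point in a
frame travelling at this speed is bounded from below. -/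
theorem exists_dissip_lower_bound {d : ℕ} {V : Euc n → ℝ} {u : ℝ → ℝ → Euc n}
    (hu : IsRadialSolution d V u) (hV : ContDiff ℝ 2 V) (hd : 1 ≤ d) (D : EscData n V)
    (h0 : (0 : Euc n) ∈ MinSet V) (hV0 : V 0 = 0) (hnd : HNonDeg V) (hbist : HOnlyBist V)
    {X R : ℝ → ℝ} {c₀ c : ℝ} (hX : IsEscapePoint V D u X R c₀) (hc : 0 < c)
    (hinv : PhiInv V c 0 = ∅) :
    ∃ ε ρ₀ T, 0 < ε ∧ 0 ≤ ρ₀ ∧ ∀ t ≥ T, ε ≤ dissip u X c ρ₀ t := by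
  obtain ⟨C, hC⟩ := hu.exists_solBound
  obtain ⟨A, hA, hlip, -⟩ := exists_quadratic_bounds hV hV0 h0.1 C
  obtain ⟨M, η, T₁, hη, htrig⟩ := hX.exists_trigger
  obtain ⟨T₂, hT₂, hlin⟩ := hX.eventually_ge
  by_contra! hcon
  have hc₀ := hX.speed_pos
  have hseq : ∀ p : ℕ, ∃ t ≥ (p : ℝ) + max T₁ T₂ + (p + 1) / (c₀ * (3 / 4)),
      dissip u X c p t < 1 / ((p : ℝ) + 1) :=
    fun p => hcon _ _ _ (by positivity) (by positivity)
  choose t htp' hdis using hseq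
  have hfrac : ∀ p : ℕ, 0 ≤ ((p : ℝ) + 1) / (c₀ * (3 / 4)) := fun p => by positivity
  have htp : ∀ p : ℕ, (p : ℝ) + max T₁ T₂ ≤ t p := fun p => by linarith [htp' p, hfrac p]
  set U : Ultrafilter ℕ := hyperfilter ℕ with hU
  have hUtop : (U : Filter ℕ) ≤ atTop := Nat.hyperfilter_le_atTop
  have hcast : Tendsto (fun p : ℕ => (p : ℝ)) U atTop := tendsto_natCast_atTop_atTop.mono_left hUtop
  have htT₁ : ∀ p, T₁ ≤ t p := fun p => by
    have := htp p
    linarith [le_max_left T₁ T₂, (Nat.cast_nonneg p : (0 : ℝ) ≤ p)]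
  have htT₂ : ∀ p, T₂ ≤ t p := fun p => by
    have := htp p
    linarith [le_max_right T₁ T₂, (Nat.cast_nonneg p : (0 : ℝ) ≤ p)]
  have ht0 : ∀ p, 0 < t p := fun p => hT₂.trans_le (htT₂ p)
  have httop : Tendsto t U atTop := by
    refine tendsto_atTop_mono (fun p => ?_) hcast
    have := htp p
    linarith [le_max_right T₁ T₂]
  have hXtop : Tendsto (fun p => X (t p)) U atTop := by
    exact tendsto_atTop_mono (fun p => hlin _ (htT₂ p)) (httop.const_mul_atTop (by positivity))
  have hpos : ∀ ρ : ℝ, ∀ᶠ p in (U : Filter ℕ), 0 < X (t p) + ρ := fun ρ =>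
    (hXtop.eventually_gt_atTop (-ρ)).mono fun p hp => by linarith
  have hv : ∀ ρ : ℝ, ∃ x, Tendsto (fun p => u (X (t p) + ρ) (t p)) U (𝓝 x) := fun ρ =>
    exists_tendsto_of_eventually_norm_le U ((hpos ρ).mono fun p hp => (hC.2 _ _ hp.le (ht0 p)).1)
  have hv₁ : ∀ ρ : ℝ, ∃ x, Tendsto (fun p => ur u (X (t p) + ρ) (t p)) U (𝓝 x) := fun ρ =>
    exists_tendsto_of_eventually_norm_le U
      ((hpos ρ).mono fun p hp => (hC.2 _ _ hp.le (ht0 p)).2.1)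
  choose φ hφ using hv
  choose φ₁ hφ₁ using hv₁
  have hφC : ∀ ρ, ‖φ ρ‖ ≤ C := fun ρ =>
    le_of_tendsto (hφ ρ).norm ((hpos ρ).mono fun p hp => (hC.2 _ _ hp.le (ht0 p)).1)
  have hφ₁C : ∀ ρ, ‖φ₁ ρ‖ ≤ C := fun ρ =>
    le_of_tendsto (hφ₁ ρ).norm ((hpos ρ).mono fun p hp => (hC.2 _ _ hp.le (ht0 p)).2.1)
  have hderiv : ∀ x, HasDerivAt φ (φ₁ x) x := fun x => by
    refine hasDerivAt_of_norm_sub_le_sq (K := C) fun y => ?_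
    refine le_of_tendsto (((hφ y).sub (hφ x)).sub ((hφ₁ x).const_smul (y - x))).norm ?_
    filter_upwards [hpos x, hpos y] with p hx hy
    have := hu.norm_taylor_le hC (ht0 p) hx.le hy.le
    rwa [add_sub_add_left_eq_sub] at this
  have hgc : Continuous (gradient V) := (contDiff_gradient hV).continuous
  have hstep : ∀ a b e, a < b → e ∈ Icc a b →
      ‖φ₁ b - φ₁ a - (b - a) • (-(c • φ₁ e) + gradient V (φ e))‖ ≤
        (1 + (c + A) * C) * (b - a) ^ 2 := by
    intro a b e hab he
    have hlim : Tendsto (fun p : ℕ => (1 + (c + A) * C) * (b - a) ^ 2 +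
        1 / ((p : ℝ) + 1) / (b - a) + (d - 1) / (X (t p) + a) * C * (b - a)) U
        (𝓝 ((1 + (c + A) * C) * (b - a) ^ 2 + 0 / (b - a) + 0 * C * (b - a))) := by
      refine (tendsto_const_nhds.add (Tendsto.div_const ?_ _)).add
        ((Tendsto.mul_const _ ?_).mul_const _)
      · exact tendsto_one_div_add_atTop_nhds_zero_nat.mono_left hUtop
      · exact (tendsto_atTop_add_const_right _ a hXtop).const_div_atTop _
    rw [zero_div, zero_mul, zero_mul, add_zero, add_zero] at hlim
    refine le_of_tendsto_of_tendsto ((((hφ₁ b).sub (hφ₁ a)).sub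
      ((((hφ₁ e).const_smul c).neg.add ((hgc.tendsto _).comp (hφ e))).const_smul (b - a))).norm)
      hlim ?_
    filter_upwards [hpos a, hcast.eventually_ge_atTop (-a), hcast.eventually_ge_atTop b] with
      p hpa hp1 hp2
    have hXp : 0 < X (t p) - p := by
      have h1 := hlin _ (htT₂ p)
      have h2 : ((p : ℝ) + 1) / (c₀ * (3 / 4)) ≤ t p := by
        linarith [htp' p, le_max_right T₁ T₂, (Nat.cast_nonneg p : (0 : ℝ) ≤ p)]
      rw [div_le_iff₀ (by positivity)] at h2
      linarith
    have key := hu.norm_ur_sub_sub_le hC hV hd hA.le hlip (a := X (t p) + a) (b := X (t p) + b)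
      (e := X (t p) + e) hc.le (ht0 p) hXp (by linarith) (by linarith) (by linarith)
      ⟨by linarith [he.1], by linarith [he.2]⟩
    rw [add_sub_add_left_eq_sub] at key
    refine key.trans ?_
    have hba : 0 < b - a := sub_pos.2 hab
    gcongr
    exact (hdis p).le
  have hderiv₁ : ∀ x, HasDerivAt φ₁ (-(c • φ₁ x) + gradient V (φ x)) x := fun x => by
    refine hasDerivAt_of_norm_sub_le_sq (K := 1 + (c + A) * C) fun y => ?_
    rcases lt_trichotomy x y with h | rfl | h
    · exact hstep x y x h (left_mem_Icc.2 h.le)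
    · simp
    · have := hstep y x x h (right_mem_Icc.2 h.le)
      rw [← norm_neg] at this
      convert this using 1
      · congr 1
        rw [← neg_sub x y, neg_smul]
        abel
      · ring
  have hesc : ∀ ρ > 0, ‖φ ρ‖ ≤ D.dEsc := fun ρ hρ => by
    refine le_of_tendsto (hφ ρ).norm ?_
    filter_upwards [(hX.gap.comp httop).eventually_ge_atTop ρ] with p hp
    simp only [Function.comp_apply] at hp
    exact hX.norm_le _ (ht0 p) _ (by linarith) (by linarith)
  have htrig' : ∀ p, ∃ s, |s| ≤ M ∧ η ≤ ‖u (X (t p) + s) (t p)‖ + ‖ur u (X (t p) + s) (t p)‖ :=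
    fun p => by
      obtain ⟨r, hr, hr'⟩ := htrig (t p) (htT₁ p)
      exact ⟨r - X (t p), hr, by rwa [add_sub_cancel]⟩
  choose s hsM hs using htrig'
  obtain ⟨s₀, hs₀⟩ := exists_tendsto_of_eventually_norm_le U (f := s) (C := M)
    (Eventually.of_forall fun p => by simpa using hsM p)
  have htrig₀ : η ≤ ‖φ s₀‖ + ‖φ₁ s₀‖ := by
    have hlim : Tendsto (fun p => ‖u (X (t p) + s₀) (t p)‖ + ‖ur u (X (t p) + s₀) (t p)‖ +
        2 * C * |s p - s₀|) U (𝓝 (‖φ s₀‖ + ‖φ₁ s₀‖ + 2 * C * |s₀ - s₀|)) :=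
      ((hφ s₀).norm.add (hφ₁ s₀).norm).add ((hs₀.sub_const s₀).abs.const_mul _)
    rw [sub_self, abs_zero, mul_zero, add_zero] at hlim
    refine ge_of_tendsto hlim ?_
    filter_upwards [hpos s₀, hpos (-M)] with p h1 h2
    have h3 : 0 ≤ X (t p) + s p := by linarith [(abs_le.1 (hsM p)).1]
    have h4 := hu.norm_ur_sub_le hC (ht0 p) h1.le h3
    have h5 := hu.norm_r_sub_le hC (ht0 p) h1.le h3
    rw [add_sub_add_left_eq_sub] at h4 h5
    have h6 := norm_sub_norm_le (u (X (t p) + s p) (t p)) (u (X (t p) + s₀) (t p))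
    have h7 := norm_sub_norm_le (ur u (X (t p) + s p) (t p)) (ur u (X (t p) + s₀) (t p))
    linarith [hs p]
  obtain ⟨mm, hmm, hmem⟩ := exists_mem_Phi_of_bounded hV D h0 hV0 hnd hbist hc hderiv hderiv₁
    hφC hφ₁C hesc (hη.trans_le htrig₀)
  have : φ ∈ PhiInv V c 0 := mem_biUnion hmm hmem
  rw [hinv] at this
  exact this

/-! ### Mean speed of the escape point -/

theorem HasUpperSpeed.mono {X : ℝ → ℝ} {c c' : ℝ} (h : HasUpperSpeed X c) (hc : c ≤ c') :
    HasUpperSpeed X c' := by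
  obtain ⟨C, T, h⟩ := h
  exact ⟨C, T, fun t ht s hs => (h t ht s hs).trans
    (by linarith [mul_le_mul_of_nonneg_right hc hs])⟩

/-- A bound on the mean speed over time intervals of a given length is a bound on the mean
speed. -/
theorem HasUpperSpeed.of_step {X : ℝ → ℝ} {c c₁ τ T : ℝ} (h : HasUpperSpeed X c₁) (hτ : 0 < τ)
    (hstep : ∀ t ≥ T, X (t + τ) ≤ X t + c * τ) : HasUpperSpeed X c := by
  obtain ⟨C, T₁, h⟩ := h
  have hiter : ∀ t ≥ T, ∀ m : ℕ, X (t + m * τ) ≤ X t + c * (m * τ) := by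
    intro t ht m
    induction m with
    | zero => simp
    | succ m ih =>
      have h1 : 0 ≤ (m : ℝ) * τ := by positivity
      have := hstep (t + m * τ) (by linarith)
      push_cast
      rw [show t + ((m : ℝ) + 1) * τ = t + m * τ + τ by ring]
      linarith
  refine ⟨|c| * τ + |c₁| * τ + C, max T T₁, fun t ht s hs => ?_⟩
  have hm := Nat.floor_le (div_nonneg hs hτ.le)
  have hm' := Nat.lt_floor_add_one (s / τ)
  set m := ⌊s / τ⌋₊ with hmdef
  rw [le_div_iff₀ hτ] at hm
  rw [div_lt_iff₀ hτ] at hm'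
  have h1 := hiter t ((le_max_left _ _).trans ht) m
  have h0 : 0 ≤ (m : ℝ) * τ := by positivity
  have h2 := h (t + m * τ) (by linarith [le_max_right T T₁]) (s - m * τ) (by linarith)
  rw [show t + m * τ + (s - m * τ) = t + s by ring] at h2
  have h3 : c₁ * (s - m * τ) ≤ |c₁| * τ := by
    refine (mul_le_mul_of_nonneg_right (le_abs_self c₁) (by linarith)).trans ?_
    exact mul_le_mul_of_nonneg_left (by linarith) (abs_nonneg _)
  have h4 : -(c * (s - m * τ)) ≤ |c| * τ := by
    rw [← neg_mul]
    refine (mul_le_mul_of_nonneg_right (neg_le_abs c) (by linarith)).trans ?_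
    exact mul_le_mul_of_nonneg_left (by linarith) (abs_nonneg _)
  linarith

/-- A sequence dominating its partial sums grows exponentially. -/
theorem mul_le_of_sum_le {W : ℕ → ℝ} {B C : ℝ} {N : ℕ} (hW : ∀ k, 0 ≤ W k) (hB : 1 ≤ B)
    (hC : 0 < C) (hN : 1 ≤ N)
    (hsum : ∀ k ≤ 2 * N, ∑ j ∈ Finset.range k, W (j + 1) ≤ C + B * W k)
    (htrig : 2 * C ≤ W N) (hpow : (1 - 1 / (2 * B)) ^ N * (4 * B * C) ≤ 1) :
    2 * C * W N ≤ W (2 * N) := by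
  set S : ℕ → ℝ := fun k => ∑ j ∈ Finset.range k, W (j + 1) with hS
  have hSsucc : ∀ k, S (k + 1) = S k + W (k + 1) := fun k => Finset.sum_range_succ _ _
  have hSmono : Monotone S := monotone_nat_of_le_succ fun k => by
    rw [hSsucc]; linarith [hW (k + 1)]
  have hSN : W N ≤ S N := by
    obtain ⟨m, rfl⟩ : ∃ m, N = m + 1 := ⟨N - 1, by omega⟩
    rw [hSsucc]
    have : 0 ≤ S m := Finset.sum_nonneg fun j _ => hW _
    linarith
  have hhalf : ∀ k, N ≤ k → k ≤ 2 * N → S k ≤ 2 * B * W k := fun k h1 h2 => by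
    have h3 := hsum k h2
    have h4 := hSmono h1
    change S k ≤ _ at h3
    linarith
  have hθ : 0 ≤ 1 - 1 / (2 * B) := by
    rw [sub_nonneg, div_le_one (by linarith)]
    linarith
  have hiter : ∀ i ≤ N, S N ≤ (1 - 1 / (2 * B)) ^ i * S (N + i) := by
    intro i
    induction i with
    | zero => simp
    | succ i ih =>
      intro hi
      refine (ih (by omega)).trans ?_
      rw [pow_succ, mul_assoc]
      refine mul_le_mul_of_nonneg_left ?_ (pow_nonneg hθ i)
      have h1 := hhalf (N + (i + 1)) (by omega) (by omega)
      have h2 : S (N + (i + 1)) = S (N + i) + W (N + (i + 1)) := hSsucc _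
      rw [← mul_le_mul_iff_right₀ (by linarith : 0 < 2 * B)]
      have h3 : 2 * B * ((1 - 1 / (2 * B)) * S (N + (i + 1))) =
          2 * B * S (N + (i + 1)) - S (N + (i + 1)) := by
        field_simp
      have h4 : 2 * B * S (N + (i + 1)) = 2 * B * S (N + i) + 2 * B * W (N + (i + 1)) := by
        rw [h2]; ring
      rw [h3]
      linarith
  have h1 := hiter N le_rfl
  rw [← two_mul] at h1
  have h2 := hhalf (2 * N) (by omega) le_rfl
  have h3 : W N ≤ (1 - 1 / (2 * B)) ^ N * (2 * B * W (2 * N)) :=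
    hSN.trans (h1.trans (mul_le_mul_of_nonneg_left h2 (pow_nonneg hθ _)))
  calc 2 * C * W N ≤ 2 * C * ((1 - 1 / (2 * B)) ^ N * (2 * B * W (2 * N))) := by gcongr
    _ = (1 - 1 / (2 * B)) ^ N * (4 * B * C) * W (2 * N) := by ring
    _ ≤ 1 * W (2 * N) := mul_le_mul_of_nonneg_right hpow (hW _)
    _ = _ := one_mul _

/-- A bound from below on the mean speed along an arithmetic progression is, up to a constant, a
bound from below on the mean speed. -/
theorem exists_lower_speed_of_step {X : ℝ → ℝ} {c c₁ τ : ℝ} (h : HasUpperSpeed X c₁)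
    (hc : 0 ≤ c) (hc₁ : 0 ≤ c₁) (hτ : 0 < τ)
    (hstep : ∀ T, ∃ t ≥ T, ∀ m : ℕ, X (t + m * τ) + c * τ ≤ X (t + (m + 1 : ℕ) * τ)) :
    ∃ C T, ∀ t ≥ T, ∀ s ≥ 0, X t + c * s - C ≤ X (t + s) := by
  obtain ⟨C₁, T₁, h⟩ := h
  obtain ⟨t₀, ht₀, hstep⟩ := hstep T₁
  have hiter : ∀ a i : ℕ, X (t₀ + a * τ) + c * (i * τ) ≤ X (t₀ + (a + i : ℕ) * τ) := by
    intro a i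
    induction i with
    | zero => simp
    | succ i ih =>
      have := hstep (a + i)
      rw [show a + (i + 1) = a + i + 1 by ring]
      push_cast at *
      linarith
  refine ⟨2 * (c₁ * τ + C₁), t₀, fun t ht s hs => ?_⟩
  have hfl : ∀ x ≥ t₀, ∃ m : ℕ, t₀ + m * τ ≤ x ∧ x < t₀ + (m + 1 : ℕ) * τ := fun x hx => by
    have hm := Nat.floor_le (div_nonneg (sub_nonneg.2 hx) hτ.le)
    have hm' := Nat.lt_floor_add_one ((x - t₀) / τ)
    rw [le_div_iff₀ hτ] at hm
    rw [div_lt_iff₀ hτ] at hm'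
    refine ⟨⌊(x - t₀) / τ⌋₊, by linarith, ?_⟩
    push_cast
    linarith
  obtain ⟨a, ha, ha'⟩ := hfl t ht
  obtain ⟨b, hb, hb'⟩ := hfl (t + s) (by linarith)
  have hab : a ≤ b + 1 := by
    have h1 : (a : ℝ) * τ < (b + 1 : ℕ) * τ := by linarith
    exact_mod_cast (lt_of_mul_lt_mul_right h1 hτ.le).le
  obtain ⟨i, hi⟩ := Nat.exists_eq_add_of_le hab
  have h0 : 0 ≤ (a : ℝ) * τ := by positivity
  have h0' : 0 ≤ (b : ℝ) * τ := by positivity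
  have h1 := h (t₀ + a * τ) (by linarith) (t - (t₀ + a * τ)) (by linarith)
  have h2 := h (t + s) (by linarith) (t₀ + (b + 1 : ℕ) * τ - (t + s)) (by linarith)
  rw [add_sub_cancel] at h1 h2
  push_cast at ha' hb' h2
  have h3 : c₁ * (t - (t₀ + a * τ)) ≤ c₁ * τ := mul_le_mul_of_nonneg_left (by linarith) hc₁
  have h4 : c₁ * (t₀ + (b + 1) * τ - (t + s)) ≤ c₁ * τ :=
    mul_le_mul_of_nonneg_left (by linarith) hc₁
  have h5 := hiter a i
  rw [← hi] at h5
  have hi' : (b : ℝ) + 1 = a + i := by exact_mod_cast hi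
  have h6 : c * s ≤ c * (i * τ) := by
    refine mul_le_mul_of_nonneg_left ?_ hc
    have : ((b : ℝ) + 1) * τ = a * τ + i * τ := by rw [hi']; ring
    linarith
  push_cast at h5
  linarith

section MeanSpeed

variable {d : ℕ} {V : Euc n → ℝ} {D : EscData n V} {u : ℝ → ℝ → Euc n} {X R : ℝ → ℝ} {c₀ : ℝ}

theorem IsEscapePoint.le_of_hasUpperSpeed (hX : IsEscapePoint V D u X R c₀) {c : ℝ}
    (h : HasUpperSpeed X c) : c₀ ≤ c := by
  obtain ⟨C, T, hC, hT, h⟩ := h.exists_pos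
  have hlim : Tendsto (fun t => (X T + C - c * T) / t + c) atTop (𝓝 (0 + c)) :=
    (tendsto_id.const_div_atTop _).add_const c
  rw [zero_add] at hlim
  refine le_of_tendsto_of_tendsto hX.tendsto_div hlim ?_
  filter_upwards [eventually_ge_atTop T] with t ht
  have ht0 : 0 < t := hT.trans_le ht
  have := h T le_rfl (t - T) (by linarith)
  rw [add_sub_cancel] at this
  rw [div_le_iff₀ ht0, add_mul, div_mul_cancel₀ _ ht0.ne']
  linarith

theorem IsEscapePoint.le_of_lower_speed (hX : IsEscapePoint V D u X R c₀) {c : ℝ}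
    (h : ∃ C T, ∀ t ≥ T, ∀ s ≥ 0, X t + c * s - C ≤ X (t + s)) : c ≤ c₀ := by
  obtain ⟨C, T, h⟩ := h
  have hlim : Tendsto (fun t => (X T - C - c * T) / t + c) atTop (𝓝 (0 + c)) :=
    (tendsto_id.const_div_atTop _).add_const c
  rw [zero_add] at hlim
  refine le_of_tendsto_of_tendsto hlim hX.tendsto_div ?_
  filter_upwards [eventually_ge_atTop T, eventually_gt_atTop 0] with t ht ht0
  have := h T le_rfl (t - T) (by linarith)
  rw [add_sub_cancel] at this
  rw [le_div_iff₀ ht0, add_mul, div_mul_cancel₀ _ ht0.ne']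
  linarith

theorem exists_mem_Ioo_PhiInv_eq_empty (h0 : (0 : Euc n) ∈ MinSet V) (hvel : HDiscVel V) {a b : ℝ}
    (ha : 0 ≤ a) (hab : a < b) : ∃ c ∈ Ioo a b, PhiInv V c 0 = ∅ := by
  by_contra! hcon
  have hsub : Ioo a b ⊆ {c : ℝ | 0 ≤ c ∧ (PhiInv V c 0).Nonempty} := fun c hc =>
    ⟨ha.trans hc.1.le, hcon c hc⟩
  have := interior_maximal hsub isOpen_Ioo
  rw [hvel 0 h0] at this
  exact this (⟨by linarith, by linarith⟩ : (a + b) / 2 ∈ Ioo a b)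

/-- If no front invades the origin at a speed `c` which is not an upper bound of the mean speed,
then this speed is a lower bound of the mean speed. -/
theorem exists_lower_speed (hu : IsRadialSolution d V u) (hV : ContDiff ℝ 2 V) (hd : 1 ≤ d)
    (h0 : (0 : Euc n) ∈ MinSet V) (hV0 : V 0 = 0) (hnd : HNonDeg V) (hbist : HOnlyBist V)
    (hX : IsEscapePoint V D u X R c₀) {c c' c₁ κ : ℝ} (hc : 0 < c) (hκ : 0 < κ) (hκc : κ ≤ c)
    (hc₁ : c ≤ c₁) (hlam : (c + κ) * (κ + (c₁ - c)) ≤ D.lmin / 2) (hup : HasUpperSpeed X c₁)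
    (hinv : PhiInv V c 0 = ∅) (hcc' : c < c') (hc' : ¬ HasUpperSpeed X c') :
    ∃ C T, ∀ t ≥ T, ∀ s ≥ 0, X t + c * s - C ≤ X (t + s) := by
  obtain ⟨ε, ρ₀, T₀, hε, hρ₀, hdis⟩ :=
    exists_dissip_lower_bound hu hV hd D h0 hV0 hnd hbist hX hc hinv
  obtain ⟨C₁, B₁, hC₁, hB₁, hrel⟩ :=
    exists_relaxation hu hV hd D h0 hV0 hX hc hκ hκc hc₁ hlam hup hρ₀ hε
  set C := max C₁ 1 with hCdef
  set B := max B₁ 1 with hBdef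
  have hC : 1 ≤ C := le_max_right _ _
  have hB : 1 ≤ B := le_max_right _ _
  have hθ0 : 0 ≤ 1 - 1 / (2 * B) := by
    rw [sub_nonneg, div_le_one (by linarith)]
    linarith
  have hθ1 : 1 - 1 / (2 * B) < 1 := by
    have : 0 < 1 / (2 * B) := by positivity
    linarith
  obtain ⟨N, hN, hNpow, hNlog⟩ : ∃ N : ℕ, 1 ≤ N ∧ (1 - 1 / (2 * B)) ^ N * (4 * B * C) ≤ 1 ∧
      Real.log (2 * C) / c ≤ (c' - c) * (2 * N) := by
    have h1 : Tendsto (fun N : ℕ => (1 - 1 / (2 * B)) ^ N * (4 * B * C)) atTop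
        (𝓝 (0 * (4 * B * C))) := (tendsto_pow_atTop_nhds_zero_of_lt_one hθ0 hθ1).mul_const _
    rw [zero_mul] at h1
    have h2 : Tendsto (fun N : ℕ => (c' - c) * (2 * (N : ℝ))) atTop atTop :=
      (tendsto_natCast_atTop_atTop.const_mul_atTop two_pos).const_mul_atTop (sub_pos.2 hcc')
    exact ((eventually_ge_atTop 1).and ((h1.eventually_le_const one_pos).and
      (h2.eventually_ge_atTop _))).exists
  obtain ⟨T₁, hrel⟩ := hrel (2 * N)
  have hN0 : (0 : ℝ) < N := by exact_mod_cast hN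
  have hexp : ∀ x, 2 * C ≤ Real.exp x ↔ Real.log (2 * C) ≤ x := fun x =>
    (Real.log_le_iff_le_exp (by positivity)).symm
  have hperp : ∀ t ≥ max T₀ T₁,
      2 * C ≤ Real.exp (c * (X (t + 2 * N) - X t - c * (2 * N))) →
      2 * C ≤ Real.exp (c * (X (t + 2 * N + 2 * N) - X (t + 2 * N) - c * (2 * N))) := by
    intro t ht htrig
    have h1 := hrel t ((le_max_right _ _).trans ht) fun j _ =>
      ⟨fun _ => ε / 2, intervalIntegrable_const, fun s hs => by
        have hj : (0 : ℝ) ≤ j := Nat.cast_nonneg j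
        have := hdis s (by linarith [hs.1, le_max_left T₀ T₁])
        linarith, by
        rw [intervalIntegral.integral_const, smul_eq_mul]
        linarith⟩
    have h2 := mul_le_of_sum_le
      (W := fun k : ℕ => Real.exp (c * (X (t + 2 * (k : ℝ)) - X t - c * (2 * (k : ℝ)))))
      (fun k => (Real.exp_pos _).le) hB (by linarith) hN
      (fun k hk => (h1 k hk).trans (add_le_add (le_max_left _ _)
        (mul_le_mul_of_nonneg_right (le_max_left _ _) (Real.exp_pos _).le))) htrig hNpow
    have h3 : Real.exp (c * (X (t + 2 * ((2 * N : ℕ) : ℝ)) - X t - c * (2 * ((2 * N : ℕ) : ℝ)))) =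
        Real.exp (c * (X (t + 2 * N + 2 * N) - X (t + 2 * N) - c * (2 * N))) *
          Real.exp (c * (X (t + 2 * N) - X t - c * (2 * N))) := by
      rw [← Real.exp_add]
      push_cast
      rw [show t + 2 * (2 * (N : ℝ)) = t + 2 * N + 2 * N by ring]
      congr 1
      ring
    simp only [h3] at h2
    exact le_of_mul_le_mul_right h2 (Real.exp_pos _)
  have htrig : ∀ T, ∃ t ≥ T, 2 * C ≤ Real.exp (c * (X (t + 2 * N) - X t - c * (2 * N))) := by
    intro T
    by_contra! hcon
    refine hc' (hup.of_step (T := T) (by positivity : (0 : ℝ) < 2 * N) fun t ht => ?_)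
    have h1 : c * (X (t + 2 * N) - X t - c * (2 * N)) ≤ Real.log (2 * C) := by
      by_contra! h
      exact absurd ((hexp _).2 h.le) (not_le.2 (hcon t ht))
    have h2 : X (t + 2 * N) - X t - c * (2 * N) ≤ Real.log (2 * C) / c := by
      rw [le_div_iff₀ hc]; linarith
    linarith
  refine exists_lower_speed_of_step hup hc.le (hc.le.trans hc₁) (by positivity : (0 : ℝ) < 2 * N)
    fun T => ?_
  obtain ⟨t, ht, htr⟩ := htrig (max T (max T₀ T₁))
  refine ⟨t, (le_max_left _ _).trans ht, fun m => ?_⟩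
  have hall : ∀ m : ℕ, 2 * C ≤ Real.exp (c * (X (t + m * (2 * N) + 2 * N) - X (t + m * (2 * N)) -
      c * (2 * N))) := by
    intro m
    induction m with
    | zero => simpa using htr
    | succ m ih =>
      have h1 : 0 ≤ (m : ℝ) * (2 * N) := by positivity
      have := hperp (t + m * (2 * N)) (by linarith [le_max_right T (max T₀ T₁)]) ih
      push_cast
      rwa [show t + ((m : ℝ) + 1) * (2 * N) = t + m * (2 * N) + 2 * N by ring]
  have h1 := (hexp _).1 (hall m)
  have h2 : 0 ≤ Real.log (2 * C) := Real.log_nonneg (by linarith)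
  have h4 : 0 ≤ X (t + m * (2 * N) + 2 * N) - X (t + m * (2 * N)) - c * (2 * N) :=
    nonneg_of_mul_nonneg_right (h2.trans h1) hc
  push_cast
  rw [show t + ((m : ℝ) + 1) * (2 * N) = t + m * (2 * N) + 2 * N by ring]
  linarith

/-- The upper and lower mean speeds of the escape point are equal. -/
theorem IsEscapePoint.exists_mean_speed (hX : IsEscapePoint V D u X R c₀)
    (hu : IsRadialSolution d V u) (hV : ContDiff ℝ 2 V) (hd : 1 ≤ d)
    (h0 : (0 : Euc n) ∈ MinSet V) (hV0 : V 0 = 0) (hnd : HNonDeg V) (hbist : HOnlyBist V)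
    (hvel : HDiscVel V) {η : ℝ} (hη : 0 < η) :
    HasUpperSpeed X (c₀ + η) ∧
      ∃ C T, ∀ t ≥ T, ∀ s ≥ 0, X t + (c₀ - η) * s - C ≤ X (t + s) := by
  set S : Set ℝ := {c | HasUpperSpeed X c} with hS
  have hSne : S.Nonempty := hX.exists_speed
  have hSbdd : BddBelow S := ⟨c₀, fun c hc => hX.le_of_hasUpperSpeed hc⟩
  set cb := sInf S with hcb
  have hcb₀ : c₀ ≤ cb := le_csInf hSne fun c hc => hX.le_of_hasUpperSpeed hc
  have hc₀ := hX.speed_pos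
  have hcbpos : 0 < cb := hc₀.trans_le hcb₀
  have hup : ∀ c, cb < c → HasUpperSpeed X c := fun c hc => by
    obtain ⟨a, ha, hac⟩ := exists_lt_of_csInf_lt hSne hc
    exact HasUpperSpeed.mono ha hac.le
  have hnot : ∀ c < cb, ¬ HasUpperSpeed X c := fun c hc h => notMem_of_lt_csInf hc hSbdd h
  have hlam := D.lmin_pos
  obtain ⟨μ, hμ, hμ1, hμcb, hμlam⟩ : ∃ μ : ℝ, 0 < μ ∧ μ ≤ 1 ∧ μ ≤ cb / 4 ∧
      μ * (8 * (cb + 2)) ≤ D.lmin := by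
    refine ⟨min (min 1 (cb / 4)) (D.lmin / (8 * (cb + 2))), by positivity,
      (min_le_left _ _).trans (min_le_left _ _), (min_le_left _ _).trans (min_le_right _ _), ?_⟩
    rw [← le_div_iff₀ (by positivity)]
    exact min_le_right _ _
  have hlow : ∀ e > 0, ∃ c > cb - e,
      ∃ C T, ∀ t ≥ T, ∀ s ≥ 0, X t + c * s - C ≤ X (t + s) := by
    intro e he
    have hm : 0 < min μ e := lt_min hμ he
    have hmμ := min_le_left μ e
    obtain ⟨c, hc, hinv⟩ := exists_mem_Ioo_PhiInv_eq_empty h0 hvel (a := cb - min μ e)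
      (b := cb) (by linarith) (by linarith)
    refine ⟨c, by linarith [hc.1, min_le_right μ e], ?_⟩
    refine exists_lower_speed hu hV hd h0 hV0 hnd hbist hX (c := c) (c' := (c + cb) / 2)
      (c₁ := cb + μ) (κ := μ) (by linarith [hc.1]) hμ (by linarith [hc.1]) (by linarith [hc.2])
      ?_ (hup _ (by linarith)) hinv (by linarith [hc.2]) (hnot _ (by linarith [hc.2]))
    have h1 : c + μ ≤ cb + 2 := by linarith [hc.2]
    have h2 : μ + (cb + μ - c) ≤ 3 * μ := by linarith [hc.1]
    calc (c + μ) * (μ + (cb + μ - c)) ≤ (cb + 2) * (3 * μ) := by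
          apply mul_le_mul h1 h2 (by linarith [hc.2]) (by linarith)
      _ ≤ D.lmin / 2 := by nlinarith
  have hcbeq : cb = c₀ := by
    refine le_antisymm (le_of_forall_pos_sub_le fun e he => ?_) hcb₀
    obtain ⟨c, hc, h⟩ := hlow e he
    linarith [hX.le_of_lower_speed h]
  refine ⟨hup _ (by linarith), ?_⟩
  obtain ⟨c, hc, C, T, h⟩ := hlow η hη
  refine ⟨C, T, fun t ht s hs => le_trans ?_ (h t ht s hs)⟩
  have : (c₀ - η) * s ≤ c * s := mul_le_mul_of_nonneg_right (by linarith) hs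
  linarith

end MeanSpeed

/-! ### Regular occurrence of small dissipation -/

/-- A positive two-sided sequence whose symmetric partial sums are dominated by their extremal
terms grows exponentially. -/
theorem one_le_mul_symm_sum {W : ℤ → ℝ} (h0 : W 0 = 1) {B : ℝ} (hB : 1 ≤ B) {N : ℕ}
    (hsum : ∀ j : ℕ, j ≤ N →
      ∑ i ∈ Finset.range (2 * j + 1), W ((i : ℤ) - j) ≤ B * (W (-j) + W j)) :
    1 ≤ (1 - 1 / B) ^ N * ∑ i ∈ Finset.range (2 * N + 1), W ((i : ℤ) - N) := by
  have hB0 : 0 < B := by linarith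
  have hθ : 0 ≤ 1 - 1 / B := by
    rw [sub_nonneg, div_le_one hB0]
    exact hB
  induction N with
  | zero => simp [h0]
  | succ N ih =>
    refine (ih fun j hj => hsum j (by omega)).trans ?_
    rw [pow_succ, mul_assoc]
    refine mul_le_mul_of_nonneg_left ?_ (pow_nonneg hθ N)
    have h1 := hsum (N + 1) le_rfl
    have h2 : ∑ i ∈ Finset.range (2 * (N + 1) + 1), W ((i : ℤ) - (N + 1 : ℕ)) =
        ∑ i ∈ Finset.range (2 * N + 1), W ((i : ℤ) - N) +
          (W (-((N + 1 : ℕ) : ℤ)) + W ((N + 1 : ℕ) : ℤ)) := by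
      rw [show 2 * (N + 1) + 1 = (2 * N + 1 + 1) + 1 by ring, Finset.sum_range_succ',
        Finset.sum_range_succ]
      have e1 : ∀ i : ℕ, (((i + 1 : ℕ) : ℤ) - (N + 1 : ℕ)) = (i : ℤ) - N := fun i => by
        push_cast; ring
      simp only [e1]
      have e2 : ((2 * N + 1 : ℕ) : ℤ) - N = ((N + 1 : ℕ) : ℤ) := by push_cast; ring
      have e3 : ((0 : ℕ) : ℤ) - (N + 1 : ℕ) = -((N + 1 : ℕ) : ℤ) := by push_cast; ring
      rw [e2, e3]
      ring
    set S := ∑ i ∈ Finset.range (2 * (N + 1) + 1), W ((i : ℤ) - (N + 1 : ℕ))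
    set S' := ∑ i ∈ Finset.range (2 * N + 1), W ((i : ℤ) - N)
    set a := W (-((N + 1 : ℕ) : ℤ)) + W ((N + 1 : ℕ) : ℤ)
    have h3 : S / B ≤ a := by
      rw [div_le_iff₀ hB0]; linarith
    have h4 : (1 - 1 / B) * S = S - S / B := by ring
    rw [h4]
    linarith

/-- The quantity `deltaDissip` is a lower bound for the dissipation. -/
theorem exists_of_lt_deltaDissip {u : ℝ → ℝ → Euc n} {X : ℝ → ℝ} {c ε t : ℝ} (hε : 0 < ε)
    (h : ε < deltaDissip u X c t) :
    IntervalIntegrable (dissip u X c (1 / ε)) volume (t - 1) (t + 1) ∧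
      ε ≤ ∫ s in (t - 1)..(t + 1), dissip u X c (1 / ε) s := by
  have h1 : ε < ∫ τ in (-1 : ℝ)..1, dissip u X c (1 / ε) (t + τ) := by
    by_contra! hcon
    exact absurd h (not_lt.2 (csInf_le ⟨0, fun e he => he.1.le⟩ ⟨hε, hcon⟩))
  have h2 : IntervalIntegrable (fun τ => dissip u X c (1 / ε) (t + τ)) volume (-1) 1 :=
    intervalIntegral.intervalIntegrable_of_integral_ne_zero (hε.trans h1).ne'
  rw [intervalIntegral.integral_comp_add_left] at h1
  have h3 := h2.comp_add_left (-t)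
  refine ⟨?_, by simpa [sub_eq_add_neg] using h1.le⟩
  convert h3 using 1
  · funext s; simp
  · ring
  · ring

theorem deltaDissip_nonneg (u : ℝ → ℝ → Euc n) (X : ℝ → ℝ) (c t : ℝ) : 0 ≤ deltaDissip u X c t :=
  Real.sInf_nonneg fun _ he => he.1.le

/-- The dissipation around the escape point is small regularly in time. -/
theorem IsEscapePoint.exists_sInf_deltaDissip_le {d : ℕ} {V : Euc n → ℝ} {D : EscData n V}
    {u : ℝ → ℝ → Euc n} {X R : ℝ → ℝ} {c₀ : ℝ} (hX : IsEscapePoint V D u X R c₀)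
    (hu : IsRadialSolution d V u) (hV : ContDiff ℝ 2 V) (hd : 1 ≤ d)
    (h0 : (0 : Euc n) ∈ MinSet V) (hV0 : V 0 = 0) (hnd : HNonDeg V) (hbist : HOnlyBist V)
    (hvel : HDiscVel V) {ε : ℝ} (hε : 0 < ε) :
    ∃ T > 0, ∀ t ≥ 1, sInf ((fun t' => deltaDissip u X c₀ t') '' Icc t (t + T)) ≤ ε := by
  have hspeed : ∀ η > 0, HasUpperSpeed X (c₀ + η) ∧
      ∃ C T, ∀ t ≥ T, ∀ s ≥ 0, X t + (c₀ - η) * s - C ≤ X (t + s) := fun η hη =>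
    hX.exists_mean_speed hu hV hd h0 hV0 hnd hbist hvel hη
  have hc₀ := hX.speed_pos
  have hlam := D.lmin_pos
  obtain ⟨μ, hμ, hμ1, hμc, hμlam⟩ : ∃ μ : ℝ, 0 < μ ∧ μ ≤ 1 ∧ μ ≤ c₀ ∧
      μ * (8 * (c₀ + 2)) ≤ D.lmin := by
    refine ⟨min (min 1 c₀) (D.lmin / (8 * (c₀ + 2))), by positivity,
      (min_le_left _ _).trans (min_le_left _ _), (min_le_left _ _).trans (min_le_right _ _), ?_⟩
    rw [← le_div_iff₀ (by positivity)]
    exact min_le_right _ _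
  obtain ⟨C, B, hC, hB, hrel⟩ := exists_relaxation hu hV hd D h0 hV0 hX (c := c₀) (κ := μ)
    (c₁ := c₀ + μ) hc₀ hμ hμc (by linarith) (by nlinarith) (hspeed μ hμ).1
    (ρ₀ := 1 / ε) (by positivity) hε
  set B' := C + 1 + B with hB'
  have hB'1 : 1 ≤ B' := by linarith
  have hB'0 : 0 < B' := by linarith
  set η := 1 / (4 * c₀ * B') with hη
  have hη0 : 0 < η := by positivity
  obtain ⟨⟨Cu, Tu, hup⟩, Cl, Tl, hlow⟩ := hspeed η hη0
  set C' := max Cu Cl with hC'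
  set q := Real.exp (-(1 / (2 * B'))) with hq
  have hq1 : q < 1 := by
    rw [hq, Real.exp_lt_one_iff]
    have : 0 < 1 / (2 * B') := by positivity
    linarith
  obtain ⟨N, hN⟩ : ∃ N : ℕ, (2 * (N : ℝ) + 1) * q ^ N * Real.exp (c₀ * C') < 1 := by
    have h1 : Tendsto (fun N : ℕ => (2 * ((N : ℝ) * q ^ N) + q ^ N) * Real.exp (c₀ * C')) atTop
        (𝓝 ((2 * 0 + 0) * Real.exp (c₀ * C'))) :=
      (((tendsto_self_mul_const_pow_of_lt_one (Real.exp_pos _).le hq1).const_mul 2).add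
        (tendsto_pow_atTop_nhds_zero_of_lt_one (Real.exp_pos _).le hq1)).mul_const _
    rw [mul_zero, add_zero, zero_mul] at h1
    obtain ⟨N, hN⟩ := (h1.eventually_lt_const one_pos).exists
    refine ⟨N, ?_⟩
    linarith [hN, show (2 * ((N : ℝ) * q ^ N) + q ^ N) * Real.exp (c₀ * C') =
      (2 * (N : ℝ) + 1) * q ^ N * Real.exp (c₀ * C') by ring]
  obtain ⟨Tr, hrel⟩ := hrel (2 * N)
  by_contra! hcon
  set Tm := |Tr| + |Tu| + |Tl| with hTm
  have hTm0 : 0 ≤ Tm := by positivity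
  obtain ⟨t, ht1, ht⟩ := hcon (Tm + 6 * N + 2) (by positivity)
  have hlarge : ∀ t' ∈ Icc t (t + (Tm + 6 * N + 2)), ε < deltaDissip u X c₀ t' := fun t' ht' =>
    ht.trans_le (csInf_le ⟨0, by rintro _ ⟨s, -, rfl⟩; exact deltaDissip_nonneg _ _ _ _⟩
      ⟨t', ht', rfl⟩)
  set s₀ := t + Tm + 2 * N with hs₀
  have hsTr : ∀ s ≥ t + Tm, Tr ≤ s ∧ Tu ≤ s ∧ Tl ≤ s := fun s hs => by
    have := le_abs_self Tr
    have := le_abs_self Tu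
    have := le_abs_self Tl
    have := abs_nonneg Tr
    have := abs_nonneg Tu
    have := abs_nonneg Tl
    refine ⟨?_, ?_, ?_⟩ <;> linarith
  set W : ℤ → ℝ := fun i => Real.exp (c₀ * (X (s₀ + 2 * (i : ℝ)) - X s₀ - c₀ * (2 * (i : ℝ))))
    with hW
  have hWsum : ∀ j : ℕ, j ≤ N →
      ∑ i ∈ Finset.range (2 * j + 1), W ((i : ℤ) - j) ≤ B' * (W (-j) + W j) := by
    intro j hj
    have hjN : (j : ℝ) ≤ N := by exact_mod_cast hj
    have hj0 : (0 : ℝ) ≤ j := Nat.cast_nonneg j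
    have hbase : t + Tm ≤ s₀ - 2 * j := by linarith
    have h1 := hrel (s₀ - 2 * j) (hsTr _ hbase).1 (fun i hi => by
      have hiN : (i : ℝ) ≤ 2 * N := by exact_mod_cast hi.le
      have hi0 : (0 : ℝ) ≤ i := Nat.cast_nonneg i
      obtain ⟨h1, h2⟩ := exists_of_lt_deltaDissip hε
        (hlarge (s₀ - 2 * j + 2 * i + 1) ⟨by linarith, by linarith⟩)
      rw [add_sub_cancel_right, add_assoc _ (1 : ℝ) 1, one_add_one_eq_two] at h1 h2
      exact ⟨_, h1, fun _ _ => le_rfl, h2⟩) (2 * j) (by omega)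
    have hmul : ∀ x : ℝ, Real.exp (c₀ * (X (s₀ - 2 * j + 2 * x) - X (s₀ - 2 * j) -
        c₀ * (2 * x))) * W (-j) =
        Real.exp (c₀ * (X (s₀ + 2 * (x - j)) - X s₀ - c₀ * (2 * (x - j)))) := fun x => by
      rw [hW, ← Real.exp_add]
      push_cast
      rw [show s₀ - 2 * j + 2 * x = s₀ + 2 * (x - j) by ring,
        show s₀ + 2 * -(j : ℝ) = s₀ - 2 * j by ring]
      congr 1
      ring
    have h5 : 0 < W (-j) := Real.exp_pos _
    have h2 := mul_le_mul_of_nonneg_right h1 h5.le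
    rw [Finset.sum_mul, add_mul, mul_assoc] at h2
    simp only [hmul] at h2
    have h3 : ∑ i ∈ Finset.range (2 * j + 1), W ((i : ℤ) - j) =
        ∑ i ∈ Finset.range (2 * j), Real.exp (c₀ * (X (s₀ + 2 * (((i + 1 : ℕ) : ℝ) - j)) - X s₀ -
          c₀ * (2 * (((i + 1 : ℕ) : ℝ) - j)))) + W (-j) := by
      rw [Finset.sum_range_succ']
      congr 1
      · refine Finset.sum_congr rfl fun i _ => ?_
        simp only [hW]
        push_cast
        rfl
      · simp
    have h4 : Real.exp (c₀ * (X (s₀ + 2 * (((2 * j : ℕ) : ℝ) - j)) - X s₀ -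
        c₀ * (2 * (((2 * j : ℕ) : ℝ) - j)))) = W j := by
      simp only [hW]
      push_cast
      rw [show 2 * (j : ℝ) - j = j by ring]
    rw [h4] at h2
    rw [h3]
    have h6 : 0 < W j := Real.exp_pos _
    have h7 : B' * (W (-j) + W j) = C * W (-j) + W (-j) + B * W (-j) + C * W j + W j + B * W j := by
      rw [hB']; ring
    have h8 := mul_pos hC h6
    have h9 := mul_pos hB h5
    linarith
  have hWle : ∀ i : ℤ, |(i : ℝ)| ≤ N → W i ≤ Real.exp (c₀ * (2 * η * N + C')) := by
    intro i hi
    refine Real.exp_le_exp.2 (mul_le_mul_of_nonneg_left ?_ hc₀.le)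
    obtain ⟨hi1, hi2⟩ := abs_le.1 hi
    rcases le_total 0 (i : ℝ) with h | h
    · have h1 := hup s₀ (hsTr s₀ (by linarith)).2.1 (2 * i) (by linarith)
      have h2 : η * (2 * i) ≤ η * (2 * N) := mul_le_mul_of_nonneg_left (by linarith) hη0.le
      linarith [le_max_left Cu Cl]
    · have h1 := hlow (s₀ + 2 * i) (hsTr _ (by linarith)).2.2 (-(2 * i)) (by linarith)
      rw [add_neg_cancel_right] at h1
      have h2 : η * (-(2 * i)) ≤ η * (2 * N) := mul_le_mul_of_nonneg_left (by linarith) hη0.le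
      linarith [le_max_right Cu Cl]
  have hone := one_le_mul_symm_sum (W := W) (by simp [hW]) hB'1 hWsum
  have hsum : ∑ i ∈ Finset.range (2 * N + 1), W ((i : ℤ) - N) ≤
      (2 * N + 1) * Real.exp (c₀ * (2 * η * N + C')) := by
    refine (Finset.sum_le_card_nsmul _ _ _ fun i hi => hWle _ ?_).trans ?_
    · have hi' : (i : ℝ) ≤ 2 * N := by
        exact_mod_cast Nat.lt_succ_iff.1 (Finset.mem_range.1 hi)
      push_cast
      rw [abs_le]
      constructor <;> linarith [(Nat.cast_nonneg i : (0 : ℝ) ≤ i)]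
    · simp
  have hθ0 : 0 ≤ 1 - 1 / B' := by
    rw [sub_nonneg, div_le_one hB'0]
    exact hB'1
  have hθ : (1 - 1 / B') ^ N ≤ Real.exp (-(1 / B')) ^ N :=
    pow_le_pow_left₀ hθ0 (by linarith [Real.add_one_le_exp (-(1 / B'))]) N
  have hexp : Real.exp (-(1 / B')) ^ N * Real.exp (c₀ * (2 * η * N + C')) =
      q ^ N * Real.exp (c₀ * C') := by
    rw [hq, ← Real.exp_nat_mul, ← Real.exp_nat_mul, ← Real.exp_add, ← Real.exp_add, hη]
    congr 1
    field_simp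
    ring
  have hfin : (1 : ℝ) ≤ (2 * N + 1) * q ^ N * Real.exp (c₀ * C') := by
    calc (1 : ℝ) ≤ _ := hone
      _ ≤ Real.exp (-(1 / B')) ^ N * ((2 * N + 1) * Real.exp (c₀ * (2 * η * N + C'))) :=
          mul_le_mul hθ hsum (Finset.sum_nonneg fun i _ => (Real.exp_pos _).le) (by positivity)
      _ = (2 * N + 1) * (Real.exp (-(1 / B')) ^ N * Real.exp (c₀ * (2 * η * N + C'))) := by ring
      _ = _ := by rw [hexp]; ring
  exact absurd hN (not_lt.2 hfin)

/-! ### Estimates on the firewall functional -/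

theorem integrable_exp_neg_abs {μ : ℝ} (hμ : 0 < μ) (x : ℝ) :
    Integrable fun r : ℝ => Real.exp (-μ * |r - x|) := by
  have h : Integrable fun r : ℝ => Real.exp (-μ * |r|) := by
    have h1 : IntegrableOn (fun r : ℝ => Real.exp (-μ * r)) (Ioi 0) :=
      integrableOn_exp_mul_Ioi (neg_lt_zero.2 hμ) 0
    have h2 : IntegrableOn (fun r : ℝ => Real.exp (-μ * |r|)) (Ioi 0) :=
      h1.congr_fun (fun r hr => by simp only [abs_of_pos (mem_Ioi.1 hr)]) measurableSet_Ioi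
    have h3 : IntegrableOn (fun r : ℝ => Real.exp (-μ * |r|)) (Iic 0) := by
      have h := h2.comp_neg
      simp only [abs_neg, neg_Ioi, neg_zero] at h
      exact (integrableOn_Iic_iff_integrableOn_Iio (by simp)).2 h
    rw [← integrableOn_univ, ← Iic_union_Ioi (a := (0 : ℝ))]
    exact h3.union h2
  exact h.comp_sub_right x

theorem integral_exp_neg_abs {μ : ℝ} (hμ : 0 < μ) (x : ℝ) :
    ∫ r : ℝ, Real.exp (-μ * |r - x|) = 2 / μ := by
  rw [integral_sub_right_eq_self (fun r : ℝ => Real.exp (-μ * |r|)) x,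
    integral_comp_abs (f := fun r : ℝ => Real.exp (-μ * r)),
    integral_exp_mul_Ioi (neg_lt_zero.2 hμ)]
  simp [div_eq_mul_inv]

theorem exp_neg_abs_le {μ ℓ r x : ℝ} (hμ : 0 < μ) (h : ℓ ≤ |r - x|) :
    Real.exp (-μ * |r - x|) ≤ Real.exp (-(μ / 2) * ℓ) * Real.exp (-(μ / 2) * |r - x|) := by
  rw [← Real.exp_add]
  exact Real.exp_le_exp.2 (by nlinarith)

theorem kappa0_pos {l : ℝ} (hl : 0 < l) : 0 < kappa0 l := lt_min (by norm_num) (by positivity)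

theorem rsc_pos {d : ℕ} (hd : 2 ≤ d) (l : ℝ) : 0 < rsc d l := by
  have : (2 : ℝ) ≤ d := by exact_mod_cast hd
  exact lt_max_of_lt_left (by linarith)

theorem Tpsi_eq {d : ℕ} (hd : 2 ≤ d) {l ρ r : ℝ} (hr : rsc d l ≤ r) :
    Tpsi d l ρ r = Real.exp (-(kappa0 l) * |r - ρ|) := by
  unfold Tpsi
  split_ifs with h
  · rw [le_antisymm h hr, div_self (rsc_pos hd l).ne', one_pow, mul_one]
  · rfl

theorem Tpsi_nonneg {d : ℕ} (hd : 2 ≤ d) {l ρ r : ℝ} (hr : 0 ≤ r) : 0 ≤ Tpsi d l ρ r := by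
  have := rsc_pos hd l
  unfold Tpsi
  split_ifs <;> positivity

theorem Tpsi_le {d : ℕ} (hd : 2 ≤ d) {l ρ r : ℝ} (hr : 0 ≤ r) :
    Tpsi d l ρ r ≤ Real.exp (-(kappa0 l) * |r - ρ|) := by
  have h0 := rsc_pos hd l
  unfold Tpsi
  split_ifs with h
  · exact mul_le_of_le_one_right (Real.exp_pos _).le
      (pow_le_one₀ (by positivity) ((div_le_one h0).2 h))
  · exact le_rfl

theorem measurable_Tpsi (d : ℕ) (l ρ : ℝ) : Measurable (Tpsi d l ρ) :=
  Measurable.ite measurableSet_Iic (by fun_prop) (by fun_prop)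

/-- Density of the firewall functional. -/
def fireDens (V : Euc n → ℝ) (u : ℝ → ℝ → Euc n) (t r : ℝ) : ℝ :=
  wV V * (‖ur u r t‖ ^ 2 / 2 + V (u r t)) + ‖u r t‖ ^ 2 / 2

section Firewall

variable {d : ℕ} {V : Euc n → ℝ} {u : ℝ → ℝ → Euc n} {D : EscData n V} {C t ρ : ℝ}

theorem le_fireDens (hV : ContDiff ℝ 2 V) (hc : HCoerc V) (D : EscData n V)
    (h0 : (0 : Euc n) ∈ MinSet V) (hV0 : V 0 = 0) (t r : ℝ) :
    min (wV V / 2) (1 / 4) * (‖u r t‖ ^ 2 + ‖ur u r t‖ ^ 2) ≤ fireDens V u t r := by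
  have h1 := wV_mul_add_ge hV hc D h0 hV0 (u r t)
  have h2 := mul_le_mul_of_nonneg_right (min_le_right (wV V / 2) (1 / 4)) (sq_nonneg ‖u r t‖)
  have h3 := mul_le_mul_of_nonneg_right (min_le_left (wV V / 2) (1 / 4)) (sq_nonneg ‖ur u r t‖)
  unfold fireDens
  linarith

theorem min_wV_pos (V : Euc n → ℝ) : 0 < min (wV V / 2) (1 / 4) :=
  lt_min (half_pos (wV_pos V)) (by norm_num)

theorem fireDens_nonneg (hV : ContDiff ℝ 2 V) (hc : HCoerc V) (D : EscData n V)
    (h0 : (0 : Euc n) ∈ MinSet V) (hV0 : V 0 = 0) (t r : ℝ) : 0 ≤ fireDens V u t r := by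
  refine le_trans ?_ (le_fireDens hV hc D h0 hV0 t r)
  have := min_wV_pos V
  positivity

theorem exists_fireDens_le (hV : ContDiff ℝ 2 V) (h0 : (0 : Euc n) ∈ MinSet V) (hV0 : V 0 = 0)
    (hC : SolBound u C) : ∃ A > 0, ∀ r t, 0 ≤ r → 0 < t →
      fireDens V u t r ≤ A * (‖u r t‖ ^ 2 + ‖ur u r t‖ ^ 2) := by
  obtain ⟨A, hA, -, hq⟩ := exists_quadratic_bounds hV hV0 h0.1 C
  have hw := wV_pos V
  refine ⟨wV V / 2 + wV V * A + 1 / 2, by positivity, fun r t hr ht => ?_⟩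
  have h1 := mul_le_mul_of_nonneg_left ((abs_le.1 (hq _ (hC.2 r t hr ht).1).1).2) hw.le
  have h2 : 0 ≤ wV V * A * ‖ur u r t‖ ^ 2 := by positivity
  have h3 : 0 ≤ wV V / 2 * ‖u r t‖ ^ 2 := by positivity
  have h4 := sq_nonneg ‖ur u r t‖
  unfold fireDens
  linarith

theorem continuous_fireDens (hu : IsRadialSolution d V u) (hV : ContDiff ℝ 2 V) (ht : 0 < t) :
    Continuous (fireDens V u t) := by
  have h1 := hu.continuous_r ht
  have h2 := hu.continuous_ur ht
  have h3 : Continuous fun r => V (u r t) := hV.continuous.comp h1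
  unfold fireDens
  fun_prop

theorem F0_eq (V : Euc n → ℝ) (d : ℕ) (l : ℝ) (u : ℝ → ℝ → Euc n) (ρ t : ℝ) :
    F0 V d l u ρ t = ∫ r in Ioi (0 : ℝ), Tpsi d l ρ r * fireDens V u t r := rfl

theorem integrableOn_firewall (hu : IsRadialSolution d V u) (hd : 2 ≤ d) (hV : ContDiff ℝ 2 V)
    (hc : HCoerc V) (D : EscData n V) (h0 : (0 : Euc n) ∈ MinSet V) (hV0 : V 0 = 0) (ht : 0 < t)
    (ρ : ℝ) : IntegrableOn (fun r => Tpsi d D.lmin ρ r * fireDens V u t r) (Ioi 0) := by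
  obtain ⟨C, hC⟩ := hu.exists_solBound
  obtain ⟨A, hA, hle⟩ := exists_fireDens_le hV h0 hV0 hC
  have hκ := kappa0_pos D.lmin_pos
  refine Integrable.mono' (((integrable_exp_neg_abs hκ ρ).mul_const (A * (2 * C ^ 2))).integrableOn)
    ((measurable_Tpsi d D.lmin ρ).mul
      (continuous_fireDens hu hV ht).measurable).aestronglyMeasurable ?_
  refine (ae_restrict_iff' measurableSet_Ioi).2 (ae_of_all _ fun r hr => ?_)
  have hr0 : 0 ≤ r := le_of_lt hr
  have hn := fireDens_nonneg (u := u) hV hc D h0 hV0 t r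
  rw [Real.norm_of_nonneg (mul_nonneg (Tpsi_nonneg hd hr0) hn)]
  refine mul_le_mul (Tpsi_le hd hr0) ((hle r t hr0 ht).trans ?_) hn (Real.exp_pos _).le
  obtain ⟨b1, b2, -, -⟩ := hC.2 r t hr0 ht
  have c1 := pow_le_pow_left₀ (norm_nonneg _) b1 2
  have c2 := pow_le_pow_left₀ (norm_nonneg _) b2 2
  exact mul_le_mul_of_nonneg_left (by linarith) hA.le

/-- The firewall functional controls the solution pointwise. -/
theorem norm_sq_le_F0 (hu : IsRadialSolution d V u) (hd : 2 ≤ d) (hV : ContDiff ℝ 2 V)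
    (hc : HCoerc V) (D : EscData n V) (h0 : (0 : Euc n) ∈ MinSet V) (hV0 : V 0 = 0) (ht : 0 < t)
    (hρ : rsc d D.lmin ≤ ρ) :
    min (wV V / 2) (1 / 4) / (kappa0 D.lmin + 1) * ‖u ρ t‖ ^ 2 ≤ F0 V d D.lmin u ρ t := by
  obtain ⟨C, hC⟩ := hu.exists_solBound
  have hκ := kappa0_pos D.lmin_pos
  have hρ0 : 0 ≤ ρ := (rsc_pos hd D.lmin).le.trans hρ
  set κ := kappa0 D.lmin
  set m := min (wV V / 2) (1 / 4)
  have hm : 0 < m := min_wV_pos V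
  have c1 := hu.continuous_r ht
  have c2 := hu.continuous_ur ht
  set g' : ℝ → ℝ := fun r => Real.exp (-κ * (r - ρ)) * (-κ) * ‖u r t‖ ^ 2
    + Real.exp (-κ * (r - ρ)) * (2 * ⟪u r t, ur u r t⟫) with hg'
  have hder : ∀ r ∈ Ici ρ, HasDerivAt (fun r => Real.exp (-κ * (r - ρ)) * ‖u r t‖ ^ 2) (g' r) r := by
    intro r _
    have e1 : HasDerivAt (fun r => Real.exp (-κ * (r - ρ))) (Real.exp (-κ * (r - ρ)) * (-κ)) r := by
      simpa using (((hasDerivAt_id r).sub_const ρ).const_mul (-κ)).exp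
    exact e1.mul (hu.hasDerivAt_r ht r).norm_sq
  have hbound : ∀ r, |g' r| ≤
      (κ + 1) * (Real.exp (-κ * (r - ρ)) * (‖u r t‖ ^ 2 + ‖ur u r t‖ ^ 2)) := by
    intro r
    have hE := (Real.exp_pos (-κ * (r - ρ))).le
    have a1 := abs_real_inner_le_norm (u r t) (ur u r t)
    have a2 := two_mul_le_add_sq ‖u r t‖ ‖ur u r t‖
    have a3 : |(-κ) * ‖u r t‖ ^ 2 + 2 * ⟪u r t, ur u r t⟫| ≤
        (κ + 1) * (‖u r t‖ ^ 2 + ‖ur u r t‖ ^ 2) := by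
      have hb := abs_le.1 a1
      have b1 : 0 ≤ κ * ‖u r t‖ ^ 2 := by positivity
      have b2 : 0 ≤ κ * ‖ur u r t‖ ^ 2 := by positivity
      rw [abs_le]
      constructor <;> nlinarith
    have e : g' r = Real.exp (-κ * (r - ρ)) * ((-κ) * ‖u r t‖ ^ 2 + 2 * ⟪u r t, ur u r t⟫) := by
      rw [hg']; ring
    rw [e, abs_mul, abs_of_nonneg hE]
    calc _ ≤ Real.exp (-κ * (r - ρ)) * ((κ + 1) * (‖u r t‖ ^ 2 + ‖ur u r t‖ ^ 2)) :=
          mul_le_mul_of_nonneg_left a3 hE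
      _ = _ := by ring
  have hexp : ∀ r ∈ Ioi ρ, Real.exp (-κ * (r - ρ)) = Tpsi d D.lmin ρ r := fun r hr => by
    rw [Tpsi_eq hd (hρ.trans (le_of_lt hr)), abs_of_pos (sub_pos.2 hr)]
  have hI := (integrableOn_firewall hu hd hV hc D h0 hV0 ht ρ).mono_set (Ioi_subset_Ioi hρ0)
  have hpt : ∀ r ∈ Ioi ρ, |g' r| ≤ (κ + 1) / m * (Tpsi d D.lmin ρ r * fireDens V u t r) := by
    intro r hr
    refine (hbound r).trans ?_
    rw [hexp r hr]
    have a1 := mul_le_mul_of_nonneg_left (le_fireDens (u := u) hV hc D h0 hV0 t r)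
      (Tpsi_nonneg (l := D.lmin) (ρ := ρ) hd (hρ0.trans (le_of_lt hr)))
    rw [div_mul_eq_mul_div, le_div_iff₀ hm, mul_assoc]
    refine mul_le_mul_of_nonneg_left ?_ (by positivity)
    refine le_trans (le_of_eq ?_) a1
    ring
  have hcont : Continuous g' := by
    rw [hg']
    fun_prop
  have hIg : IntegrableOn g' (Ioi ρ) :=
    Integrable.mono' (hI.const_mul ((κ + 1) / m)) hcont.aestronglyMeasurable
      ((ae_restrict_iff' measurableSet_Ioi).2 (ae_of_all _ hpt))
  have hlim : Tendsto (fun r => Real.exp (-κ * (r - ρ)) * ‖u r t‖ ^ 2) atTop (𝓝 0) := by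
    have e1 : Tendsto (fun r => Real.exp (-κ * (r - ρ)) * C ^ 2) atTop (𝓝 0) := by
      have : Tendsto (fun r => -κ * (r - ρ)) atTop atBot :=
        (tendsto_atTop_add_const_right _ (-ρ) tendsto_id).const_mul_atTop_of_neg (neg_lt_zero.2 hκ)
      simpa using (Real.tendsto_exp_atBot.comp this).mul_const (C ^ 2)
    refine squeeze_zero' (Eventually.of_forall fun r => by positivity) ?_ e1
    filter_upwards [eventually_ge_atTop 0] with r hr
    exact mul_le_mul_of_nonneg_left (pow_le_pow_left₀ (norm_nonneg _) (hC.2 r t hr ht).1 2)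
      (Real.exp_pos _).le
  have hFTC := integral_Ioi_of_hasDerivAt_of_tendsto' hder hIg hlim
  simp only [sub_self, mul_zero, Real.exp_zero, one_mul, zero_sub] at hFTC
  have h1 : ‖u ρ t‖ ^ 2 ≤ (κ + 1) / m * ∫ r in Ioi ρ, Tpsi d D.lmin ρ r * fireDens V u t r := by
    rw [← integral_const_mul]
    calc ‖u ρ t‖ ^ 2 = -∫ r in Ioi ρ, g' r := by rw [hFTC, neg_neg]
      _ ≤ |∫ r in Ioi ρ, g' r| := neg_le_abs _
      _ ≤ ∫ r in Ioi ρ, |g' r| := abs_integral_le_integral_abs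
      _ ≤ _ := setIntegral_mono_on hIg.abs (hI.const_mul _) measurableSet_Ioi hpt
  have h2 : ∫ r in Ioi ρ, Tpsi d D.lmin ρ r * fireDens V u t r ≤ F0 V d D.lmin u ρ t := by
    rw [F0_eq]
    refine setIntegral_mono_set (integrableOn_firewall hu hd hV hc D h0 hV0 ht ρ) ?_
      (Ioi_subset_Ioi hρ0).eventuallyLE
    exact (ae_restrict_iff' measurableSet_Ioi).2 (ae_of_all _ fun r hr =>
      mul_nonneg (Tpsi_nonneg hd (le_of_lt hr)) (fireDens_nonneg hV hc D h0 hV0 t r))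
  have h3 := h1.trans (mul_le_mul_of_nonneg_left h2 (by positivity))
  calc m / (κ + 1) * ‖u ρ t‖ ^ 2
      ≤ m / (κ + 1) * ((κ + 1) / m * F0 V d D.lmin u ρ t) :=
        mul_le_mul_of_nonneg_left h3 (by positivity)
    _ = F0 V d D.lmin u ρ t := by
        have : κ + 1 ≠ 0 := by positivity
        field_simp

/-- The firewall functional is controlled by the local size of the solution, up to an
exponentially small remainder. -/
theorem exists_F0_le (hu : IsRadialSolution d V u) (hd : 2 ≤ d) (hV : ContDiff ℝ 2 V)
    (hc : HCoerc V) (D : EscData n V) (h0 : (0 : Euc n) ∈ MinSet V) (hV0 : V 0 = 0) :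
    ∃ A > 0, ∃ E > 0, ∀ ρ t L, 0 < t → 0 ≤ L → L ≤ ρ → F0 V d D.lmin u ρ t ≤
      A * (∫ r in (ρ - L)..(ρ + L), (‖u r t‖ ^ 2 + ‖ur u r t‖ ^ 2))
        + E * Real.exp (-(kappa0 D.lmin / 2) * L) := by
  obtain ⟨C, hC⟩ := hu.exists_solBound
  obtain ⟨A, hA, hle⟩ := exists_fireDens_le hV h0 hV0 hC
  have hκ := kappa0_pos D.lmin_pos
  have hC0 := hC.1
  refine ⟨A, hA, A * (2 * C ^ 2) * (2 / (kappa0 D.lmin / 2)), by positivity,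
    fun ρ t L ht hL hLρ => ?_⟩
  set κ := kappa0 D.lmin
  have c1 := hu.continuous_r ht
  have c2 := hu.continuous_ur ht
  set q : ℝ → ℝ := fun r => ‖u r t‖ ^ 2 + ‖ur u r t‖ ^ 2 with hq
  have hqc : Continuous q := by rw [hq]; fun_prop
  have hq0 : ∀ r, 0 ≤ q r := fun r => by positivity
  set B := A * (2 * C ^ 2) * Real.exp (-(κ / 2) * L) with hB
  have hB0 : 0 ≤ B := by positivity
  have hI1 : Integrable (Set.indicator (Ioc (ρ - L) (ρ + L)) fun r => A * q r) := by
    rw [integrable_indicator_iff measurableSet_Ioc]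
    exact ((hqc.const_mul A).continuousOn.integrableOn_compact isCompact_Icc).mono_set
      Ioc_subset_Icc_self
  have hI2 : Integrable fun r => B * Real.exp (-(κ / 2) * |r - ρ|) :=
    (integrable_exp_neg_abs (half_pos hκ) ρ).const_mul B
  have hpt : ∀ r ∈ Ioi (0 : ℝ), Tpsi d D.lmin ρ r * fireDens V u t r ≤
      Set.indicator (Ioc (ρ - L) (ρ + L)) (fun r => A * q r) r
        + B * Real.exp (-(κ / 2) * |r - ρ|) := by
    intro r hr
    have hr0 : 0 ≤ r := le_of_lt hr
    have hT0 := Tpsi_nonneg (l := D.lmin) (ρ := ρ) hd hr0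
    have hT := Tpsi_le (l := D.lmin) (ρ := ρ) hd hr0
    have hfd := hle r t hr0 ht
    have hfn := fireDens_nonneg (u := u) hV hc D h0 hV0 t r
    by_cases hm : r ∈ Ioc (ρ - L) (ρ + L)
    · rw [indicator_of_mem hm]
      have hT1 : Tpsi d D.lmin ρ r ≤ 1 := hT.trans (Real.exp_le_one_iff.2 (by
        have := abs_nonneg (r - ρ); nlinarith))
      have e1 := mul_le_of_le_one_left hfn hT1
      have e2 : 0 ≤ B * Real.exp (-(κ / 2) * |r - ρ|) := by positivity
      simp only [hq]
      linarith
    · rw [indicator_of_notMem hm, zero_add]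
      have hab : L ≤ |r - ρ| := by
        by_contra hcon
        obtain ⟨x1, x2⟩ := abs_lt.1 (not_le.1 hcon)
        exact hm ⟨by linarith, by linarith⟩
      obtain ⟨b1, b2, -, -⟩ := hC.2 r t hr0 ht
      have d1 := pow_le_pow_left₀ (norm_nonneg _) b1 2
      have d2 := pow_le_pow_left₀ (norm_nonneg _) b2 2
      have hfE : fireDens V u t r ≤ A * (2 * C ^ 2) :=
        hfd.trans (mul_le_mul_of_nonneg_left (by linarith) hA.le)
      calc Tpsi d D.lmin ρ r * fireDens V u t r
          ≤ (Real.exp (-(κ / 2) * L) * Real.exp (-(κ / 2) * |r - ρ|)) * (A * (2 * C ^ 2)) :=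
            mul_le_mul (hT.trans (exp_neg_abs_le hκ hab)) hfE hfn (by positivity)
        _ = _ := by rw [hB]; ring
  have h1 : F0 V d D.lmin u ρ t ≤ ∫ r in Ioi (0 : ℝ),
      (Set.indicator (Ioc (ρ - L) (ρ + L)) (fun r => A * q r) r
        + B * Real.exp (-(κ / 2) * |r - ρ|)) := by
    rw [F0_eq]
    exact setIntegral_mono_on (integrableOn_firewall hu hd hV hc D h0 hV0 ht ρ)
      (hI1.add hI2).integrableOn measurableSet_Ioi hpt
  have h2 : ∫ r in Ioi (0 : ℝ),
      (Set.indicator (Ioc (ρ - L) (ρ + L)) (fun r => A * q r) r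
        + B * Real.exp (-(κ / 2) * |r - ρ|)) ≤ ∫ r,
      (Set.indicator (Ioc (ρ - L) (ρ + L)) (fun r => A * q r) r
        + B * Real.exp (-(κ / 2) * |r - ρ|)) := by
    refine setIntegral_le_integral (hI1.add hI2) (ae_of_all _ fun r => ?_)
    exact add_nonneg (indicator_nonneg (fun r _ => mul_nonneg hA.le (hq0 r)) r) (by positivity)
  refine (h1.trans h2).trans (le_of_eq ?_)
  rw [integral_add hI1 hI2, integral_indicator measurableSet_Ioc, integral_const_mul,
    integral_const_mul, integral_exp_neg_abs (half_pos hκ),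
    intervalIntegral.integral_of_le (by linarith), hB]
  ring

/-- The escape set far from `ρ` contributes an exponentially small amount. -/
theorem setIntegral_Tpsi_le (hu : IsRadialSolution d V u) (hd : 2 ≤ d) (D : EscData n V)
    (ht : 0 < t) {ℓ : ℝ} (h : ∀ r, 0 ≤ r → |r - ρ| < ℓ → ‖u r t‖ ≤ D.dEsc) :
    ∫ r in Sigma0 u D.dEsc t, Tpsi d D.lmin ρ r ≤
      4 / kappa0 D.lmin * Real.exp (-(kappa0 D.lmin / 2) * ℓ) := by
  have hκ := kappa0_pos D.lmin_pos
  set κ := kappa0 D.lmin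
  have hS : MeasurableSet (Sigma0 u D.dEsc t) :=
    measurableSet_Ici.inter (isOpen_lt continuous_const (hu.continuous_r ht).norm).measurableSet
  have hI : Integrable fun r => Real.exp (-(κ / 2) * ℓ) * Real.exp (-(κ / 2) * |r - ρ|) :=
    (integrable_exp_neg_abs (half_pos hκ) ρ).const_mul _
  have hT : IntegrableOn (Tpsi d D.lmin ρ) (Sigma0 u D.dEsc t) := by
    refine Integrable.mono' (integrable_exp_neg_abs hκ ρ).integrableOn
      (measurable_Tpsi d D.lmin ρ).aestronglyMeasurable
      ((ae_restrict_iff' hS).2 (ae_of_all _ fun r hr => ?_))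
    rw [Real.norm_of_nonneg (Tpsi_nonneg hd hr.1)]
    exact Tpsi_le hd hr.1
  calc ∫ r in Sigma0 u D.dEsc t, Tpsi d D.lmin ρ r
      ≤ ∫ r in Sigma0 u D.dEsc t, Real.exp (-(κ / 2) * ℓ) * Real.exp (-(κ / 2) * |r - ρ|) := by
        refine setIntegral_mono_on hT hI.integrableOn hS fun r hr => ?_
        refine (Tpsi_le hd hr.1).trans (exp_neg_abs_le hκ ?_)
        by_contra hcon
        exact absurd (h r hr.1 (not_le.1 hcon)) (not_le.2 hr.2)
    _ ≤ ∫ r, Real.exp (-(κ / 2) * ℓ) * Real.exp (-(κ / 2) * |r - ρ|) :=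
        setIntegral_le_integral hI (ae_of_all _ fun r => by positivity)
    _ = _ := by
        rw [integral_const_mul, integral_exp_neg_abs (half_pos hκ)]
        field_simp
        norm_num

end Firewall

/-! ### Properties of the escape point -/

theorem exists_mul_exp_neg_le {μ E η : ℝ} (hμ : 0 < μ) (hη : 0 < η) :
    ∃ L > 0, E * Real.exp (-μ * L) ≤ η := by
  have h1 : Tendsto (fun L : ℝ => -μ * L) atTop atBot :=
    tendsto_id.const_mul_atTop_of_neg (neg_lt_zero.2 hμ)
  have h2 : Tendsto (fun L : ℝ => E * Real.exp (-μ * L)) atTop (𝓝 0) := by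
    simpa using (Real.tendsto_exp_atBot.comp h1).const_mul E
  obtain ⟨L, hL, hL'⟩ := ((eventually_gt_atTop 0).and (h2.eventually_le_const hη)).exists
  exact ⟨L, hL, hL'⟩

theorem le_of_deriv_le_relaxation {f : ℝ → ℝ} {ν q t s : ℝ} (hts : t ≤ s)
    (hf : ∀ x ∈ Icc t s, DifferentiableAt ℝ f x) (hf' : ∀ x ∈ Icc t s, deriv f x ≤ -ν * (f x - q))
    (h : f t ≤ q) : f s ≤ q := by
  have hder : ∀ x ∈ Icc t s, HasDerivAt (fun x => Real.exp (ν * x) * (f x - q))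
      (Real.exp (ν * x) * ν * (f x - q) + Real.exp (ν * x) * deriv f x) x := by
    intro x hx
    have e1 : HasDerivAt (fun x => Real.exp (ν * x)) (Real.exp (ν * x) * ν) x := by
      simpa using ((hasDerivAt_id x).const_mul ν).exp
    exact e1.mul ((hf x hx).hasDerivAt.sub_const q)
  have hanti : AntitoneOn (fun x => Real.exp (ν * x) * (f x - q)) (Icc t s) := by
    refine antitoneOn_of_deriv_nonpos (convex_Icc t s)
      (fun x hx => (hder x hx).continuousAt.continuousWithinAt)
      (fun x hx => (hder x (interior_subset hx)).differentiableAt.differentiableWithinAt)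
      fun x hx => ?_
    rw [(hder x (interior_subset hx)).deriv]
    have := mul_le_mul_of_nonneg_left (hf' x (interior_subset hx)) (Real.exp_pos (ν * x)).le
    nlinarith
  have h1 := hanti (left_mem_Icc.2 hts) (right_mem_Icc.2 hts) hts
  simp only at h1
  have h2 : Real.exp (ν * t) * (f t - q) ≤ 0 :=
    mul_nonpos_of_nonneg_of_nonpos (Real.exp_pos _).le (by linarith)
  have h3 := nonpos_of_mul_nonpos_right (h1.trans h2) (Real.exp_pos (ν * s))
  linarith

theorem exists_upper_speed_of_step {X : ℝ → ℝ} {τ B T : ℝ} (hτ : 0 < τ) (hB : 0 ≤ B)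
    (h : ∀ t ≥ T, ∀ t' ∈ Icc t (t + τ), X t' ≤ X t + B) :
    ∀ t ≥ T, ∀ s ≥ 0, X (t + s) ≤ X t + B / τ * s + B := by
  intro t ht s hs
  have hN : ∀ N : ℕ, X (t + N * τ) ≤ X t + N * B := by
    intro N
    induction N with
    | zero => simp
    | succ N ih =>
      have hN0 : 0 ≤ (N : ℝ) * τ := by positivity
      have := h (t + N * τ) (by linarith) (t + (N + 1 : ℕ) * τ)
        ⟨by push_cast; nlinarith, by push_cast; nlinarith⟩
      push_cast at this ⊢
      linarith
  have hfl := Nat.floor_le (div_nonneg hs hτ.le)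
  have hlt := Nat.lt_floor_add_one (s / τ)
  have e1 := (le_div_iff₀ hτ).1 hfl
  have e2 := (div_lt_iff₀ hτ).1 hlt
  have hp : 0 ≤ (⌊s / τ⌋₊ : ℝ) * τ := by positivity
  have h1 := h (t + ⌊s / τ⌋₊ * τ) (by linarith) (t + s) ⟨by linarith, by linarith⟩
  have h2 := hN ⌊s / τ⌋₊
  have h3 := mul_le_mul_of_nonneg_right hfl hB
  have e3 : s / τ * B = B / τ * s := by ring
  linarith

theorem hull_le {δ L₀ x : ℝ} (hx : 0 ≤ x) : hull δ L₀ x ≤ ((δ ^ 2 / 2 : ℝ) : EReal) := by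
  unfold hull
  rw [if_neg (not_lt.2 hx)]
  split_ifs with h
  · refine EReal.coe_le_coe_iff.2 (mul_le_of_le_one_right (by positivity) ?_)
    have : 0 ≤ x / (2 * L₀) := div_nonneg hx (by linarith)
    linarith
  · exact EReal.coe_le_coe_iff.2 (by nlinarith [sq_nonneg δ])

theorem hull_eq_of_lt {δ L₀ x : ℝ} (hx : max L₀ 0 < x) :
    hull δ L₀ x = ((δ ^ 2 / 4 : ℝ) : EReal) := by
  obtain ⟨h1, h2⟩ := max_lt_iff.1 hx
  unfold hull
  rw [if_neg (not_lt.2 h2.le), if_neg (not_le.2 h1)]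

theorem le_hull (δ L₀ x : ℝ) : ((δ ^ 2 / 4 : ℝ) : EReal) ≤ hull δ L₀ x := by
  unfold hull
  split_ifs with h1 h2
  · exact le_top
  · refine EReal.coe_le_coe_iff.2 ?_
    have : x / (2 * L₀) ≤ 1 / 2 := by
      rcases (not_lt.1 h1).trans h2 |>.eq_or_lt with h | h
      · simp [← h]
      · rw [div_le_iff₀ (by positivity)]
        linarith
    nlinarith [sq_nonneg δ]
  · exact le_rfl

/-- The standing assumptions under which the escape point is studied. -/
structure FirewallSetting (d : ℕ) (V : Euc n → ℝ) (D : EscData n V) (u : ℝ → ℝ → Euc n)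
    (ν K δ L₀ cHom : ℝ) (rHom : ℝ → ℝ) : Prop where
  sol : IsRadialSolution d V u
  two_le_dim : 2 ≤ d
  contDiff : ContDiff ℝ 2 V
  coercive : HCoerc V
  zero_mem : (0 : Euc n) ∈ MinSet V
  map_zero : V 0 = 0
  rate_pos : 0 < ν
  source_pos : 0 < K
  eq_deltaEsc : δ = deltaEsc D.dEsc (wV V) (kappa0 D.lmin)
  fire : FireIneq V d D.lmin D.dEsc u ν K
  hullBound : HullBound V d D.lmin u δ L₀ rHom
  hom : HHomWith u 0 cHom rHom
  deriv_nonneg : ∀ t : ℝ, 0 ≤ deriv rHom t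

namespace FirewallSetting

variable {d : ℕ} {V : Euc n → ℝ} {D : EscData n V} {u : ℝ → ℝ → Euc n}
  {ν K δ L₀ cHom : ℝ} {rHom : ℝ → ℝ}

theorem delta_pos (S : FirewallSetting d V D u ν K δ L₀ cHom rHom) : 0 < δ := by
  have h1 := min_wV_pos V
  have h2 := kappa0_pos D.lmin_pos
  rw [S.eq_deltaEsc, deltaEsc]
  exact mul_pos D.dEsc_pos (Real.sqrt_pos.2 (by positivity))

theorem norm_lt (S : FirewallSetting d V D u ν K δ L₀ cHom rHom) {ρ t : ℝ} (ht : 0 < t)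
    (hρ : rsc d D.lmin ≤ ρ) (h : F0 V d D.lmin u ρ t ≤ δ ^ 2 / 2) : ‖u ρ t‖ < D.dEsc := by
  have h1 := norm_sq_le_F0 S.sol S.two_le_dim S.contDiff S.coercive D S.zero_mem S.map_zero ht hρ
  have h2 := min_wV_pos V
  have h3 := kappa0_pos D.lmin_pos
  have hd := D.dEsc_pos
  have h4 : δ ^ 2 = min (wV V / 2) (1 / 4) / (kappa0 D.lmin + 1) * D.dEsc ^ 2 := by
    rw [S.eq_deltaEsc, deltaEsc, mul_pow, Real.sq_sqrt (by positivity), mul_comm]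
  have h5 : min (wV V / 2) (1 / 4) / (kappa0 D.lmin + 1) * ‖u ρ t‖ ^ 2 ≤
      min (wV V / 2) (1 / 4) / (kappa0 D.lmin + 1) * (D.dEsc ^ 2 / 2) := by linarith
  have h6 := le_of_mul_le_mul_left h5 (by positivity)
  exact lt_of_pow_lt_pow_left₀ 2 hd.le (by nlinarith)

theorem F0_nonneg (S : FirewallSetting d V D u ν K δ L₀ cHom rHom) (ρ t : ℝ) :
    0 ≤ F0 V d D.lmin u ρ t :=
  setIntegral_nonneg measurableSet_Ioi fun r hr =>
    mul_nonneg (Tpsi_nonneg S.two_le_dim (le_of_lt hr))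
      (fireDens_nonneg S.contDiff S.coercive D S.zero_mem S.map_zero t r)

theorem sub_one_mem_rescSet (S : FirewallSetting d V D u ν K δ L₀ cHom rHom) {t : ℝ} (ht : 0 ≤ t) :
    rHom t - 1 ∈ rescSet V d D.lmin u δ L₀ rHom t := by
  obtain ⟨h1, h2⟩ := S.hullBound t ht
  exact ⟨⟨h1, by linarith⟩, h2⟩

theorem rescF_le_of_mem {t r : ℝ} (hr : r ∈ rescSet V d D.lmin u δ L₀ rHom t) :
    rescF V d D.lmin u δ L₀ rHom t ≤ r :=
  csInf_le ⟨rsc d D.lmin, fun _ hx => hx.1.1⟩ hr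

theorem rescF_le (S : FirewallSetting d V D u ν K δ L₀ cHom rHom) {t : ℝ} (ht : 0 ≤ t) :
    rescF V d D.lmin u δ L₀ rHom t ≤ rHom t - 1 :=
  rescF_le_of_mem (S.sub_one_mem_rescSet ht)

theorem rsc_le_rescF (S : FirewallSetting d V D u ν K δ L₀ cHom rHom) {t : ℝ} (ht : 0 ≤ t) :
    rsc d D.lmin ≤ rescF V d D.lmin u δ L₀ rHom t :=
  le_csInf ⟨_, S.sub_one_mem_rescSet ht⟩ fun _ hx => hx.1.1

theorem F0_le_half (S : FirewallSetting d V D u ν K δ L₀ cHom rHom) {t r : ℝ} (ht : 0 ≤ t)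
    (hr : rescF V d D.lmin u δ L₀ rHom t < r) (hr' : r ≤ rHom t) :
    F0 V d D.lmin u r t ≤ δ ^ 2 / 2 := by
  obtain ⟨rl, hrl, hlt⟩ := exists_lt_of_csInf_lt ⟨_, S.sub_one_mem_rescSet ht⟩ hr
  have h := hrl.2 r (hrl.1.1.trans hlt.le)
  exact EReal.coe_le_coe_iff.1
    (h.trans (max_le (hull_le (by linarith)) (hull_le (by linarith))))

theorem F0_le_quarter (S : FirewallSetting d V D u ν K δ L₀ cHom rHom) {t r : ℝ} (ht : 0 ≤ t)
    (hr : rescF V d D.lmin u δ L₀ rHom t + max L₀ 0 < r) (hr' : r < rHom t - max L₀ 0) :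
    F0 V d D.lmin u r t ≤ δ ^ 2 / 4 := by
  obtain ⟨rl, hrl, hlt⟩ := exists_lt_of_csInf_lt ⟨_, S.sub_one_mem_rescSet ht⟩
    (show rescF V d D.lmin u δ L₀ rHom t < r - max L₀ 0 by linarith)
  have h := hrl.2 r (hrl.1.1.trans (by linarith [le_max_right L₀ 0]))
  rw [hull_eq_of_lt (by linarith), hull_eq_of_lt (by linarith), max_self] at h
  exact EReal.coe_le_coe_iff.1 h

theorem rescF_le_of_F0_le {t rl : ℝ} (h1 : rsc d D.lmin ≤ rl) (h2 : rl ≤ rHom t)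
    (h : ∀ r ∈ Icc rl (rHom t), F0 V d D.lmin u r t ≤ δ ^ 2 / 4) :
    rescF V d D.lmin u δ L₀ rHom t ≤ rl := by
  refine rescF_le_of_mem ⟨⟨h1, h2⟩, fun r _ => ?_⟩
  rcases lt_or_ge r rl with hr | hr
  · refine le_max_of_le_left (le_top.trans (le_of_eq ?_))
    rw [hull, if_pos (by linarith)]
  · rcases lt_or_ge (rHom t) r with hr' | hr'
    · refine le_max_of_le_right (le_top.trans (le_of_eq ?_))
      rw [hull, if_pos (by linarith)]
    · exact le_max_of_le_left ((EReal.coe_le_coe_iff.2 (h r ⟨hr, hr'⟩)).trans (le_hull _ _ _))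

theorem exists_rHom_bounds (S : FirewallSetting d V D u ν K δ L₀ cHom rHom) :
    ∃ T > 0, ∀ t ≥ T, ∀ t' ≥ t,
      cHom / 2 * (t' - t) ≤ rHom t' - rHom t ∧ rHom t' - rHom t ≤ 2 * cHom * (t' - t) := by
  obtain ⟨hc, hdiff, hlim, -⟩ := S.hom
  have h1 := hlim.eventually_const_lt (show cHom / 2 < cHom by linarith)
  have h2 := hlim.eventually_lt_const (show cHom < 2 * cHom by linarith)
  obtain ⟨T, hT⟩ := eventually_atTop.1 (h1.and h2)
  refine ⟨max T 1, lt_max_of_lt_right one_pos, fun t ht t' htt' => ?_⟩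
  have hTt := (le_max_left _ _).trans ht
  have hcont : ContinuousOn rHom (Ici t) := fun x _ => (hdiff x).continuousAt.continuousWithinAt
  have hd : DifferentiableOn ℝ rHom (interior (Ici t)) := fun x _ => (hdiff x).differentiableWithinAt
  have hmem : ∀ x ∈ interior (Ici t), T ≤ x := fun x hx => hTt.trans (interior_subset hx)
  exact ⟨(convex_Ici t).mul_sub_le_image_sub_of_le_deriv hcont hd
      (fun x hx => (hT x (hmem x hx)).1.le) t self_mem_Ici t' htt' htt',
    (convex_Ici t).image_sub_le_mul_sub_of_deriv_le hcont hd
      (fun x hx => (hT x (hmem x hx)).2.le) t self_mem_Ici t' htt' htt'⟩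

theorem tendsto_rHom (S : FirewallSetting d V D u ν K δ L₀ cHom rHom) :
    Tendsto rHom atTop atTop := by
  obtain ⟨T, -, hT⟩ := S.exists_rHom_bounds
  have h1 : Tendsto (fun t => cHom / 2 * (t - T) + rHom T) atTop atTop :=
    tendsto_atTop_add_const_right _ _
      ((tendsto_atTop_add_const_right _ (-T) tendsto_id).const_mul_atTop (half_pos S.hom.1))
  refine tendsto_atTop_mono' _ ?_ h1
  filter_upwards [eventually_ge_atTop T] with t ht
  linarith [(hT T le_rfl t ht).1]

theorem eventually_F0_le_near_rHom (S : FirewallSetting d V D u ν K δ L₀ cHom rHom) {L : ℝ}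
    (hL : 0 ≤ L) : ∀ᶠ t in atTop, ∀ r ∈ Icc (rHom t - L) (rHom t),
      F0 V d D.lmin u r t ≤ δ ^ 2 / 4 := by
  obtain ⟨A, hA, E, hE, hF⟩ := exists_F0_le S.sol S.two_le_dim S.contDiff S.coercive D S.zero_mem
    S.map_zero
  have hδ := S.delta_pos
  obtain ⟨L', hL', hsmall⟩ := exists_mul_exp_neg_le (E := E) (η := δ ^ 2 / 8)
    (half_pos (kappa0_pos D.lmin_pos)) (by positivity)
  have hlim := (S.hom.2.2.2 (L + L') (by linarith)).const_mul A
  rw [mul_zero] at hlim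
  filter_upwards [hlim.eventually_le_const (show 0 < δ ^ 2 / 8 by positivity),
    S.tendsto_rHom.eventually_ge_atTop (L + L'), eventually_gt_atTop 0] with t h1 h2 ht r hr
  refine (hF r t L' ht hL'.le (by linarith [hr.1])).trans ?_
  have c1 := S.sol.continuous_r ht
  have c2 := S.sol.continuous_ur ht
  have hq : Continuous fun r => ‖u r t‖ ^ 2 + ‖ur u r t‖ ^ 2 := by fun_prop
  simp only [sub_zero] at h1
  rw [intervalIntegral.integral_comp_add_left (fun r => ‖u r t‖ ^ 2 + ‖ur u r t‖ ^ 2)] at h1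
  have h3 : ∫ r in (r - L')..(r + L'), (‖u r t‖ ^ 2 + ‖ur u r t‖ ^ 2) ≤
      ∫ r in (rHom t + -(L + L'))..(rHom t + (L + L')), (‖u r t‖ ^ 2 + ‖ur u r t‖ ^ 2) :=
    intervalIntegral.integral_mono_interval (by linarith [hr.1]) (by linarith)
      (by linarith [hr.2]) (ae_of_all _ fun r => by positivity) (hq.intervalIntegrable _ _)
  have h4 := mul_le_mul_of_nonneg_left h3 hA.le
  linarith

theorem tendsto_gap (S : FirewallSetting d V D u ν K δ L₀ cHom rHom) :
    Tendsto (fun t => rHom t - rescF V d D.lmin u δ L₀ rHom t) atTop atTop := by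
  refine tendsto_atTop.2 fun L => ?_
  filter_upwards [S.eventually_F0_le_near_rHom (le_max_right L 0),
    S.tendsto_rHom.eventually_ge_atTop (rsc d D.lmin + max L 0)] with t h1 h2
  have h3 : rescF V d D.lmin u δ L₀ rHom t ≤ rHom t - max L 0 :=
    rescF_le_of_F0_le (by linarith) (by linarith [le_max_right L 0]) h1
  linarith [le_max_left L 0]

theorem eventually_F0_le_quarter (S : FirewallSetting d V D u ν K δ L₀ cHom rHom) :
    ∀ᶠ t in atTop, ∀ r ∈ Icc (rescF V d D.lmin u δ L₀ rHom t + (max L₀ 0 + 1)) (rHom t),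
      F0 V d D.lmin u r t ≤ δ ^ 2 / 4 := by
  filter_upwards [S.eventually_F0_le_near_rHom (le_max_right L₀ 0), eventually_ge_atTop 0]
    with t h1 ht r hr
  rcases lt_or_ge r (rHom t - max L₀ 0) with h | h
  · exact S.F0_le_quarter ht (by linarith [hr.1]) h
  · exact h1 r ⟨h, hr.2⟩

theorem exists_step (S : FirewallSetting d V D u ν K δ L₀ cHom rHom) :
    ∃ τ > 0, ∃ B ≥ 0, ∃ T, ∀ t ≥ T, ∀ t' ∈ Icc t (t + τ),
      rescF V d D.lmin u δ L₀ rHom t' ≤ rescF V d D.lmin u δ L₀ rHom t + B := by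
  have hκ := kappa0_pos D.lmin_pos
  have hδ := S.delta_pos
  have hK := S.source_pos
  have hν := S.rate_pos
  have hc := S.hom.1
  set X := rescF V d D.lmin u δ L₀ rHom
  set κ := kappa0 D.lmin with hκdef
  set τ := δ ^ 2 * κ / (16 * K) with hτdef
  have hτ : 0 < τ := by positivity
  obtain ⟨L₁, hL₁, hsmall⟩ := exists_mul_exp_neg_le (E := K * (4 / κ)) (η := ν * (δ ^ 2 / 4))
    (half_pos hκ) (by positivity)
  obtain ⟨T₁, hT₁, hrH⟩ := S.exists_rHom_bounds
  obtain ⟨T₂, hT₂⟩ := eventually_atTop.1 (S.eventually_F0_le_quarter.and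
    (S.eventually_F0_le_near_rHom (show 0 ≤ L₁ + 2 * cHom * τ by positivity)))
  have hLp := le_max_right L₀ 0
  refine ⟨τ, hτ, max L₀ 0 + 1 + L₁, by linarith, max T₁ T₂, fun t ht t' ht' => ?_⟩
  have hT1t : T₁ ≤ t := (le_max_left _ _).trans ht
  have hT2t : T₂ ≤ t := (le_max_right _ _).trans ht
  have ht0 : 0 < t := hT₁.trans_le hT1t
  have ht'0 : 0 < t' := ht0.trans_le ht'.1
  set a := X t + (max L₀ 0 + 1) with ha
  have hsc : rsc d D.lmin ≤ a := by linarith [S.rsc_le_rescF ht0.le]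
  have hinit : ∀ r ∈ Icc a (rHom t), F0 V d D.lmin u r t ≤ δ ^ 2 / 4 := (hT₂ t hT2t).1
  have hstay : ∀ r ∈ Icc a (rHom t), ∀ s ∈ Icc t (t + τ), F0 V d D.lmin u r s ≤ δ ^ 2 / 2 := by
    intro r hr s hs
    have hrs := hsc.trans hr.1
    have h1 : F0 V d D.lmin u r s - F0 V d D.lmin u r t ≤ K * (4 / κ) * (s - t) := by
      have hpos : ∀ x ∈ Ici t, 0 < x := fun x hx => ht0.trans_le hx
      refine (convex_Ici t).image_sub_le_mul_sub_of_deriv_le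
        (f := fun s => F0 V d D.lmin u r s)
        (fun x hx => (S.fire r hrs x (hpos x hx)).1.continuousAt.continuousWithinAt)
        (fun x hx => (S.fire r hrs x
          (hpos x (interior_subset hx))).1.differentiableWithinAt) (fun x hx => ?_)
        t self_mem_Ici s hs.1 hs.1
      have hx0 := hpos x (interior_subset hx)
      have e1 := (S.fire r hrs x hx0).2
      have e2 := setIntegral_Tpsi_le (ρ := r) (ℓ := 0) S.sol S.two_le_dim D hx0
        fun y _ hy => absurd hy (not_lt.2 (abs_nonneg _))
      rw [mul_zero, Real.exp_zero, mul_one] at e2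
      have e3 := mul_le_mul_of_nonneg_left e2 hK.le
      have e4 : 0 ≤ ν * F0 V d D.lmin u r x := mul_nonneg hν.le (S.F0_nonneg r x)
      linarith
    have h2 : K * (4 / κ) * (s - t) ≤ δ ^ 2 / 4 := by
      calc K * (4 / κ) * (s - t) ≤ K * (4 / κ) * τ :=
            mul_le_mul_of_nonneg_left (by linarith [hs.2]) (by positivity)
        _ = δ ^ 2 / 4 := by rw [hτdef]; field_simp; norm_num
    linarith [hinit r hr]
  have hinner : ∀ r ∈ Icc (a + L₁) (rHom t - L₁), F0 V d D.lmin u r t' ≤ δ ^ 2 / 4 := by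
    intro r hr
    have hrs : rsc d D.lmin ≤ r := by linarith [hr.1]
    refine le_of_deriv_le_relaxation (f := fun s => F0 V d D.lmin u r s) (ν := ν) ht'.1
      (fun x hx => (S.fire r hrs x (ht0.trans_le hx.1)).1) (fun x hx => ?_)
      (hinit r ⟨by linarith [hr.1], by linarith [hr.2]⟩)
    have hx0 : 0 < x := ht0.trans_le hx.1
    have e1 := (S.fire r hrs x hx0).2
    have e2 := setIntegral_Tpsi_le (ρ := r) (ℓ := L₁) S.sol S.two_le_dim D hx0
      fun y _ hy => by
        obtain ⟨y1, y2⟩ := abs_lt.1 hy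
        have hy' : y ∈ Icc a (rHom t) := ⟨by linarith [hr.1], by linarith [hr.2]⟩
        exact (S.norm_lt hx0 (hsc.trans hy'.1)
          (hstay y hy' x ⟨hx.1, hx.2.trans ht'.2⟩)).le
    have e3 := mul_le_mul_of_nonneg_left e2 hK.le
    rw [← mul_assoc] at e3
    have e4 := e3.trans hsmall
    linarith
  have hfinal : X t' ≤ a + L₁ := by
    rcases le_or_gt (a + L₁) (rHom t') with h | h
    · refine rescF_le_of_F0_le (by linarith) h fun r hr => ?_
      rcases le_or_gt r (rHom t - L₁) with hr' | hr'
      · exact hinner r ⟨hr.1, hr'⟩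
      · refine (hT₂ t' (hT2t.trans ht'.1)).2 r ⟨?_, hr.2⟩
        have e1 := (hrH t hT1t t' ht'.1).2
        have e2 : 2 * cHom * (t' - t) ≤ 2 * cHom * τ :=
          mul_le_mul_of_nonneg_left (by linarith [ht'.2]) (by positivity)
        linarith
    · linarith [S.rescF_le ht'0.le]
  linarith

theorem isBoundedUnder_rescF_div (S : FirewallSetting d V D u ν K δ L₀ cHom rHom) :
    IsBoundedUnder (· ≤ ·) atTop (fun t => rescF V d D.lmin u δ L₀ rHom t / t) := by
  obtain ⟨T, hT, hr⟩ := S.exists_rHom_bounds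
  have hc := S.hom.1
  refine isBoundedUnder_of_eventually_le (a := |rHom T| + 2 * cHom) ?_
  filter_upwards [eventually_ge_atTop T, eventually_ge_atTop 1] with t ht ht1
  rw [div_le_iff₀ (by linarith)]
  have h1 := (hr T le_rfl t ht).2
  have h2 := S.rescF_le (show 0 ≤ t by linarith)
  have h3 := le_abs_self (rHom T)
  have h4 : |rHom T| ≤ |rHom T| * t := le_mul_of_one_le_right (abs_nonneg _) ht1
  have h5 : 0 ≤ 2 * cHom * T := by positivity
  nlinarith

theorem rescF_div_nonneg (S : FirewallSetting d V D u ν K δ L₀ cHom rHom) {t : ℝ} (ht : 0 ≤ t) :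
    0 ≤ rescF V d D.lmin u δ L₀ rHom t / t :=
  div_nonneg ((rsc_pos S.two_le_dim D.lmin).le.trans (S.rsc_le_rescF ht)) ht

theorem rEscF_le_rescF (S : FirewallSetting d V D u ν K δ L₀ cHom rHom) {t : ℝ} (ht : 0 < t) :
    rEscF u 0 D.dEsc rHom t ≤ rescF V d D.lmin u δ L₀ rHom t := by
  have hsc := S.rsc_le_rescF ht.le
  refine Real.sSup_le (fun r hr => ?_) ((rsc_pos S.two_le_dim D.lmin).le.trans hsc)
  by_contra hlt
  have hlt := not_le.1 hlt
  have h1 := S.norm_lt ht (hsc.trans hlt.le) (S.F0_le_half ht.le hlt hr.1.2)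
  have h2 := hr.2
  rw [sub_zero] at h2
  exact h1.ne h2

theorem cEscV_le_limsup (S : FirewallSetting d V D u ν K δ L₀ cHom rHom) :
    cEscV u 0 D.dEsc rHom ≤ limsup (fun t => rescF V d D.lmin u δ L₀ rHom t / t) atTop := by
  refine limsup_le_limsup ?_ ?_ S.isBoundedUnder_rescF_div
  · filter_upwards [eventually_gt_atTop 0] with t ht
    exact div_le_div_of_nonneg_right (S.rEscF_le_rescF ht) ht.le
  · refine IsBoundedUnder.isCoboundedUnder_le (isBoundedUnder_of_eventually_ge (a := 0) ?_)
    filter_upwards [eventually_ge_atTop 0] with t ht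
    exact div_nonneg (Real.sSup_nonneg fun r hr => hr.1.1) ht

theorem exists_trigger (S : FirewallSetting d V D u ν K δ L₀ cHom rHom)
    (hX : Tendsto (rescF V d D.lmin u δ L₀ rHom) atTop atTop) :
    ∃ M η T, 0 < η ∧ ∀ t ≥ T, ∃ r, |r - rescF V d D.lmin u δ L₀ rHom t| ≤ M ∧
      η ≤ ‖u r t‖ + ‖ur u r t‖ := by
  obtain ⟨A, hA, E, hE, hF⟩ := exists_F0_le S.sol S.two_le_dim S.contDiff S.coercive D S.zero_mem
    S.map_zero
  have hδ := S.delta_pos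
  obtain ⟨L, hL, hsmall⟩ := exists_mul_exp_neg_le (E := E) (η := δ ^ 2 / 8)
    (half_pos (kappa0_pos D.lmin_pos)) (by positivity)
  have hη : 0 < Real.sqrt (δ ^ 2 / (16 * A * L)) := Real.sqrt_pos.2 (by positivity)
  have hη2 := Real.sq_sqrt (show 0 ≤ δ ^ 2 / (16 * A * L) by positivity)
  set η := Real.sqrt (δ ^ 2 / (16 * A * L))
  obtain ⟨T, hT⟩ := eventually_atTop.1 (S.eventually_F0_le_quarter.and
    ((hX.eventually_ge_atTop (rsc d D.lmin + L + 1)).and (eventually_gt_atTop 0)))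
  refine ⟨max L₀ 0 + 1 + L, η, T, hη, fun t ht => ?_⟩
  obtain ⟨h1, h2, ht0⟩ := hT t ht
  set X := rescF V d D.lmin u δ L₀ rHom
  have hLp := le_max_right L₀ 0
  have hsc := rsc_pos S.two_le_dim D.lmin
  by_contra! hcon
  have hle : X t ≤ X t - 1 := by
    refine rescF_le_of_F0_le (by linarith) (by linarith [S.rescF_le ht0.le]) fun r hr => ?_
    rcases le_or_gt (X t + (max L₀ 0 + 1)) r with h | h
    · exact h1 r ⟨h, hr.2⟩
    · refine (hF r t L ht0 hL.le (by linarith [hr.1])).trans ?_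
      have c1 := S.sol.continuous_r ht0
      have c2 := S.sol.continuous_ur ht0
      have hq : Continuous fun r => ‖u r t‖ ^ 2 + ‖ur u r t‖ ^ 2 := by fun_prop
      have h3 : ∫ r in (r - L)..(r + L), (‖u r t‖ ^ 2 + ‖ur u r t‖ ^ 2) ≤
          ∫ _ in (r - L)..(r + L), η ^ 2 := by
        refine intervalIntegral.integral_mono_on (by linarith) (hq.intervalIntegrable _ _)
          intervalIntegrable_const fun y hy => ?_
        have e := hcon y (abs_le.2 ⟨by linarith [hy.1, hr.1], by linarith [hy.2]⟩)
        have n1 := norm_nonneg (u y t)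
        have n2 := norm_nonneg (ur u y t)
        nlinarith
      rw [intervalIntegral.integral_const, smul_eq_mul, hη2] at h3
      have h4 := mul_le_mul_of_nonneg_left h3 hA.le
      have h5 : A * ((r + L - (r - L)) * (δ ^ 2 / (16 * A * L))) = δ ^ 2 / 8 := by
        field_simp
        ring
      linarith
  linarith

theorem isEscapePoint (S : FirewallSetting d V D u ν K δ L₀ cHom rHom) {c : ℝ}
    (hinv : 0 < cEscV u 0 D.dEsc rHom)
    (hinf : liminf (fun t => rescF V d D.lmin u δ L₀ rHom t / t) atTop = c)
    (hsup : limsup (fun t => rescF V d D.lmin u δ L₀ rHom t / t) atTop = c) :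
    IsEscapePoint V D u (rescF V d D.lmin u δ L₀ rHom) rHom c := by
  have hc : 0 < c := hinv.trans_le (hsup ▸ S.cEscV_le_limsup)
  have hdiv : Tendsto (fun t => rescF V d D.lmin u δ L₀ rHom t / t) atTop (𝓝 c) := by
    refine tendsto_of_liminf_eq_limsup hinf hsup S.isBoundedUnder_rescF_div
      (isBoundedUnder_of_eventually_ge (a := 0) ?_)
    filter_upwards [eventually_ge_atTop 0] with t ht
    exact S.rescF_div_nonneg ht
  have hX : Tendsto (rescF V d D.lmin u δ L₀ rHom) atTop atTop := by
    refine (hdiv.pos_mul_atTop hc tendsto_id).congr' ?_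
    filter_upwards [eventually_ne_atTop 0] with t ht
    exact div_mul_cancel₀ _ ht
  obtain ⟨τ, hτ, B, hB, T, hT⟩ := S.exists_step
  exact
    { norm_le := fun t ht r hr hr' => (S.norm_lt ht ((S.rsc_le_rescF ht.le).trans hr.le)
        (S.F0_le_half ht.le hr hr')).le
      mono := (monotone_of_deriv_nonneg S.hom.2.1 S.deriv_nonneg).monotoneOn _
      gap := S.tendsto_gap
      speed_pos := hc
      tendsto_div := hdiv
      exists_speed := ⟨B / τ, B, T, exists_upper_speed_of_step hτ hB hT⟩
      exists_trigger := S.exists_trigger hX }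

end FirewallSetting

/-- regular occurrence of small dissipation. -/
theorem stmt16 {n d k : ℕ} (hn : 1 ≤ n) (hd : 2 ≤ d) (hk : 2 ≤ k)
    (V : Euc n → ℝ) (hV : ContDiff ℝ (k : ℕ∞) V) (hcoerc : HCoerc V)
    (D : EscData n V) (hgen : HGen V D.dEsc)
    (h0 : (0 : Euc n) ∈ MinSet V) (hV0 : V 0 = 0)
    (u : ℝ → ℝ → Euc n) (hu : IsRadialSolution d V u)
    (cHom : ℝ) (rHom : ℝ → ℝ) (hhom : HHomWith u 0 cHom rHom)
    (hrHom' : ∀ t : ℝ, 0 ≤ deriv rHom t)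
    (hinv : 0 < cEscV u 0 D.dEsc rHom)
    (ν K δ L₀ cno : ℝ) (hν : 0 < ν) (hK : 0 < K)
    (hδ : δ = deltaEsc D.dEsc (wV V) (kappa0 D.lmin))
    (hL : L₀ = L0c (kappa0 D.lmin) ν K δ)
    (hcno : cno = cNoEsc (kappa0 D.lmin) K L₀ δ)
    (hfire : FireIneq V d D.lmin D.dEsc u ν K)
    (hhull : HullBound V d D.lmin u δ L₀ rHom)
    (cesc : ℝ)
    (hcesc₁ : liminf (fun t => rescF V d D.lmin u δ L₀ rHom t / t) atTop = cesc)
    (hcesc₂ : limsup (fun t => rescF V d D.lmin u δ L₀ rHom t / t) atTop = cesc) :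
    ∀ ε > (0:ℝ), ∃ T > (0:ℝ), ∀ t ≥ (1:ℝ),
      sInf ((fun t' => deltaDissip u (rescF V d D.lmin u δ L₀ rHom) cesc t') ''
        Icc t (t + T)) ≤ ε := by
  intro ε hε
  have hV2 : ContDiff ℝ 2 V := hV.of_le (WithTop.coe_le_coe.2 (by exact_mod_cast hk))
  have S : FirewallSetting d V D u ν K δ L₀ cHom rHom :=
    ⟨hu, hd, hV2, hcoerc, h0, hV0, hν, hK, hδ, hfire, hhull, hhom, hrHom'⟩
  exact (S.isEscapePoint hinv hcesc₁ hcesc₂).exists_sInf_deltaDissip_le hu hV2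
    (one_le_two.trans hd) h0 hV0 hgen.1 hgen.2.1 hgen.2.2.1 hε
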